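/- arXiv:2009.05659 — 3 statements merged into one kernel-verified Lean document; each statement's English description precedes it below -/
import Mathlib

section
/- Let T > 0, let μ be a modulus of continuity satisfying the Osgood condition, let α ∈ (0,1), and let (a_{jk}(t,x))_{jk} be a real symmetric matrix of bounded measurable coefficients on [0,T]×ℝⁿ satisfying, for some λ₀ ∈ (0,1) and C > 0: Σ_{j,k} a_{jk}(t,x)ξ_jξ_k ≥ λ₀|ξ|², |a_{jk}(t,x) − a_{jk}(s,x)| ≤ C|t−s|^α, |a_{jk}(t,x) − a_{jk}(t,y)| ≤ C|x−y|, and for every t ∈ (0,T], sup_{s₁,s₂ ∈ [t,T], x} |a_{jk}(s₁,x) − a_{jk}(s₂,x)|/μ(|s₁−s₂|) ≤ C t^{α−1}. Then there exist γ₀ > 0 and C' > 0 such that for all γ > γ₀ and all u ∈ C₀^∞(ℝ^{n+1}) with supp u ⊆ [0, T/2]×ℝⁿ: ∫₀^{T/2} e^{(2/γ)Φ_γ(γ(T−t))} ‖∂_t u + Σ_{j,k} ∂_{x_j}(a_{jk}(t,·)∂_{x_k}u)‖²_{L²(ℝⁿ)} dt ≥ C' γ^{1/2} ∫₀^{T/2}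 e^{(2/γ)Φ_γ(γ(T−t))} (‖∇_x u‖²_{L²(ℝⁿ)} + γ^{1/2}‖u‖²_{L²(ℝⁿ)}) dt. -/
open Set MeasureTheory

/-- `φ(t) = ∫_{1/t}^1 1/μ(s) ds`. -/
noncomputable def phiF (μ : ℝ → ℝ) (t : ℝ) : ℝ := ∫ s in (1/t)..1, 1 / μ s

/-- `ψ_γ(τ) = φ⁻¹(γ ∫₀^{τ/γ} (T−s)^{α−1} ds)`, the inverse being that of the
bijection `φ : [1,∞) → [0,∞)`. -/
noncomputable def psiF (μ : ℝ → ℝ) (T α γ τ : ℝ) : ℝ :=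
  Function.invFunOn (phiF μ) (Ici 1) (γ * ∫ s in (0:ℝ)..(τ/γ), (T - s) ^ (α - 1))

/-- `Φ_γ(τ) = ∫₀^τ ψ_γ(σ) dσ`. -/
noncomputable def PhiF (μ : ℝ → ℝ) (T α γ τ : ℝ) : ℝ :=
  ∫ σ in (0:ℝ)..τ, psiF μ T α γ σ

namespace Carl

structure Mod (μ : ℝ → ℝ) : Prop where
  cont : ContinuousOn μ (Icc 0 1)
  conc : ConcaveOn ℝ (Icc 0 1) μ
  mono : StrictMonoOn μ (Icc 0 1)
  maps : MapsTo μ (Icc 0 1) (Icc 0 1)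
  zero : μ 0 = 0
  one : μ 1 = 1
  osg : (∫⁻ s in Ioc (0:ℝ) 1, ENNReal.ofReal (1 / μ s)) = ⊤

variable {μ : ℝ → ℝ}

lemma Mod.ge (h : Mod μ) {s : ℝ} (hs : s ∈ Icc (0:ℝ) 1) : s ≤ μ s := by
  have h0 : (0:ℝ) ∈ Icc (0:ℝ) 1 := by simp
  have h1 : (1:ℝ) ∈ Icc (0:ℝ) 1 := by simp
  have := h.conc.2 h0 h1 (sub_nonneg.2 hs.2) hs.1 (by ring)
  simpa [h.zero, h.one] using this

lemma Mod.le_one (h : Mod μ) {s : ℝ} (hs : s ∈ Icc (0:ℝ) 1) : μ s ≤ 1 := (h.maps hs).2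

lemma Mod.pos (h : Mod μ) {s : ℝ} (hs : s ∈ Ioc (0:ℝ) 1) : 0 < μ s :=
  hs.1.trans_le (h.ge ⟨hs.1.le, hs.2⟩)

lemma Mod.inv_cont (h : Mod μ) : ContinuousOn (fun s => 1 / μ s) (Ioc 0 1) :=
  continuousOn_const.div (h.cont.mono Ioc_subset_Icc_self) fun s hs => (h.pos hs).ne'

lemma uIcc_sub {a b : ℝ} (ha : a ∈ Ioc (0:ℝ) 1) (hb : b ∈ Ioc (0:ℝ) 1) : uIcc a b ⊆ Ioc 0 1 :=
  ordConnected_Ioc.uIcc_subset ha hb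

lemma Mod.ii (h : Mod μ) {a b : ℝ} (ha : a ∈ Ioc (0:ℝ) 1) (hb : b ∈ Ioc (0:ℝ) 1) :
    IntervalIntegrable (fun s => 1 / μ s) volume a b :=
  (h.inv_cont.mono (uIcc_sub ha hb)).intervalIntegrable

noncomputable def Mf (μ : ℝ → ℝ) (q : ℝ) : ℝ := ∫ s in q..1, 1 / μ s

lemma one_mem : (1:ℝ) ∈ Ioc (0:ℝ) 1 := by simp

lemma Mod.Mf_eq (h : Mod μ) {a b : ℝ} (ha : a ∈ Ioc (0:ℝ) 1) (hb : b ∈ Ioc (0:ℝ) 1) :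
    Mf μ a - Mf μ b = ∫ s in a..b, 1 / μ s := by
  unfold Mf
  rw [← intervalIntegral.integral_add_adjacent_intervals (h.ii ha hb) (h.ii hb one_mem)]
  ring

lemma Mod.Mf_sub (h : Mod μ) {a b : ℝ} (ha : a ∈ Ioc (0:ℝ) 1) (hb : b ∈ Ioc (0:ℝ) 1)
    (hab : a ≤ b) : b - a ≤ Mf μ a - Mf μ b := by
  rw [h.Mf_eq ha hb]
  have : ∫ s in a..b, (1:ℝ) = b - a := by simp
  rw [← this]
  refine intervalIntegral.integral_mono_on hab (by simp) (h.ii ha hb) fun s hs => ?_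
  have hs' : s ∈ Ioc (0:ℝ) 1 := ⟨ha.1.trans_le hs.1, hs.2.trans hb.2⟩
  rw [le_div_iff₀ (h.pos hs'), one_mul]
  exact h.le_one ⟨hs'.1.le, hs'.2⟩

lemma Mod.Mf_dist (h : Mod μ) {a b : ℝ} (ha : a ∈ Ioc (0:ℝ) 1) (hb : b ∈ Ioc (0:ℝ) 1) :
    |a - b| ≤ |Mf μ a - Mf μ b| := by
  rcases le_total a b with hab | hab
  · have := h.Mf_sub ha hb hab
    rw [abs_sub_comm, abs_of_nonneg (by linarith), abs_of_nonneg (by linarith)]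
    exact this
  · have := h.Mf_sub hb ha hab
    rw [abs_of_nonneg (by linarith), abs_sub_comm, abs_of_nonneg (by linarith)]
    exact this

lemma Mod.Mf_one : Mf μ 1 = 0 := by simp [Mf]

lemma Mod.Mf_log (h : Mod μ) {q : ℝ} (hq : q ∈ Ioc (0:ℝ) 1) : Mf μ q ≤ - Real.log q := by
  have e : ∫ s in q..1, 1 / s = - Real.log q := by
    rw [integral_one_div_of_pos hq.1 one_pos, one_div, Real.log_inv]
  rw [← e]
  unfold Mf
  have hc : ContinuousOn (fun s : ℝ => 1 / s) (uIcc q 1) :=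
    continuousOn_const.div continuousOn_id fun s hs => (uIcc_sub hq one_mem hs).1.ne'
  refine intervalIntegral.integral_mono_on hq.2 (h.ii hq one_mem) hc.intervalIntegrable
    fun s hs => ?_
  have hs' : s ∈ Ioc (0:ℝ) 1 := ⟨hq.1.trans_le hs.1, hs.2⟩
  exact one_div_le_one_div_of_le hs'.1 (h.ge ⟨hs'.1.le, hs'.2⟩)

lemma Mod.Mf_deriv (h : Mod μ) {q : ℝ} (hq : q ∈ Ioo (0:ℝ) 1) :
    HasDerivAt (Mf μ) (-(1 / μ q)) q := by
  have hc : ContinuousOn (fun s => 1 / μ s) (Ioo 0 1) := h.inv_cont.mono Ioo_subset_Ioc_self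
  exact intervalIntegral.integral_hasDerivAt_left (h.ii ⟨hq.1, hq.2.le⟩ one_mem)
    (hc.stronglyMeasurableAtFilter isOpen_Ioo q hq)
    (hc.continuousAt (isOpen_Ioo.mem_nhds hq))

lemma Mod.Mf_cont (h : Mod μ) {q : ℝ} (hq : q ∈ Ioc (0:ℝ) 1) : ContinuousOn (Mf μ) (Icc q 1) := by
  have := intervalIntegral.continuousOn_primitive_interval_left (a := q) (b := 1)
    (f := fun s => 1 / μ s) (μ := volume)
    ((h.inv_cont.mono (uIcc_sub hq one_mem)).integrableOn_compact isCompact_uIcc)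
  rwa [uIcc_of_le hq.2] at this

lemma Mod.Mf_unbdd (h : Mod μ) (y : ℝ) : ∃ q ∈ Ioc (0:ℝ) 1, y ≤ Mf μ q := by
  by_contra hcon
  push Not at hcon
  have hq : ∀ k : ℕ, (1 / ((k:ℝ) + 1)) ∈ Ioc (0:ℝ) 1 := fun k =>
    ⟨by positivity, by rw [div_le_one (by positivity)]; linarith [k.cast_nonneg (α := ℝ)]⟩
  have := integrableOn_Ioc_of_intervalIntegral_norm_bounded_left (l := Filter.atTop)
    (a := fun k : ℕ => 1 / ((k:ℝ) + 1)) (f := fun s => 1 / μ s) (I := y) (a₀ := 0) (b := 1)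
    (fun k => (intervalIntegrable_iff_integrableOn_Ioc_of_le (hq k).2).1 (h.ii (hq k) one_mem))
    tendsto_one_div_add_atTop_nhds_zero_nat
    (Filter.Eventually.of_forall fun k => by
      refine le_trans (le_of_eq ?_) (hcon _ (hq k)).le
      unfold Mf
      rw [intervalIntegral.integral_of_le (hq k).2]
      refine setIntegral_congr_fun measurableSet_Ioc fun s hs => ?_
      have hs' : s ∈ Ioc (0:ℝ) 1 := ⟨(hq k).1.trans hs.1, hs.2⟩
      exact Real.norm_of_nonneg (one_div_nonneg.2 (h.pos hs').le))
  have h2 := this.2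
  rw [hasFiniteIntegral_iff_ofReal] at h2
  · rw [h.osg] at h2
    exact lt_irrefl _ h2
  · filter_upwards [ae_restrict_mem measurableSet_Ioc] with s hs
    exact one_div_nonneg.2 (h.pos hs).le

lemma Mod.Mf_surj (h : Mod μ) {y : ℝ} (hy : 0 ≤ y) : ∃ q ∈ Ioc (0:ℝ) 1, Mf μ q = y := by
  obtain ⟨q, hq, hqy⟩ := h.Mf_unbdd y
  obtain ⟨r, hr, hr2⟩ := intermediate_value_Icc' hq.2 (h.Mf_cont hq)
    (show y ∈ Icc (Mf μ 1) (Mf μ q) from ⟨by rw [Mod.Mf_one]; exact hy, hqy⟩)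
  exact ⟨r, ⟨hq.1.trans_le hr.1, hr.2⟩, hr2⟩

noncomputable def Pf (μ : ℝ → ℝ) (y : ℝ) : ℝ := 1 / Function.invFunOn (phiF μ) (Ici 1) y

lemma Mod.Pf_spec (h : Mod μ) {y : ℝ} (hy : 0 ≤ y) : Pf μ y ∈ Ioc (0:ℝ) 1 ∧ Mf μ (Pf μ y) = y := by
  obtain ⟨q, hq, hqy⟩ := h.Mf_surj hy
  have hex : ∃ t ∈ Ici (1:ℝ), phiF μ t = y := by
    refine ⟨1 / q, ?_, ?_⟩
    · rw [mem_Ici, le_div_iff₀ hq.1]; linarith [hq.2]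
    · unfold phiF
      rw [one_div_one_div]; exact hqy
  have h1 : (1:ℝ) ≤ Function.invFunOn (phiF μ) (Ici 1) y := Function.invFunOn_mem hex
  have h2 := Function.invFunOn_eq hex
  unfold Pf
  refine ⟨⟨one_div_pos.2 (by linarith), ?_⟩, h2⟩
  rw [div_le_one (by linarith)]; exact h1

lemma Mod.Pf_dist (h : Mod μ) {y z : ℝ} (hy : 0 ≤ y) (hz : 0 ≤ z) :
    |Pf μ y - Pf μ z| ≤ |y - z| := by
  have h1 := h.Pf_spec hy
  have h2 := h.Pf_spec hz
  have := h.Mf_dist h1.1 h2.1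
  rwa [h1.2, h2.2] at this

lemma Mod.Pf_cont (h : Mod μ) : ContinuousOn (Pf μ) (Ici 0) := by
  have : LipschitzOnWith 1 (Pf μ) (Ici 0) := LipschitzOnWith.of_dist_le_mul fun y hy z hz => by
    simpa [Real.dist_eq] using h.Pf_dist hy hz
  exact this.continuousOn

lemma Mod.Pf_deriv (h : Mod μ) {y : ℝ} (hy : 0 < y) : HasDerivAt (Pf μ) (-μ (Pf μ y)) y := by
  have h1 := h.Pf_spec hy.le
  have hlt : Pf μ y < 1 := by
    refine lt_of_le_of_ne h1.1.2 fun he => ?_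
    have := h1.2
    rw [he, Mod.Mf_one] at this
    linarith
  have hd := h.Mf_deriv ⟨h1.1.1, hlt⟩
  have hμ := h.pos h1.1
  have := HasDerivAt.of_local_left_inverse (h.Pf_cont.continuousAt (Ici_mem_nhds hy)) hd
    (by simp [hμ.ne']) (by
      filter_upwards [Ioi_mem_nhds hy] with z hz
      exact (h.Pf_spec (le_of_lt hz)).2)
  exact this.congr_deriv (by rw [inv_neg, one_div, inv_inv])

lemma Mod.Pf_exp (h : Mod μ) {y : ℝ} (hy : 0 ≤ y) : Pf μ y ≤ Real.exp (-y) := by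
  have h1 := h.Pf_spec hy
  have h2 := h.Mf_log h1.1
  rw [h1.2] at h2
  rw [← Real.log_le_iff_le_exp h1.1.1]
  linarith

/-- clamping to `[0,T]` -/
noncomputable def cl (T t : ℝ) : ℝ := max 0 (min t T)

lemma cl_cont (T : ℝ) : Continuous (cl T) := by unfold cl; fun_prop

lemma cl_mem {T : ℝ} (hT : 0 < T) (t : ℝ) : cl T t ∈ Icc 0 T := by
  unfold cl
  exact ⟨le_max_left _ _, max_le hT.le (min_le_right _ _)⟩

lemma cl_eq {T t : ℝ} (ht : t ∈ Icc 0 T) : cl T t = t := by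
  unfold cl
  rw [min_eq_left ht.2, max_eq_right ht.1]

noncomputable def Hf (T α γ t : ℝ) : ℝ := γ * ((T ^ α - (cl T t) ^ α) / α)

noncomputable def pf (μ : ℝ → ℝ) (T α γ t : ℝ) : ℝ := Pf μ (Hf T α γ t)

section
variable {T α γ : ℝ}

lemma Hf_cont (hα : 0 < α) : Continuous (Hf T α γ) := by
  unfold Hf
  have : Continuous fun t => (cl T t) ^ α := (cl_cont T).rpow_const fun _ => Or.inr hα.le
  fun_prop

lemma Hf_nonneg (hT : 0 < T) (hα : 0 < α) (hγ : 0 < γ) (t : ℝ) : 0 ≤ Hf T α γ t := by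
  unfold Hf
  have h := cl_mem hT t
  have := Real.rpow_le_rpow h.1 h.2 hα.le
  have : 0 ≤ T ^ α - (cl T t) ^ α := by linarith
  positivity

lemma Hf_pos (hT : 0 < T) (hα : 0 < α) (hγ : 0 < γ) {t : ℝ} (ht : t ∈ Ico 0 T) :
    0 < Hf T α γ t := by
  unfold Hf
  rw [cl_eq ⟨ht.1, ht.2.le⟩]
  have := Real.rpow_lt_rpow ht.1 ht.2 hα
  have : 0 < T ^ α - t ^ α := by linarith
  positivity

lemma Hf_deriv (hα : 0 < α) {t : ℝ} (ht : t ∈ Ioo 0 T) :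
    HasDerivAt (Hf T α γ) (-(γ * t ^ (α - 1))) t := by
  have h1 : HasDerivAt (fun t : ℝ => γ * ((T ^ α - t ^ α) / α)) (-(γ * t ^ (α - 1))) t := by
    have := (((Real.hasDerivAt_rpow_const (p := α) (Or.inl ht.1.ne')).const_sub
      (T ^ α)).div_const α).const_mul γ
    exact this.congr_deriv (by field_simp)
  refine h1.congr_of_eventuallyEq ?_
  filter_upwards [Ioo_mem_nhds ht.1 ht.2] with s hs
  unfold Hf
  rw [cl_eq ⟨hs.1.le, hs.2.le⟩]

lemma Mod.pf_mem (h : Mod μ) (hT : 0 < T) (hα : 0 < α) (hγ : 0 < γ) (t : ℝ) :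
    pf μ T α γ t ∈ Ioc (0:ℝ) 1 := (h.Pf_spec (Hf_nonneg hT hα hγ t)).1

lemma Mod.pf_cont (h : Mod μ) (hT : 0 < T) (hα : 0 < α) (hγ : 0 < γ) :
    Continuous (pf μ T α γ) :=
  h.Pf_cont.comp_continuous (Hf_cont hα) (Hf_nonneg hT hα hγ)

lemma Mod.pf_deriv (h : Mod μ) (hT : 0 < T) (hα : 0 < α) (hγ : 0 < γ) {t : ℝ} (ht : t ∈ Ioo 0 T) :
    HasDerivAt (pf μ T α γ) (γ * t ^ (α - 1) * μ (pf μ T α γ t)) t := by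
  have := (h.Pf_deriv (Hf_pos hT hα hγ ⟨ht.1.le, ht.2⟩)).comp t (Hf_deriv hα ht)
  exact this.congr_deriv (by unfold pf; ring)

lemma pf_psi (hα : 0 < α) (hγ : 0 < γ) {t : ℝ} (ht : t ∈ Icc 0 T) :
    psiF μ T α γ (γ * (T - t)) = 1 / pf μ T α γ t := by
  have e : γ * (∫ s in (0:ℝ)..(γ * (T - t) / γ), (T - s) ^ (α - 1)) = Hf T α γ t := by
    rw [mul_div_cancel_left₀ _ hγ.ne']
    rw [intervalIntegral.integral_comp_sub_left (fun s => s ^ (α - 1)) T]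
    rw [integral_rpow (Or.inl (by linarith))]
    unfold Hf
    rw [cl_eq ht]
    simp
  unfold psiF pf Pf
  rw [e, one_div_one_div]

noncomputable def Wf (μ : ℝ → ℝ) (T α γ t : ℝ) : ℝ := Real.exp (2 * ∫ s in t..T, 1 / pf μ T α γ s)

lemma Wf_eq (hα : 0 < α) (hγ : 0 < γ) {t : ℝ} (ht : t ∈ Icc 0 T) :
    Real.exp ((2/γ) * PhiF μ T α γ (γ * (T - t))) = Wf μ T α γ t := by
  unfold Wf
  congr 1
  have e1 : ∫ s in t..T, 1 / pf μ T α γ s = ∫ s in t..T, psiF μ T α γ (γ * (T - s)) := by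
    refine intervalIntegral.integral_congr fun s hs => ?_
    rw [uIcc_of_le ht.2] at hs
    exact (pf_psi hα hγ ⟨ht.1.trans hs.1, hs.2⟩).symm
  have e2 := intervalIntegral.integral_comp_sub_left (a := t) (b := T)
    (fun s => psiF μ T α γ (γ * s)) T
  rw [e1, e2, sub_self]
  have e3 := intervalIntegral.mul_integral_comp_mul_left (a := 0) (b := T - t)
    (f := psiF μ T α γ) γ
  unfold PhiF
  rw [mul_zero] at e3
  rw [← e3]
  field_simp

lemma Mod.ipf_cont (h : Mod μ) (hT : 0 < T) (hα : 0 < α) (hγ : 0 < γ) :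
    Continuous fun t => 1 / pf μ T α γ t :=
  continuous_const.div (h.pf_cont hT hα hγ) fun t => (h.pf_mem hT hα hγ t).1.ne'

lemma Mod.Wf_deriv (h : Mod μ) (hT : 0 < T) (hα : 0 < α) (hγ : 0 < γ) (t : ℝ) :
    HasDerivAt (Wf μ T α γ) (-(2 * (1 / pf μ T α γ t)) * Wf μ T α γ t) t := by
  have hc := h.ipf_cont hT hα hγ
  have := ((intervalIntegral.integral_hasDerivAt_left (hc.intervalIntegrable t T)
    (hc.stronglyMeasurableAtFilter _ _) hc.continuousAt).const_mul 2).exp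
  exact this.congr_deriv (by unfold Wf; ring)

lemma Wf_pos (t : ℝ) : 0 < Wf μ T α γ t := Real.exp_pos _

lemma Mod.pf_exp (h : Mod μ) (hT : 0 < T) (hα : 0 < α) (hγ : 0 < γ) {t : ℝ}
    (ht : t ∈ Icc 0 (T / 2)) :
    pf μ T α γ t ≤ Real.exp (-(γ * ((T ^ α - (T / 2) ^ α) / α))) := by
  refine (h.Pf_exp (Hf_nonneg hT hα hγ t)).trans (Real.exp_le_exp.2 (neg_le_neg ?_))
  unfold Hf
  rw [cl_eq ⟨ht.1, ht.2.trans (by linarith)⟩]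
  have := Real.rpow_le_rpow ht.1 ht.2 hα.le
  gcongr

end

end Carl

namespace Carl

/-- partial derivative -/
noncomputable def pd {n : ℕ} (j : Fin n) (g : (Fin n → ℝ) → ℝ) (x : Fin n → ℝ) : ℝ :=
  fderiv ℝ g x (Pi.single j 1)

structure Bd {n : ℕ} (f : (Fin n → ℝ) → ℝ) : Prop where
  meas : AEStronglyMeasurable f volume
  bdd : ∃ B, ∀ x, |f x| ≤ B

structure Good {n : ℕ} (f : (Fin n → ℝ) → ℝ) : Prop where
  bd : Bd f
  supp : HasCompactSupport f

structure Sm {n : ℕ} (f : (Fin n → ℝ) → ℝ) : Prop where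
  cd : ContDiff ℝ (⊤ : ℕ∞) f
  supp : HasCompactSupport f

lemma Bd.mul {n : ℕ} {f g : (Fin n → ℝ) → ℝ} (hf : Bd f) (hg : Bd g) :
    Bd (fun x => f x * g x) := by
  obtain ⟨B, hB⟩ := hf.bdd
  obtain ⟨B', hB'⟩ := hg.bdd
  refine ⟨hf.meas.mul hg.meas, B * B', fun x => ?_⟩
  rw [abs_mul]
  exact mul_le_mul (hB x) (hB' x) (abs_nonneg _) ((abs_nonneg _).trans (hB x))

lemma Bd.add {n : ℕ} {f g : (Fin n → ℝ) → ℝ} (hf : Bd f) (hg : Bd g) :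
    Bd (fun x => f x + g x) := by
  obtain ⟨B, hB⟩ := hf.bdd
  obtain ⟨B', hB'⟩ := hg.bdd
  refine ⟨hf.meas.add hg.meas, B + B', fun x => ?_⟩
  exact (abs_add_le _ _).trans (add_le_add (hB x) (hB' x))

lemma Bd.const {n : ℕ} (c : ℝ) : Bd (fun _ : Fin n → ℝ => c) :=
  ⟨aestronglyMeasurable_const, |c|, fun _ => le_rfl⟩

lemma Bd.sub {n : ℕ} {f g : (Fin n → ℝ) → ℝ} (hf : Bd f) (hg : Bd g) :
    Bd (fun x => f x - g x) := by
  have := hf.add ((Bd.const (-1)).mul hg)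
  simpa [sub_eq_add_neg] using this

lemma Bd.mulGood {n : ℕ} {f g : (Fin n → ℝ) → ℝ} (hf : Bd f) (hg : Good g) :
    Good (fun x => f x * g x) :=
  ⟨hf.mul hg.bd, hg.supp.mul_left⟩

lemma Good.mulBd {n : ℕ} {f g : (Fin n → ℝ) → ℝ} (hf : Good f) (hg : Bd g) :
    Good (fun x => f x * g x) :=
  ⟨hf.bd.mul hg, hf.supp.mul_right⟩

lemma Good.mul {n : ℕ} {f g : (Fin n → ℝ) → ℝ} (hf : Good f) (hg : Good g) :
    Good (fun x => f x * g x) := hf.bd.mulGood hg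

lemma Good.add {n : ℕ} {f g : (Fin n → ℝ) → ℝ} (hf : Good f) (hg : Good g) :
    Good (fun x => f x + g x) := ⟨hf.bd.add hg.bd, hf.supp.add hg.supp⟩

lemma Good.cmul {n : ℕ} {f : (Fin n → ℝ) → ℝ} (c : ℝ) (hf : Good f) :
    Good (fun x => c * f x) := (Bd.const c).mulGood hf

lemma Good.neg {n : ℕ} {f : (Fin n → ℝ) → ℝ} (hf : Good f) :
    Good (fun x => - f x) := by simpa using hf.cmul (-1)

lemma Good.sub {n : ℕ} {f g : (Fin n → ℝ) → ℝ} (hf : Good f) (hg : Good g) :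
    Good (fun x => f x - g x) := by simpa [sub_eq_add_neg] using hf.add hg.neg

lemma Good.sq {n : ℕ} {f : (Fin n → ℝ) → ℝ} (hf : Good f) :
    Good (fun x => f x ^ 2) := by simpa [_root_.sq] using hf.mul hf

lemma Good.zero {n : ℕ} : Good (fun _ : Fin n → ℝ => (0 : ℝ)) :=
  ⟨Bd.const 0, HasCompactSupport.zero⟩

lemma Good.sum {n : ℕ} {ι : Type*} (s : Finset ι) {f : ι → (Fin n → ℝ) → ℝ}
    (hf : ∀ i ∈ s, Good (f i)) : Good (fun x => ∑ i ∈ s, f i x) := by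
  classical
  induction s using Finset.induction_on with
  | empty => simpa using Good.zero
  | insert i s his ih =>
    simp only [Finset.sum_insert his]
    exact (hf i (by simp)).add (ih fun j hj => hf j (by simp [hj]))

lemma Good.integrable {n : ℕ} {f : (Fin n → ℝ) → ℝ} (hf : Good f) : Integrable f := by
  obtain ⟨B, hB⟩ := hf.bd.bdd
  have hK : IsCompact (tsupport f) := hf.supp
  rw [← integrableOn_iff_integrable_of_support_subset (subset_tsupport f)]
  exact Measure.integrableOn_of_bounded (M := B) hK.measure_lt_top.ne hf.bd.meas
    (Filter.Eventually.of_forall fun x => by simpa using hB x)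

lemma Sm.good {n : ℕ} {f : (Fin n → ℝ) → ℝ} (hf : Sm f) : Good f := by
  refine ⟨⟨hf.cd.continuous.aestronglyMeasurable, ?_⟩, hf.supp⟩
  obtain ⟨B, hB⟩ := hf.supp.exists_bound_of_continuous hf.cd.continuous
  exact ⟨B, fun x => by simpa using hB x⟩

lemma Sm.pd {n : ℕ} {f : (Fin n → ℝ) → ℝ} (hf : Sm f) (j : Fin n) : Sm (pd j f) :=
  ⟨(hf.cd.fderiv_right (m := (⊤ : ℕ∞)) (by simp)).clm_apply contDiff_const,
    hf.supp.fderiv_apply (𝕜 := ℝ) _⟩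

lemma Sm.mul {n : ℕ} {f g : (Fin n → ℝ) → ℝ} (hf : Sm f) (hg : Sm g) :
    Sm (fun x => f x * g x) := ⟨hf.cd.mul hg.cd, hf.supp.mul_right⟩

lemma Sm.diff {n : ℕ} {f : (Fin n → ℝ) → ℝ} (hf : Sm f) : Differentiable ℝ f :=
  hf.cd.differentiable (by simp)

lemma pd_mul {n : ℕ} {f g : (Fin n → ℝ) → ℝ} (j : Fin n) (x : Fin n → ℝ)
    (hf : DifferentiableAt ℝ f x) (hg : DifferentiableAt ℝ g x) :
    pd j (fun x => f x * g x) x = pd j f x * g x + f x * pd j g x := by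
  unfold pd
  rw [fderiv_fun_mul hf hg]
  simp
  ring

lemma Sm.pd_comm {n : ℕ} {f : (Fin n → ℝ) → ℝ} (hf : Sm f) (j k : Fin n) (x : Fin n → ℝ) :
    Carl.pd j (Carl.pd k f) x = Carl.pd k (Carl.pd j f) x := by
  have hsym := (hf.cd.contDiffAt (x := x)).isSymmSndFDerivAt
    (by simpa using (WithTop.coe_le_coe.2 (le_top : (2 : ℕ∞) ≤ ⊤)))
  have h1 : ∀ v w : Fin n → ℝ, fderiv ℝ (fun y => fderiv ℝ f y v) x w
      = fderiv ℝ (fderiv ℝ f) x w v := by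
    intro v w
    have hd : DifferentiableAt ℝ (fderiv ℝ f) x :=
      ((hf.cd.fderiv_right (m := (⊤ : ℕ∞)) (by simp)).differentiable (by simp)) x
    rw [fderiv_clm_apply hd (by fun_prop)]
    simp
  have e : ∀ j k : Fin n, Carl.pd j (Carl.pd k f) x
    = fderiv ℝ (fderiv ℝ f) x (Pi.single j 1) (Pi.single k 1) := fun j k => h1 _ _
  rw [e, e]
  exact hsym _ _

/-- Lipschitz in the elementary sense -/
def Lip {n : ℕ} (C : ℝ) (f : (Fin n → ℝ) → ℝ) : Prop := ∀ x y, |f x - f y| ≤ C * dist x y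

lemma Lip.lw {n : ℕ} {C : ℝ} {f : (Fin n → ℝ) → ℝ} (h : Lip C f) :
    LipschitzWith C.toNNReal f :=
  LipschitzWith.of_dist_le_mul fun x y => by
    rw [Real.dist_eq]
    exact (h x y).trans (mul_le_mul_of_nonneg_right (Real.le_coe_toNNReal C) dist_nonneg)

lemma Lip.pd_bdd {n : ℕ} {C : ℝ} (hC : 0 ≤ C) {f : (Fin n → ℝ) → ℝ} (h : Lip C f) (j : Fin n)
    (x : Fin n → ℝ) : |pd j f x| ≤ C := by
  have := norm_fderiv_le_of_lipschitz ℝ h.lw (x₀ := x)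
  have h2 := (fderiv ℝ f x).le_opNorm (Pi.single j 1)
  rw [Real.coe_toNNReal _ hC] at this
  have h3 : ‖(Pi.single j 1 : Fin n → ℝ)‖ = 1 := by rw [Pi.norm_single]; simp
  rw [h3, mul_one] at h2
  exact h2.trans this

lemma Lip.pd_bd {n : ℕ} {C : ℝ} (hC : 0 ≤ C) {f : (Fin n → ℝ) → ℝ} (h : Lip C f) (j : Fin n) :
    Bd (pd j f) :=
  ⟨(measurable_fderiv_apply_const ℝ f _).aestronglyMeasurable, C, h.pd_bdd hC j⟩

lemma Lip.ae_diff {n : ℕ} {C : ℝ} {f : (Fin n → ℝ) → ℝ} (h : Lip C f) :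
    ∀ᵐ x, DifferentiableAt ℝ f x := h.lw.ae_differentiableAt

/-- integration by parts -/
lemma Lip.ibp {n : ℕ} {C : ℝ} {a : (Fin n → ℝ) → ℝ} (h : Lip C a) {g : (Fin n → ℝ) → ℝ}
    (hg : Sm g) (j : Fin n) : ∫ x, pd j a x * g x = - ∫ x, a x * pd j g x := by
  obtain ⟨D, hD⟩ := ContDiff.lipschitzWith_of_hasCompactSupport hg.supp hg.cd (by simp)
  have := h.lw.integral_lineDeriv_mul_eq (μ := volume) hD hg.supp (Pi.single j 1)
  have e1 : ∫ x, pd j a x * g x = ∫ x, lineDeriv ℝ a x (Pi.single j 1) * g x := by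
    apply integral_congr_ae
    filter_upwards [h.ae_diff] with x hx
    rw [hx.lineDeriv_eq_fderiv]; rfl
  rw [e1, this, ← integral_neg]
  apply integral_congr_ae
  filter_upwards with x
  rw [(hg.diff x).lineDeriv_eq_fderiv]
  simp [pd]; ring

structure Coef (n : ℕ) (lam C M : ℝ) (a : Fin n → Fin n → (Fin n → ℝ) → ℝ) : Prop where
  lip : ∀ j k, Lip C (a j k)
  bdd : ∀ j k x, |a j k x| ≤ M
  symm : ∀ j k x, a j k x = a k j x
  ell : ∀ x, ∀ ξ : Fin n → ℝ, lam * ∑ j, ξ j ^ 2 ≤ ∑ j, ∑ k, a j k x * ξ j * ξ k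

lemma Coef.bd {n : ℕ} {lam C M : ℝ} {a : Fin n → Fin n → (Fin n → ℝ) → ℝ}
    (h : Coef n lam C M a) (j k : Fin n) : Bd (a j k) :=
  ⟨(h.lip j k).lw.continuous.aestronglyMeasurable, M, h.bdd j k⟩

/-- the elliptic operator, minus the divergence -/
noncomputable def Lop {n : ℕ} (a : Fin n → Fin n → (Fin n → ℝ) → ℝ) (v : (Fin n → ℝ) → ℝ)
    (x : Fin n → ℝ) : ℝ :=
  - ∑ j, ∑ k, (pd j (a j k) x * pd k v x + a j k x * pd j (pd k v) x)

lemma Lop_good {n : ℕ} {lam C M : ℝ} (hC : 0 ≤ C) {a : Fin n → Fin n → (Fin n → ℝ) → ℝ}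
    (h : Coef n lam C M a) {v : (Fin n → ℝ) → ℝ} (hv : Sm v) : Good (Lop a v) := by
  unfold Lop
  refine Good.neg (Good.sum _ fun j _ => Good.sum _ fun k _ => ?_)
  exact (((h.lip j k).pd_bd hC j).mulGood (hv.pd k).good).add
    ((h.bd j k).mulGood ((hv.pd k).pd j).good)

lemma Lop_ibp {n : ℕ} {lam C M : ℝ} (hC : 0 ≤ C) {a : Fin n → Fin n → (Fin n → ℝ) → ℝ}
    (h : Coef n lam C M a) {v g : (Fin n → ℝ) → ℝ} (hv : Sm v) (hg : Sm g) :
    ∫ x, Lop a v x * g x = ∑ j, ∑ k, ∫ x, a j k x * pd k v x * pd j g x := by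
  have e : ∀ x, Lop a v x * g x = ∑ j, ∑ k,
      (-(pd j (a j k) x * (pd k v x * g x)) - a j k x * (pd j (pd k v) x * g x)) := by
    intro x
    unfold Lop
    rw [neg_mul, Finset.sum_mul, ← Finset.sum_neg_distrib]
    refine Finset.sum_congr rfl fun j _ => ?_
    rw [Finset.sum_mul, ← Finset.sum_neg_distrib]
    refine Finset.sum_congr rfl fun k _ => ?_
    ring
  have g1 : ∀ j k, Good (fun x => -(pd j (a j k) x * (pd k v x * g x))) := fun j k =>
    (((h.lip j k).pd_bd hC j).mulGood ((hv.pd k).mul hg).good).neg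
  have g2 : ∀ j k, Good (fun x => a j k x * (pd j (pd k v) x * g x)) := fun j k =>
    (h.bd j k).mulGood (((hv.pd k).pd j).mul hg).good
  have g3 : ∀ j k, Good (fun x => a j k x * (pd k v x * pd j g x)) := fun j k =>
    (h.bd j k).mulGood ((hv.pd k).mul (hg.pd j)).good
  simp_rw [e]
  rw [integral_finsetSum _ fun j _ => (Good.sum _ fun k _ => (g1 j k).sub (g2 j k)).integrable]
  refine Finset.sum_congr rfl fun j _ => ?_
  rw [integral_finsetSum _ fun k _ => ((g1 j k).sub (g2 j k)).integrable]
  refine Finset.sum_congr rfl fun k _ => ?_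
  rw [integral_sub (g1 j k).integrable (g2 j k).integrable, integral_neg,
    (h.lip j k).ibp ((hv.pd k).mul hg) j, neg_neg]
  rw [← integral_sub ((h.bd j k).mulGood (((hv.pd k).mul hg).pd j).good).integrable
    (g2 j k).integrable]
  refine integral_congr_ae (Filter.Eventually.of_forall fun x => ?_)
  simp only
  rw [pd_mul j x ((hv.pd k).diff x) (hg.diff x)]
  ring

end Carl

namespace Carl

noncomputable def S1 {n : ℕ} (v : (Fin n → ℝ) → ℝ) (x : Fin n → ℝ) : ℝ := ∑ k, pd k v x ^ 2
noncomputable def S2 {n : ℕ} (v : (Fin n → ℝ) → ℝ) (x : Fin n → ℝ) : ℝ :=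
  ∑ l, ∑ k, pd l (pd k v) x ^ 2

lemma S1_good {n : ℕ} {v : (Fin n → ℝ) → ℝ} (hv : Sm v) : Good (S1 v) :=
  Good.sum _ fun k _ => (hv.pd k).good.sq

lemma S2_good {n : ℕ} {v : (Fin n → ℝ) → ℝ} (hv : Sm v) : Good (S2 v) :=
  Good.sum _ fun l _ => Good.sum _ fun k _ => ((hv.pd k).pd l).good.sq

lemma ell_identity {n : ℕ} {lam C M : ℝ} (hC : 0 ≤ C) {a : Fin n → Fin n → (Fin n → ℝ) → ℝ}
    (h : Coef n lam C M a) {v : (Fin n → ℝ) → ℝ} (hv : Sm v) :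
    ∫ x, ∑ l, ∑ j, ∑ k, a j k x * (pd l (pd k v) x * pd j (pd l v) x)
      = ∫ x, (∑ l, - (Lop a v x * pd l (pd l v) x)
          - ∑ l, ∑ j, ∑ k, pd l (a j k) x * (pd k v x * pd j (pd l v) x)) := by
  have gA : ∀ l j k, Good (fun x => a j k x * (pd l (pd k v) x * pd j (pd l v) x)) :=
    fun l j k => (h.bd j k).mulGood (((hv.pd k).pd l).mul ((hv.pd l).pd j)).good
  have gB : ∀ l, Good (fun x => Lop a v x * pd l (pd l v) x) :=
    fun l => (Lop_good hC h hv).mul ((hv.pd l).pd l).good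
  have gC : ∀ l j k, Good (fun x => pd l (a j k) x * (pd k v x * pd j (pd l v) x)) :=
    fun l j k => ((h.lip j k).pd_bd hC l).mulGood ((hv.pd k).mul ((hv.pd l).pd j)).good
  have key : ∀ l j k, ∫ x, a j k x * pd k v x * pd j (pd l (pd l v)) x =
      - (∫ x, pd l (a j k) x * (pd k v x * pd j (pd l v) x))
      - ∫ x, a j k x * (pd l (pd k v) x * pd j (pd l v) x) := by
    intro l j k
    rw [(h.lip j k).ibp ((hv.pd k).mul ((hv.pd l).pd j)) l, neg_neg,
      ← integral_sub ((h.bd j k).mulGood (((hv.pd k).mul ((hv.pd l).pd j)).pd l).good).integrable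
        (gA l j k).integrable]
    refine integral_congr_ae (Filter.Eventually.of_forall fun x => ?_)
    simp only
    rw [pd_mul l x ((hv.pd k).diff x) (((hv.pd l).pd j).diff x), (hv.pd l).pd_comm j l x]
    ring
  rw [integral_sub (Good.sum _ fun l _ => (gB l).neg).integrable
    (Good.sum _ fun l _ => Good.sum _ fun j _ => Good.sum _ fun k _ => gC l j k).integrable,
    integral_finsetSum _ fun l _ => (gB l).neg.integrable,
    integral_finsetSum _ fun l _ =>
      (Good.sum _ fun j _ => Good.sum _ fun k _ => gC l j k).integrable,
    integral_finsetSum _ fun l _ =>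
      (Good.sum _ fun j _ => Good.sum _ fun k _ => gA l j k).integrable,
    ← Finset.sum_sub_distrib]
  refine Finset.sum_congr rfl fun l _ => ?_
  rw [integral_neg, Lop_ibp hC h hv ((hv.pd l).pd l),
    integral_finsetSum _ fun j _ => (Good.sum _ fun k _ => gC l j k).integrable,
    integral_finsetSum _ fun j _ => (Good.sum _ fun k _ => gA l j k).integrable,
    ← Finset.sum_neg_distrib, ← Finset.sum_sub_distrib]
  refine Finset.sum_congr rfl fun j _ => ?_
  rw [integral_finsetSum _ fun k _ => (gC l j k).integrable,
    integral_finsetSum _ fun k _ => (gA l j k).integrable,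
    ← Finset.sum_neg_distrib, ← Finset.sum_sub_distrib]
  refine Finset.sum_congr rfl fun k _ => ?_
  rw [key]; ring

lemma young (η x y : ℝ) (hη : 0 < η) : - (x * y) ≤ η * y ^ 2 + x ^ 2 / (4 * η) := by
  have : η * y ^ 2 + x ^ 2 / (4 * η) + x * y = (2 * η * y + x) ^ 2 / (4 * η) := by
    field_simp; ring
  have h2 : 0 ≤ (2 * η * y + x) ^ 2 / (4 * η) := by positivity
  linarith

lemma ell_reg {n : ℕ} {lam C M : ℝ} (hlam : 0 < lam) (hC : 0 ≤ C)
    {a : Fin n → Fin n → (Fin n → ℝ) → ℝ}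
    (h : Coef n lam C M a) {v : (Fin n → ℝ) → ℝ} (hv : Sm v) :
    ∫ x, S2 v x ≤ ((n + 1) * (n + n ^ 2 * C ^ 2) / lam ^ 2) *
      ((∫ x, Lop a v x ^ 2) + ∫ x, S1 v x) := by
  set η : ℝ := lam / (2 * (n + 1)) with hη
  have hη0 : 0 < η := by positivity
  have gA : ∀ l j k, Good (fun x => a j k x * (pd l (pd k v) x * pd j (pd l v) x)) :=
    fun l j k => (h.bd j k).mulGood (((hv.pd k).pd l).mul ((hv.pd l).pd j)).good
  have gB : ∀ l, Good (fun x => Lop a v x * pd l (pd l v) x) :=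
    fun l => (Lop_good hC h hv).mul ((hv.pd l).pd l).good
  have gC : ∀ l j k, Good (fun x => pd l (a j k) x * (pd k v x * pd j (pd l v) x)) :=
    fun l j k => ((h.lip j k).pd_bd hC l).mulGood ((hv.pd k).mul ((hv.pd l).pd j)).good
  have gL := (Lop_good hC h hv).sq
  have g1 := S1_good hv
  have g2 := S2_good hv
  have low : lam * ∫ x, S2 v x ≤
      ∫ x, ∑ l, ∑ j, ∑ k, a j k x * (pd l (pd k v) x * pd j (pd l v) x) := by
    rw [← integral_const_mul]
    refine integral_mono (g2.cmul lam).integrable (Good.sum _ fun l _ =>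
      Good.sum _ fun j _ => Good.sum _ fun k _ => gA l j k).integrable fun x => ?_
    simp only [S2]
    rw [Finset.mul_sum]
    refine Finset.sum_le_sum fun l _ => ?_
    refine (h.ell x (fun k => pd l (pd k v) x)).trans (le_of_eq ?_)
    refine Finset.sum_congr rfl fun j _ => Finset.sum_congr rfl fun k _ => ?_
    rw [hv.pd_comm j l x]; ring
  have up : ∫ x, (∑ l, - (Lop a v x * pd l (pd l v) x)
          - ∑ l, ∑ j, ∑ k, pd l (a j k) x * (pd k v x * pd j (pd l v) x)) ≤
      ∫ x, ((η * (n + 1)) * S2 v x + ((n / (4 * η)) * Lop a v x ^ 2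
        + (n ^ 2 * C ^ 2 / (4 * η)) * S1 v x)) := by
    refine integral_mono ((Good.sum _ fun l _ => (gB l).neg).sub
      (Good.sum _ fun l _ => Good.sum _ fun j _ => Good.sum _ fun k _ => gC l j k)).integrable
      ((g2.cmul _).add ((gL.cmul _).add (g1.cmul _))).integrable fun x => ?_
    simp only
    have p1 : ∑ l, - (Lop a v x * pd l (pd l v) x) ≤ η * S2 v x + (n / (4 * η)) * Lop a v x ^ 2 := by
      calc _ ≤ ∑ l : Fin n, (η * pd l (pd l v) x ^ 2 + Lop a v x ^ 2 / (4 * η)) :=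
            Finset.sum_le_sum fun l _ => young _ _ _ hη0
        _ = η * (∑ l : Fin n, pd l (pd l v) x ^ 2) + (n / (4 * η)) * Lop a v x ^ 2 := by
            rw [Finset.sum_add_distrib, ← Finset.mul_sum]
            simp; ring
        _ ≤ _ := by
            gcongr
            exact Finset.sum_le_sum fun l _ =>
              Finset.single_le_sum (f := fun k => pd l (pd k v) x ^ 2)
                (fun k _ => sq_nonneg _) (Finset.mem_univ l)
    have p2 : - ∑ l, ∑ j, ∑ k, pd l (a j k) x * (pd k v x * pd j (pd l v) x) ≤
        (η * n) * S2 v x + (n ^ 2 * C ^ 2 / (4 * η)) * S1 v x := by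
      calc _ = ∑ l, ∑ j, ∑ k, - ((pd l (a j k) x * pd k v x) * pd l (pd j v) x) := by
            simp only [← Finset.sum_neg_distrib]
            refine Finset.sum_congr rfl fun l _ => Finset.sum_congr rfl fun j _ =>
              Finset.sum_congr rfl fun k _ => ?_
            rw [hv.pd_comm j l x]; ring
        _ ≤ ∑ l, ∑ j, ∑ k, (η * pd l (pd j v) x ^ 2 + C ^ 2 * pd k v x ^ 2 / (4 * η)) := by
            refine Finset.sum_le_sum fun l _ => Finset.sum_le_sum fun j _ =>
              Finset.sum_le_sum fun k _ => ?_
            refine (young η _ _ hη0).trans ?_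
            rw [mul_pow]
            have := sq_le_sq' (abs_le.1 ((h.lip j k).pd_bdd hC l x)).1
              (abs_le.1 ((h.lip j k).pd_bdd hC l x)).2
            gcongr
        _ = _ := by
            simp only [Finset.sum_add_distrib, S1, S2, Finset.mul_sum, Finset.sum_const,
              Finset.card_univ, Fintype.card_fin, nsmul_eq_mul]
            congr 1
            · refine Finset.sum_congr rfl fun l _ => Finset.sum_congr rfl fun k _ => ?_
              ring
            · refine Finset.sum_congr rfl fun l _ => ?_
              ring
    linarith
  rw [ell_identity hC h hv] at low
  have := low.trans up
  rw [integral_add (g2.cmul _).integrable ((gL.cmul _).add (g1.cmul _)).integrable,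
    integral_add (gL.cmul _).integrable (g1.cmul _).integrable, integral_const_mul,
    integral_const_mul, integral_const_mul] at this
  have n1 : 0 ≤ ∫ x, S1 v x := integral_nonneg fun x => Finset.sum_nonneg fun k _ => sq_nonneg _
  have nL : 0 ≤ ∫ x, Lop a v x ^ 2 := integral_nonneg fun x => sq_nonneg _
  generalize (∫ x, S1 v x) = s1 at *
  generalize (∫ x, S2 v x) = s2 at *
  generalize (∫ x, Lop a v x ^ 2) = ℓ at *
  have e : η * (n + 1) = lam / 2 := by rw [hη]; field_simp
  rw [e] at this
  have h3 : lam / 2 * s2 ≤ (n / (4 * η)) * ℓ + (n ^ 2 * C ^ 2 / (4 * η)) * s1 := by linarith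
  have h4 : (n / (4 * η)) * ℓ + (n ^ 2 * C ^ 2 / (4 * η)) * s1 ≤
      ((n + n ^ 2 * C ^ 2) / (4 * η)) * (ℓ + s1) := by
    have : ((n + n ^ 2 * C ^ 2) / (4 * η)) * (ℓ + s1) -
      ((n / (4 * η)) * ℓ + (n ^ 2 * C ^ 2 / (4 * η)) * s1)
      = (n / (4 * η)) * s1 + (n ^ 2 * C ^ 2 / (4 * η)) * ℓ := by ring
    have : 0 ≤ (n / (4 * η)) * s1 + (n ^ 2 * C ^ 2 / (4 * η)) * ℓ := by positivity
    linarith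
  have h5 : ((n + 1) * (n + n ^ 2 * C ^ 2) / lam ^ 2) * (ℓ + s1) =
    (2 / lam) * (((n + n ^ 2 * C ^ 2) / (4 * η)) * (ℓ + s1)) := by
    rw [hη]; field_simp; ring
  rw [h5]
  have h6 : s2 = (2 / lam) * (lam / 2 * s2) := by field_simp
  rw [h6]
  exact mul_le_mul_of_nonneg_left (h3.trans h4) (by positivity)

/-- difference of two operators -/
lemma Lop_diff {n : ℕ} {lam C M : ℝ} (hC : 0 ≤ C)
    {a b : Fin n → Fin n → (Fin n → ℝ) → ℝ}
    (h : Coef n lam C M a) (hb : Coef n lam C M b) {ω : ℝ} (hω : ∀ j k x, |b j k x - a j k x| ≤ ω)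
    {v : (Fin n → ℝ) → ℝ} (hv : Sm v) :
    ∫ x, (Lop b v x - Lop a v x) ^ 2 ≤
      (2 * n ^ 2 + 8 * C ^ 2 * n ^ 3) * (ω ^ 2 * (∫ x, S2 v x) + ∫ x, S1 v x) := by
  have g1 := S1_good hv
  have g2 := S2_good hv
  have : ∫ x, (Lop b v x - Lop a v x) ^ 2 ≤
      ∫ x, ((2 * n ^ 2 * ω ^ 2) * S2 v x + (8 * C ^ 2 * n ^ 3) * S1 v x) := by
    refine integral_mono ((Lop_good hC hb hv).sub (Lop_good hC h hv)).sq.integrable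
      ((g2.cmul _).add (g1.cmul _)).integrable fun x => ?_
    simp only
    have e : Lop b v x - Lop a v x = - ∑ j, ∑ k, ((pd j (b j k) x - pd j (a j k) x) * pd k v x
        + (b j k x - a j k x) * pd j (pd k v) x) := by
      simp only [Lop]
      rw [← neg_add', neg_inj.2]
      rw [← sub_eq_add_neg, ← Finset.sum_sub_distrib]
      refine Finset.sum_congr rfl fun j _ => ?_
      rw [← Finset.sum_sub_distrib]
      refine Finset.sum_congr rfl fun k _ => ?_
      ring
    rw [e, neg_sq]
    calc _ ≤ (n : ℝ) * ∑ j, (∑ k, ((pd j (b j k) x - pd j (a j k) x) * pd k v x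
        + (b j k x - a j k x) * pd j (pd k v) x)) ^ 2 := by
          simpa using sq_sum_le_card_mul_sum_sq (s := (Finset.univ : Finset (Fin n)))
            (f := fun j => ∑ k, ((pd j (b j k) x - pd j (a j k) x) * pd k v x
        + (b j k x - a j k x) * pd j (pd k v) x))
      _ ≤ (n : ℝ) * ∑ j : Fin n, ((n : ℝ) * ∑ k : Fin n, (2 * ω ^ 2 * pd j (pd k v) x ^ 2
        + 8 * C ^ 2 * pd k v x ^ 2)) := by
          gcongr with j _
          refine (sq_sum_le_card_mul_sum_sq (s := (Finset.univ : Finset (Fin n)))).trans ?_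
          simp only [Finset.card_univ, Fintype.card_fin]
          gcongr with k _
          have b1 := abs_le.1 (hω j k x)
          have b2 := abs_le.1 ((hb.lip j k).pd_bdd hC j x)
          have b3 := abs_le.1 ((h.lip j k).pd_bdd hC j x)
          have c1 : (b j k x - a j k x) ^ 2 ≤ ω ^ 2 := sq_le_sq' b1.1 b1.2
          have c2 : (pd j (b j k) x - pd j (a j k) x) ^ 2 ≤ (2 * C) ^ 2 :=
            sq_le_sq' (by linarith) (by linarith)
          have c3 : ∀ p q : ℝ, (p + q) ^ 2 ≤ 2 * p ^ 2 + 2 * q ^ 2 := fun p q => by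
            nlinarith [sq_nonneg (p - q)]
          refine (c3 _ _).trans ?_
          rw [mul_pow, mul_pow]
          nlinarith [mul_le_mul_of_nonneg_right c1 (sq_nonneg (pd j (pd k v) x)),
            mul_le_mul_of_nonneg_right c2 (sq_nonneg (pd k v x))]
      _ = _ := by
          simp only [Finset.sum_add_distrib, S1, S2, ← Finset.mul_sum, Finset.sum_const,
              Finset.card_univ, Fintype.card_fin, nsmul_eq_mul]
          ring
  refine this.trans ?_
  rw [integral_add (g2.cmul _).integrable (g1.cmul _).integrable, integral_const_mul,
    integral_const_mul]
  have n1 : 0 ≤ ∫ x, S1 v x := integral_nonneg fun x => Finset.sum_nonneg fun k _ => sq_nonneg _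
  have n2 : 0 ≤ ∫ x, S2 v x := integral_nonneg fun x =>
    Finset.sum_nonneg fun k _ => Finset.sum_nonneg fun k _ => sq_nonneg _
  generalize (∫ x, S1 v x) = s1 at *
  generalize (∫ x, S2 v x) = s2 at *
  have p1 : 0 ≤ 8 * C ^ 2 * n ^ 3 * (ω ^ 2 * s2) := by positivity
  have p2 : 0 ≤ 2 * (n : ℝ) ^ 2 * s1 := by positivity
  linarith

end Carl

namespace Carl

noncomputable def Bform {n : ℕ} (a : Fin n → Fin n → (Fin n → ℝ) → ℝ) (v g : (Fin n → ℝ) → ℝ)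
    (x : Fin n → ℝ) : ℝ := ∑ j, ∑ k, a j k x * pd k v x * pd j g x

lemma Bform_good {n : ℕ} {a : Fin n → Fin n → (Fin n → ℝ) → ℝ} (ha : ∀ j k, Bd (a j k))
    {v g : (Fin n → ℝ) → ℝ} (hv : Sm v) (hg : Sm g) : Good (Bform a v g) :=
  Good.sum _ fun j _ => Good.sum _ fun k _ => ((ha j k).mulGood (hv.pd k).good).mul (hg.pd j).good

lemma Lop_ibp' {n : ℕ} {lam C M : ℝ} (hC : 0 ≤ C) {a : Fin n → Fin n → (Fin n → ℝ) → ℝ}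
    (h : Coef n lam C M a) {v g : (Fin n → ℝ) → ℝ} (hv : Sm v) (hg : Sm g) :
    ∫ x, Lop a v x * g x = ∫ x, Bform a v g x := by
  have gd : ∀ j k, Good (fun x => a j k x * pd k v x * pd j g x) := fun j k =>
    ((h.bd j k).mulGood (hv.pd k).good).mul (hg.pd j).good
  rw [Lop_ibp hC h hv hg]
  unfold Bform
  rw [integral_finsetSum _ fun j _ => (Good.sum _ fun k _ => gd j k).integrable]
  refine Finset.sum_congr rfl fun j _ => ?_
  rw [integral_finsetSum _ fun k _ => (gd j k).integrable]

lemma Bform_lower {n : ℕ} {lam C M : ℝ} {a : Fin n → Fin n → (Fin n → ℝ) → ℝ}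
    (h : Coef n lam C M a) {v : (Fin n → ℝ) → ℝ} (hv : Sm v) :
    lam * ∫ x, S1 v x ≤ ∫ x, Bform a v v x := by
  rw [← integral_const_mul]
  refine integral_mono ((S1_good hv).cmul _).integrable
    (Bform_good h.bd hv hv).integrable fun x => ?_
  simp only [S1, Bform]
  refine (h.ell x (fun k => pd k v x)).trans (le_of_eq ?_)
  refine Finset.sum_congr rfl fun j _ => Finset.sum_congr rfl fun k _ => ?_
  ring

lemma Bform_upper {n : ℕ} {β : ℝ} {a : Fin n → Fin n → (Fin n → ℝ) → ℝ}
    (ha : ∀ j k, Bd (a j k)) (hβ : ∀ j k x, |a j k x| ≤ β) {v : (Fin n → ℝ) → ℝ} (hv : Sm v) :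
    - (n * β * ∫ x, S1 v x) ≤ ∫ x, Bform a v v x := by
  rw [← integral_const_mul, ← integral_neg]
  refine integral_mono ((S1_good hv).cmul _).neg.integrable
    (Bform_good ha hv hv).integrable fun x => ?_
  simp only [S1, Bform]
  have : ∑ j : Fin n, ∑ k : Fin n, (-(β / 2 * pd k v x ^ 2 + β / 2 * pd j v x ^ 2)) ≤
      ∑ j, ∑ k, a j k x * pd k v x * pd j v x := by
    refine Finset.sum_le_sum fun j _ => Finset.sum_le_sum fun k _ => ?_
    have h1 := abs_le.1 (hβ j k x)
    nlinarith [mul_nonneg (by linarith : 0 ≤ β - a j k x) (sq_nonneg (pd k v x - pd j v x)),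
      mul_nonneg (by linarith : 0 ≤ β + a j k x) (sq_nonneg (pd k v x + pd j v x))]
  refine le_trans (le_of_eq ?_) this
  simp only [Finset.sum_neg_distrib, Finset.sum_add_distrib, ← Finset.mul_sum, Finset.sum_const,
    Finset.card_univ, Fintype.card_fin, nsmul_eq_mul]
  ring

lemma Bform_symm {n : ℕ} {lam C M : ℝ} {a : Fin n → Fin n → (Fin n → ℝ) → ℝ}
    (h : Coef n lam C M a) (v g : (Fin n → ℝ) → ℝ) (x : Fin n → ℝ) :
    Bform a v g x = Bform a g v x := by
  unfold Bform
  rw [Finset.sum_comm]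
  refine Finset.sum_congr rfl fun j _ => Finset.sum_congr rfl fun k _ => ?_
  rw [h.symm]; ring

lemma int_A {n : ℕ} {A B g v : (Fin n → ℝ) → ℝ} (ψ : ℝ) (hA : Good A) (hB : Good B) (hg : Good g)
    (hv : Good v) :
    3 / 2 * (∫ x, (A x - ψ * v x) ^ 2) - 5 * (∫ x, (B x - A x) ^ 2) - 5 * (∫ x, (g x - A x) ^ 2)
      ≤ 2 * ∫ x, (B x - ψ * v x) * (g x - ψ * v x) := by
  have g1 := (hA.sub (hv.cmul ψ)).sq
  have g2 := (hB.sub hA).sq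
  have g3 := (hg.sub hA).sq
  have g4 := (hB.sub (hv.cmul ψ)).mul (hg.sub (hv.cmul ψ))
  rw [← integral_const_mul, ← integral_const_mul, ← integral_const_mul, ← integral_const_mul,
    ← integral_sub (g1.cmul _).integrable (g2.cmul _).integrable,
    ← integral_sub ((g1.cmul _).sub (g2.cmul _)).integrable (g3.cmul _).integrable]
  refine integral_mono (((g1.cmul _).sub (g2.cmul _)).sub (g3.cmul _)).integrable
    (g4.cmul _).integrable fun x => ?_
  simp only
  generalize A x = a, B x = b, g x = g, v x = w
  nlinarith [sq_nonneg ((a - ψ * w) + 4 * (b - a)), sq_nonneg ((a - ψ * w) + 4 * (g - a)),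
    sq_nonneg ((b - a) + (g - a))]

lemma int_B {n : ℕ} {A v : (Fin n → ℝ) → ℝ} (ψ : ℝ) (hA : Good A) (hv : Good v) :
    ∫ x, A x ^ 2 ≤ 2 * (∫ x, (A x - ψ * v x) ^ 2) + 2 * ψ ^ 2 * ∫ x, v x ^ 2 := by
  have g1 := (hA.sub (hv.cmul ψ)).sq
  rw [← integral_const_mul, ← integral_const_mul,
    ← integral_add (g1.cmul _).integrable (hv.sq.cmul _).integrable]
  refine integral_mono hA.sq.integrable ((g1.cmul _).add (hv.sq.cmul _)).integrable fun x => ?_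
  simp only
  nlinarith [sq_nonneg (A x - 2 * ψ * v x)]

lemma int_C {n : ℕ} {A v : (Fin n → ℝ) → ℝ} (ψ s : ℝ) (hA : Good A) (hv : Good v) :
    s * ∫ x, A x * v x ≤ s * ψ * (∫ x, v x ^ 2) + (∫ x, (A x - ψ * v x) ^ 2) / 8
      + 2 * s ^ 2 * ∫ x, v x ^ 2 := by
  have g1 := (hA.sub (hv.cmul ψ)).sq
  have e : (∫ x, (A x - ψ * v x) ^ 2) / 8 = (1 / 8) * ∫ x, (A x - ψ * v x) ^ 2 := by ring
  rw [e, ← integral_const_mul, ← integral_const_mul, ← integral_const_mul, ← integral_const_mul,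
    ← integral_add (hv.sq.cmul _).integrable (g1.cmul _).integrable,
    ← integral_add ((hv.sq.cmul _).add (g1.cmul _)).integrable (hv.sq.cmul _).integrable]
  refine integral_mono ((hA.mul hv).cmul _).integrable
    (((hv.sq.cmul _).add (g1.cmul _)).add (hv.sq.cmul _)).integrable fun x => ?_
  simp only
  nlinarith [sq_nonneg ((A x - ψ * v x) - 4 * s * v x)]

/-- the constant governing smallness -/
noncomputable def Dc (n lam C c2 c3 cT : ℝ) : ℝ :=
  80 * c2 * c3 * C ^ 2 + 10 * c2 * c3 * C ^ 2 + n * C / lam + n * C / lam + 2 * n ^ 2 * C ^ 2 / lam ^ 2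
   + (5 * c2 * c3 * C ^ 2 + 5 * c2 + 1) / (lam * cT)
   + 2 * (5 * c2 * c3 * C ^ 2 + 5 * c2 + 1) ^ 2 / (lam ^ 2 * cT) + 1 / cT

set_option maxHeartbeats 4000000 in
lemma alg (n lam C c2 c3 cT p q g G ω h N0 N1 N2 x2 r ℓ ff Eb Db Q1 Q : ℝ)
    (hn : 0 ≤ n) (hlam : 0 < lam) (hC : 0 ≤ C) (hc2 : 0 ≤ c2) (hc3 : 0 ≤ c3) (hcT : 0 < cT)
    (hp : 0 < p) (hq : 0 < q) (hg : 1 ≤ g) (hω : 0 ≤ ω) (hh : 0 < h) (hh1 : h ≤ 1)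
    (hph : p ≤ h) (hqh : q ≤ h) (hgh : 1 ≤ h * g) (hD : Dc n lam C c2 c3 cT * h ≤ 1)
    (hG : g ^ 2 * cT ≤ G * p) (hω1 : ω ≤ C * q) (hω2 : g ^ 2 * ω ≤ C * (G * p ^ 2))
    (hω3 : g ^ 2 * ω ^ 2 ≤ C ^ 2 * q * (G * p ^ 2))
    (hN0 : 0 ≤ N0) (hN1 : 0 ≤ N1) (hx2 : 0 ≤ x2)
    (iA : 3 / 2 * x2 - 5 * r - 5 * ff ≤ Q1)
    (iB : ℓ ≤ 2 * x2 + 2 * (1 / p) ^ 2 * N0)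
    (iC : ∀ s, 0 ≤ s → s * (lam * N1) ≤ s * (1 / p) * N0 + x2 / 8 + 2 * s ^ 2 * N0)
    (iD : - (n * (ω / p + C * (G * p * q)) * N1) ≤ Db)
    (iE : lam * N1 ≤ Eb)
    (iR : r ≤ c2 * (ω ^ 2 * N2 + N1)) (iN : N2 ≤ c3 * (ℓ + N1))
    (hQ : Q = Q1 + G * N0 + Db + (n * C / lam) * (G * p * q) * (Eb - (1 / p) * N0)) :
    g * N1 + g ^ 2 * N0 - 5 * ff ≤ Q := by
  have hG0 : 0 < G := by
    have : 0 < G * p := lt_of_lt_of_le (by positivity) hG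
    exact pos_of_mul_pos_left this hp.le
  unfold Dc at hD
  obtain ⟨K, hK⟩ : ∃ K, K = 5 * c2 * c3 * C ^ 2 + 5 * c2 + 1 := ⟨_, rfl⟩
  rw [← hK] at hD
  have hK0 : 0 < K := by rw [hK]; positivity
  have hg2 : 1 ≤ g ^ 2 := one_le_pow₀ hg
  -- bound on r
  have hr : 5 * r ≤ 10 * c2 * c3 * C ^ 2 * h * x2 + 10 * c2 * c3 * C ^ 2 * h * (G * N0)
      + (K - 1) * N1 := by
    have w1 : ω ^ 2 ≤ C ^ 2 * h := by
      calc ω ^ 2 ≤ (C * q) ^ 2 := pow_le_pow_left₀ hω hω1 2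
        _ = C ^ 2 * (q * q) := by ring
        _ ≤ C ^ 2 * (h * 1) := by gcongr; exact hqh.trans hh1
        _ = _ := by ring
    have w2 : ω ^ 2 * (1 / p) ^ 2 ≤ C ^ 2 * h * G := by
      have : ω ^ 2 ≤ C ^ 2 * q * (G * p ^ 2) :=
        le_trans (by nlinarith [sq_nonneg ω]) hω3
      calc ω ^ 2 * (1 / p) ^ 2 ≤ (C ^ 2 * q * (G * p ^ 2)) * (1 / p) ^ 2 := by gcongr
        _ = C ^ 2 * q * G := by field_simp
        _ ≤ _ := by gcongr
    have s1 : r ≤ c2 * (ω ^ 2 * (c3 * (2 * x2 + 2 * (1 / p) ^ 2 * N0 + N1)) + N1) := by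
      refine iR.trans ?_
      gcongr
      refine iN.trans ?_
      gcongr
    have e1 : c2 * (ω ^ 2 * (c3 * (2 * x2 + 2 * (1 / p) ^ 2 * N0 + N1)) + N1)
      = (2 * c2 * c3 * x2) * ω ^ 2 + (2 * c2 * c3 * N0) * (ω ^ 2 * (1 / p) ^ 2)
        + (c2 * c3 * N1) * ω ^ 2 + c2 * N1 := by ring
    have t1 : (2 * c2 * c3 * x2) * ω ^ 2 ≤ (2 * c2 * c3 * x2) * (C ^ 2 * h) := by gcongr
    have t2 : (2 * c2 * c3 * N0) * (ω ^ 2 * (1 / p) ^ 2) ≤ (2 * c2 * c3 * N0) * (C ^ 2 * h * G) := by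
      gcongr
    have t3 : (c2 * c3 * N1) * ω ^ 2 ≤ (c2 * c3 * N1) * (C ^ 2 * 1) := by
      gcongr
      exact w1.trans (by gcongr)
    rw [hK]
    linarith
  -- the term with the time derivative of the coefficients
  have hs1 : n * (ω / p) * N1 ≤ (n * C / lam) * h * (G * N0) + x2 / 8
      + 2 * n ^ 2 * C ^ 2 / lam ^ 2 * h * (G * N0) := by
    have := iC (n * (ω / p) / lam) (by positivity)
    have e : n * (ω / p) / lam * (lam * N1) = n * (ω / p) * N1 := by field_simp
    rw [e] at this
    refine this.trans ?_
    have i1 : n * (ω / p) / lam * (1 / p) * N0 ≤ (n * C / lam) * h * (G * N0) := by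
      have : ω ≤ C * (G * p ^ 2) * h := by
        have h3 : ω * 1 ≤ ω * (h * g ^ 2) := by
          gcongr
          nlinarith
        calc ω ≤ h * (g ^ 2 * ω) := by linarith
          _ ≤ h * (C * (G * p ^ 2)) := by gcongr
          _ = _ := by ring
      calc n * (ω / p) / lam * (1 / p) * N0 = (n / lam * (1 / p) ^ 2 * N0) * ω := by ring
        _ ≤ (n / lam * (1 / p) ^ 2 * N0) * (C * (G * p ^ 2) * h) := by gcongr
        _ = _ := by field_simp
    have i2 : 2 * (n * (ω / p) / lam) ^ 2 * N0 ≤ 2 * n ^ 2 * C ^ 2 / lam ^ 2 * h * (G * N0) := by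
      have : ω ^ 2 ≤ C ^ 2 * h * (G * p ^ 2) := by
        calc ω ^ 2 ≤ g ^ 2 * ω ^ 2 := by nlinarith [sq_nonneg ω]
          _ ≤ C ^ 2 * q * (G * p ^ 2) := hω3
          _ ≤ _ := by gcongr
      calc 2 * (n * (ω / p) / lam) ^ 2 * N0 = (2 * (n / lam) ^ 2 * (1 / p) ^ 2 * N0) * ω ^ 2 := by
            ring
        _ ≤ (2 * (n / lam) ^ 2 * (1 / p) ^ 2 * N0) * (C ^ 2 * h * (G * p ^ 2)) := by gcongr
        _ = _ := by field_simp
    linarith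
  have hs2 : K * g * N1 ≤ K / (lam * cT) * h * (G * N0) + x2 / 8
      + 2 * K ^ 2 / (lam ^ 2 * cT) * h * (G * N0) := by
    have := iC (K * g / lam) (by positivity)
    have e : K * g / lam * (lam * N1) = K * g * N1 := by field_simp
    rw [e] at this
    refine this.trans ?_
    have i1 : K * g / lam * (1 / p) * N0 ≤ K / (lam * cT) * h * (G * N0) := by
      have : g * cT ≤ h * (G * p) := by
        calc g * cT ≤ (g * cT) * (h * g) := le_mul_of_one_le_right (by positivity) hgh
          _ = h * (g ^ 2 * cT) := by ring
          _ ≤ _ := by gcongr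
      calc K * g / lam * (1 / p) * N0 = (K / (lam * cT) * (1 / p) * N0) * (g * cT) := by field_simp
        _ ≤ (K / (lam * cT) * (1 / p) * N0) * (h * (G * p)) := by gcongr
        _ = _ := by field_simp
    have i2 : 2 * (K * g / lam) ^ 2 * N0 ≤ 2 * K ^ 2 / (lam ^ 2 * cT) * h * (G * N0) := by
      calc 2 * (K * g / lam) ^ 2 * N0 = (2 * K ^ 2 / (lam ^ 2 * cT) * N0) * (g ^ 2 * cT) := by
            field_simp
        _ ≤ (2 * K ^ 2 / (lam ^ 2 * cT) * N0) * (G * h) := 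
            mul_le_mul_of_nonneg_left (hG.trans (mul_le_mul_of_nonneg_left hph hG0.le)) (by positivity)
        _ = _ := by ring
    linarith
  have hs3 : g ^ 2 * N0 ≤ 1 / cT * h * (G * N0) := by
    calc g ^ 2 * N0 = (1 / cT * N0) * (g ^ 2 * cT) := by field_simp
      _ ≤ (1 / cT * N0) * (G * h) := 
            mul_le_mul_of_nonneg_left (hG.trans (mul_le_mul_of_nonneg_left hph hG0.le)) (by positivity)
      _ = _ := by ring
  have hs4 : -(n * C / lam * h * (G * N0)) ≤
      - (n * (C * (G * p * q)) * N1) + (n * C / lam) * (G * p * q) * (Eb - (1 / p) * N0) := by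
    have t1 : (n * C / lam) * (G * p * q) * (lam * N1) ≤ (n * C / lam) * (G * p * q) * Eb := by
      gcongr
    have e1 : (n * C / lam) * (G * p * q) * (lam * N1) = n * (C * (G * p * q)) * N1 := by
      field_simp
    have e2 : (n * C / lam) * (G * p * q) * ((1 / p) * N0) = n * C / lam * q * (G * N0) := by
      field_simp
    have t2 : n * C / lam * q * (G * N0) ≤ n * C / lam * h * (G * N0) := by gcongr
    rw [mul_sub, e2]
    linarith
  have hKg : (K - 1) * N1 + g * N1 ≤ K * g * N1 := by
    have : 0 ≤ (K - 1) * (g - 1) * N1 := by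
      have : 0 ≤ K - 1 := by rw [hK]; have : 0 ≤ 5 * c2 * c3 * C ^ 2 + 5 * c2 := by positivity
                             linarith
      have : 0 ≤ g - 1 := by linarith
      positivity
    nlinarith
  have hGN : 0 ≤ G * N0 := by positivity
  -- smallness
  have pos1 : 0 ≤ c2 * c3 * C ^ 2 := by positivity
  have pos2 : 0 ≤ n * C / lam := by positivity
  have pos3 : 0 ≤ 2 * n ^ 2 * C ^ 2 / lam ^ 2 := by positivity
  have pos4 : 0 ≤ K / (lam * cT) := by positivity
  have pos5 : 0 ≤ 2 * K ^ 2 / (lam ^ 2 * cT) := by positivity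
  have pos6 : 0 ≤ 1 / cT := by positivity
  have sx : 10 * c2 * c3 * C ^ 2 * h * x2 ≤ 1 / 8 * x2 := by
    gcongr
    nlinarith [mul_nonneg pos1 hh.le, mul_nonneg pos2 hh.le, mul_nonneg pos3 hh.le,
      mul_nonneg pos4 hh.le, mul_nonneg pos5 hh.le, mul_nonneg pos6 hh.le]
  have sG := mul_le_mul_of_nonneg_right hD hGN
  have sG2 : 0 ≤ 80 * (c2 * c3 * C ^ 2) * h * (G * N0) := by positivity
  generalize G * N0 = Y at *
  have eD : -(n * (ω / p + C * (G * p * q)) * N1) =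
    - (n * (ω / p) * N1) - (n * (C * (G * p * q)) * N1) := by ring
  rw [eD] at iD
  rw [hQ]
  generalize n * C / lam * (G * p * q) * (Eb - 1 / p * N0) = Z at *
  generalize n * (C * (G * p * q)) * N1 = Z2 at *
  generalize n * (ω / p) * N1 = Z3 at *
  ring_nf at *
  linarith

end Carl

namespace Carl

/-- smallness constant in terms of the data -/
noncomputable def Dk (n : ℕ) (lam C cT : ℝ) : ℝ :=
  Dc n lam C (2 * n ^ 2 + 8 * C ^ 2 * n ^ 3) ((n + 1) * (n + n ^ 2 * C ^ 2) / lam ^ 2) cT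

lemma fixed_time {n : ℕ} {lam C M : ℝ} (hlam : 0 < lam) (hC : 0 ≤ C)
    {a b db : Fin n → Fin n → (Fin n → ℝ) → ℝ} (ha : Coef n lam C M a) (hb : Coef n lam C M b)
    (hdb : ∀ j k, Bd (db j k)) {v vt : (Fin n → ℝ) → ℝ} (hv : Sm v) (hvt : Sm vt)
    {cT p q g G ω h : ℝ} (hcT : 0 < cT)
    (hp : 0 < p) (hq : 0 < q) (hg : 1 ≤ g) (hω : 0 ≤ ω) (hh : 0 < h) (hh1 : h ≤ 1)
    (hph : p ≤ h) (hqh : q ≤ h) (hgh : 1 ≤ h * g) (hD : Dk n lam C cT * h ≤ 1)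
    (hG : g ^ 2 * cT ≤ G * p) (hω1 : ω ≤ C * q) (hω2 : g ^ 2 * ω ≤ C * (G * p ^ 2))
    (hω3 : g ^ 2 * ω ^ 2 ≤ C ^ 2 * q * (G * p ^ 2))
    (hba : ∀ j k x, |b j k x - a j k x| ≤ ω)
    (hdbb : ∀ j k x, |db j k x| ≤ ω / p + C * (G * p * q)) :
    g * (∫ x, S1 v x) + g ^ 2 * (∫ x, v x ^ 2) - 5 * (∫ x, (vt x - Lop a v x) ^ 2) ≤
      (n * C / lam) * (G * p * q) * ((∫ x, Bform b v v x) - (1 / p) * ∫ x, v x ^ 2)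
      - 2 * (1 / p) * ((∫ x, Bform b v v x) - (1 / p) * ∫ x, v x ^ 2)
      + ((∫ x, Bform db v v x) + 2 * (∫ x, Bform b v vt x) + G * (∫ x, v x ^ 2)
        - 2 * (1 / p) * ∫ x, v x * vt x) := by
  have gLa := Lop_good hC ha hv
  have gLb := Lop_good hC hb hv
  have e : 2 * ∫ x, (Lop b v x - (1 / p) * v x) * (vt x - (1 / p) * v x)
      = 2 * (∫ x, Bform b v vt x) - 2 * (1 / p) * (∫ x, Bform b v v x)
        - 2 * (1 / p) * (∫ x, v x * vt x) + 2 * (1 / p) ^ 2 * ∫ x, v x ^ 2 := by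
    rw [← Lop_ibp' hC hb hv hvt, ← Lop_ibp' hC hb hv hv]
    have g1 := gLb.mul hvt.good
    have g2 := gLb.mul hv.good
    have g3 := hv.good.mul hvt.good
    have g4 := hv.good.sq
    rw [← integral_const_mul, ← integral_const_mul, ← integral_const_mul, ← integral_const_mul,
      ← integral_const_mul, ← integral_sub (g1.cmul _).integrable (g2.cmul _).integrable,
      ← integral_sub ((g1.cmul _).sub (g2.cmul _)).integrable (g3.cmul _).integrable,
      ← integral_add (((g1.cmul _).sub (g2.cmul _)).sub (g3.cmul _)).integrable
        (g4.cmul _).integrable]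
    refine integral_congr_ae (Filter.Eventually.of_forall fun x => ?_)
    simp only
    ring
  refine alg n lam C (2 * n ^ 2 + 8 * C ^ 2 * n ^ 3) ((n + 1) * (n + n ^ 2 * C ^ 2) / lam ^ 2) cT
    p q g G ω h (∫ x, v x ^ 2) (∫ x, S1 v x) (∫ x, S2 v x)
    (∫ x, (Lop a v x - (1 / p) * v x) ^ 2) (∫ x, (Lop b v x - Lop a v x) ^ 2)
    (∫ x, Lop a v x ^ 2) _ (∫ x, Bform b v v x) (∫ x, Bform db v v x)
    (2 * ∫ x, (Lop b v x - (1 / p) * v x) * (vt x - (1 / p) * v x)) _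
    (by positivity) hlam hC (by positivity) (by positivity) hcT hp hq hg hω hh hh1 hph hqh hgh hD
    hG hω1 hω2 hω3 (integral_nonneg fun x => by positivity)
    (integral_nonneg fun x => by unfold S1; positivity)
    (integral_nonneg fun x => by positivity)
    (int_A _ gLa gLb hvt.good hv.good) (int_B _ gLa hv.good) ?_
    (Bform_upper hdb hdbb hv) (Bform_lower hb hv) (Lop_diff hC ha hb hba hv)
    (ell_reg hlam hC ha hv) ?_
  · intro s hs
    refine le_trans ?_ (int_C (1 / p) s gLa hv.good)
    rw [Lop_ibp' hC ha hv hv]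
    exact mul_le_mul_of_nonneg_left (Bform_lower ha hv) hs
  · rw [e]; ring

end Carl

namespace Carl

/-- smooth, compactly supported functions of time and space -/
structure SU {n : ℕ} (U : ℝ → (Fin n → ℝ) → ℝ) : Prop where
  cd : ContDiff ℝ (⊤ : ℕ∞) (Function.uncurry U)
  supp : HasCompactSupport (Function.uncurry U)

noncomputable def dd {n : ℕ} (v : ℝ × (Fin n → ℝ)) (U : ℝ → (Fin n → ℝ) → ℝ) (t : ℝ)
    (x : Fin n → ℝ) : ℝ := fderiv ℝ (Function.uncurry U) (t, x) v

/-- time derivative -/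
noncomputable def dt {n : ℕ} (U : ℝ → (Fin n → ℝ) → ℝ) : ℝ → (Fin n → ℝ) → ℝ := dd (1, 0) U

/-- space derivative -/
noncomputable def dx {n : ℕ} (k : Fin n) (U : ℝ → (Fin n → ℝ) → ℝ) : ℝ → (Fin n → ℝ) → ℝ :=
  dd (0, Pi.single k 1) U

section
variable {n : ℕ} {U : ℝ → (Fin n → ℝ) → ℝ}

lemma SU.dd (h : SU U) (v : ℝ × (Fin n → ℝ)) : SU (Carl.dd v U) := by
  have e : Function.uncurry (Carl.dd v U) = fun z => fderiv ℝ (Function.uncurry U) z v := by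
    ext ⟨t, x⟩; rfl
  constructor
  · rw [e]
    exact (h.cd.fderiv_right (m := (⊤ : ℕ∞)) (by simp)).clm_apply contDiff_const
  · rw [e]
    exact h.supp.fderiv_apply (𝕜 := ℝ) _

lemma SU.dt (h : SU U) : SU (Carl.dt U) := h.dd _
lemma SU.dx (h : SU U) (k : Fin n) : SU (Carl.dx k U) := h.dd _

lemma SU.cont (h : SU U) : Continuous (Function.uncurry U) := h.cd.continuous

lemma SU.dd_comm (h : SU U) (v w : ℝ × (Fin n → ℝ)) (t : ℝ) (x : Fin n → ℝ) :
    Carl.dd v (Carl.dd w U) t x = Carl.dd w (Carl.dd v U) t x := by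
  have hsym := (h.cd.contDiffAt (x := (t, x))).isSymmSndFDerivAt
    (by simpa using (WithTop.coe_le_coe.2 (le_top : (2 : ℕ∞) ≤ ⊤)))
  have h1 : ∀ v w : ℝ × (Fin n → ℝ), Carl.dd v (Carl.dd w U) t x
      = fderiv ℝ (fderiv ℝ (Function.uncurry U)) (t, x) v w := by
    intro v w
    have e : Function.uncurry (Carl.dd w U) = fun z => fderiv ℝ (Function.uncurry U) z w := by
      ext ⟨t, x⟩; rfl
    have hd : DifferentiableAt ℝ (fderiv ℝ (Function.uncurry U)) (t, x) :=
      ((h.cd.fderiv_right (m := (⊤ : ℕ∞)) (by simp)).differentiable (by simp)) _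
    change fderiv ℝ (Function.uncurry (Carl.dd w U)) (t, x) v = _
    rw [e, fderiv_clm_apply hd (by fun_prop)]
    simp
  rw [h1, h1]
  exact hsym _ _

lemma SU.fd (h : SU U) (t : ℝ) (x : Fin n → ℝ) :
    HasFDerivAt (Function.uncurry U) (fderiv ℝ (Function.uncurry U) (t, x)) (t, x) :=
  (h.cd.differentiable (by simp) (t, x)).hasFDerivAt

lemma SU.hasDerivAt (h : SU U) (t : ℝ) (x : Fin n → ℝ) :
    HasDerivAt (fun s => U s x) (Carl.dt U t x) t := by
  have h2 : HasDerivAt (fun s : ℝ => (s, x)) ((1 : ℝ), (0 : Fin n → ℝ)) t :=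
    (hasDerivAt_id t).prodMk (hasDerivAt_const t x)
  exact (h.fd t x).comp_hasDerivAt t h2

lemma SU.pd_eq (h : SU U) (k : Fin n) (t : ℝ) : pd k (U t) = Carl.dx k U t := by
  ext x
  have h2 : HasFDerivAt (fun y : Fin n → ℝ => (t, y)) (ContinuousLinearMap.inr ℝ ℝ (Fin n → ℝ)) x :=
    hasFDerivAt_prodMk_right t x
  have h3 := (h.fd t x).comp x h2
  have h4 : HasFDerivAt (U t) _ x := h3
  unfold pd
  rw [h4.fderiv]
  simp [Carl.dx, Carl.dd]

lemma SU.dx_hasDerivAt (h : SU U) (k : Fin n) (t : ℝ) (x : Fin n → ℝ) :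
    HasDerivAt (fun s => Carl.dx k U s x) (Carl.dx k (Carl.dt U) t x) t :=
  ((h.dx k).hasDerivAt t x).congr_deriv (h.dd_comm _ _ t x)

/-- spatial support -/
def SK (U : ℝ → (Fin n → ℝ) → ℝ) : Set (Fin n → ℝ) := Set.image Prod.snd (tsupport (Function.uncurry U))

lemma SU.SK_compact (h : SU U) : IsCompact (SK U) :=
  IsCompact.image (show IsCompact (tsupport (Function.uncurry U)) from h.supp) continuous_snd

lemma SK_notMem {t : ℝ} {x : Fin n → ℝ} (hx : x ∉ SK U) : (t, x) ∉ tsupport (Function.uncurry U) :=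
  fun h => hx ⟨_, h, rfl⟩

lemma SK_zero {x : Fin n → ℝ} (hx : x ∉ SK U) (t : ℝ) : U t x = 0 :=
  image_eq_zero_of_notMem_tsupport (f := Function.uncurry U) (SK_notMem (t := t) hx)

lemma SK_dd {x : Fin n → ℝ} (hx : x ∉ SK U) (v) (t : ℝ) : dd v U t x = 0 := by
  unfold dd
  rw [fderiv_of_notMem_tsupport ℝ (SK_notMem (t := t) hx)]
  simp

lemma SK_dd_sub (v) : SK (dd v U) ⊆ SK U := by
  have e : Function.uncurry (Carl.dd v U) = fun z => fderiv ℝ (Function.uncurry U) z v := by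
    ext ⟨t, x⟩; rfl
  unfold SK
  rw [e]
  exact image_mono (tsupport_fderiv_apply_subset ℝ v)

lemma SU.sm (h : SU U) (t : ℝ) : Sm (U t) := by
  refine ⟨h.cd.comp (contDiff_prodMk_right t), ?_⟩
  exact HasCompactSupport.intro h.SK_compact fun x hx => SK_zero hx t

lemma SU.bdd (h : SU U) : ∃ B, ∀ t x, |U t x| ≤ B := by
  obtain ⟨B, hB⟩ := h.supp.exists_bound_of_continuous h.cont
  exact ⟨B, fun t x => by simpa using hB (t, x)⟩

lemma SU.vanish (h : SU U) {T : ℝ} (hs : tsupport (Function.uncurry U) ⊆ Icc 0 (T/2) ×ˢ univ)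
    {t : ℝ} (ht : t ∉ Ioo 0 (T/2)) (x : Fin n → ℝ) : U t x = 0 := by
  have hc : Continuous fun s => U s x := h.cont.comp (by fun_prop : Continuous fun s : ℝ => (s, x))
  have hz : ∀ s, s ∉ Icc 0 (T/2) → U s x = 0 := fun s hs' =>
    image_eq_zero_of_notMem_tsupport (f := Function.uncurry U) (x := (s, x))
      fun hm => hs' (hs hm).1
  have hcl : IsClosed {s | U s x = 0} := isClosed_eq hc continuous_const
  have h1 : (Icc 0 (T/2))ᶜ ⊆ {s | U s x = 0} := fun s hs' => hz s hs'
  have h2 := hcl.closure_subset_iff.2 h1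
  rw [closure_compl, interior_Icc] at h2
  exact h2 ht

end

/-- differentiation under the integral sign -/
lemma hasDerivAt_int {n : ℕ} {f f' : ℝ → (Fin n → ℝ) → ℝ} {s : Set ℝ} (hs : IsOpen s) {t₀ : ℝ}
    (ht₀ : t₀ ∈ s) {K : Set (Fin n → ℝ)} (hK : IsCompact K)
    (hcont : ∀ t ∈ s, Continuous (f t)) (hsupp : ∀ t, ∀ x, x ∉ K → f t x = 0)
    (hder : ∀ t ∈ s, ∀ x, HasDerivAt (fun t => f t x) (f' t x) t)
    (hf' : ContinuousOn (Function.uncurry f') (s ×ˢ univ)) :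
    HasDerivAt (fun t => ∫ x, f t x) (∫ x, f' t₀ x) t₀ := by
  obtain ⟨ε, hε, hball⟩ := Metric.nhds_basis_closedBall.mem_iff.1 (hs.mem_nhds ht₀)
  have hcpt : IsCompact (Metric.closedBall t₀ ε ×ˢ K) := (isCompact_closedBall _ _).prod hK
  obtain ⟨B, hB⟩ := hcpt.exists_bound_of_continuousOn
    (hf'.mono (prod_mono hball (subset_univ K)))
  have hz : ∀ t ∈ s, ∀ x, x ∉ K → f' t x = 0 := by
    intro t ht x hx
    have h1 : HasDerivAt (fun t => f t x) 0 t := by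
      have : (fun t => f t x) = fun _ => 0 := funext fun t => hsupp t x hx
      rw [this]; exact hasDerivAt_const _ _
    exact (hder t ht x).unique h1
  have hc' : Continuous (f' t₀) := by
    have : ContinuousOn (f' t₀) univ := hf'.comp (f := fun x => (t₀, x)) (by fun_prop)
      fun x _ => ⟨ht₀, mem_univ _⟩
    exact continuousOn_univ.1 this
  refine (hasDerivAt_integral_of_dominated_loc_of_deriv_le (bound := K.indicator fun _ => B)
    (Metric.closedBall_mem_nhds t₀ hε) ?_ ?_ hc'.aestronglyMeasurable ?_ ?_ ?_).2
  · filter_upwards [hs.mem_nhds ht₀] with t ht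
    exact (hcont t ht).aestronglyMeasurable
  · exact (hcont t₀ ht₀).integrable_of_hasCompactSupport
      (HasCompactSupport.intro hK fun x hx => hsupp t₀ x hx)
  · refine Filter.Eventually.of_forall fun x t ht => ?_
    by_cases hx : x ∈ K
    · rw [indicator_of_mem hx]
      exact hB (t, x) ⟨ht, hx⟩
    · rw [indicator_of_notMem hx, hz t (hball ht) x hx, norm_zero]
  · rw [integrable_indicator_iff hK.measurableSet]
    exact integrableOn_const hK.measure_lt_top.ne
  · exact Filter.Eventually.of_forall fun x t ht => hder t (hball ht) x

lemma cont_int {n : ℕ} {f : ℝ → (Fin n → ℝ) → ℝ} {K : Set (Fin n → ℝ)} (hK : IsCompact K)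
    (hf : Continuous (Function.uncurry f)) (hsupp : ∀ t, ∀ x, x ∉ K → f t x = 0) :
    Continuous fun t => ∫ x, f t x := by
  rw [← continuousOn_univ]
  exact continuousOn_integral_of_compact_support hK hf.continuousOn fun t x _ hx => hsupp t x hx

end Carl

namespace Carl

/-- time dependent coefficients, extended to all times -/
structure TC (n : ℕ) (T lam C M α : ℝ) (μ : ℝ → ℝ)
    (a : Fin n → Fin n → ℝ → (Fin n → ℝ) → ℝ) : Prop where
  cont : ∀ j k, Continuous (Function.uncurry (a j k))
  coef : ∀ t, Coef n lam C M (fun j k => a j k t)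
  hold : ∀ j k t s x, |a j k t x - a j k s x| ≤ C * |t - s| ^ α
  osg : ∀ j k, ∀ t ∈ Ioc 0 T, ∀ s₁ ∈ Icc t T, ∀ s₂ ∈ Icc t T, ∀ x,
      |a j k s₁ x - a j k s₂ x| ≤ C * t ^ (α - 1) * μ |s₁ - s₂|

/-- averaged coefficients -/
noncomputable def av {n : ℕ} (a : Fin n → Fin n → ℝ → (Fin n → ℝ) → ℝ) (p : ℝ → ℝ) (t : ℝ)
    (j k : Fin n) (x : Fin n → ℝ) : ℝ := ∫ σ in (0:ℝ)..1, a j k (t + p t * σ) x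

/-- their time derivative -/
noncomputable def dav {n : ℕ} (a : Fin n → Fin n → ℝ → (Fin n → ℝ) → ℝ) (p p' : ℝ → ℝ) (t : ℝ)
    (j k : Fin n) (x : Fin n → ℝ) : ℝ :=
  (a j k (t + p t) x - a j k t x) / p t + (p' t / p t) * (a j k (t + p t) x - av a p t j k x)

section
variable {n : ℕ} {T lam C M α : ℝ} {μ : ℝ → ℝ} {a : Fin n → Fin n → ℝ → (Fin n → ℝ) → ℝ}
  {p p' : ℝ → ℝ}

lemma TC.cont1 (h : TC n T lam C M α μ a) (j k : Fin n) (x : Fin n → ℝ) :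
    Continuous fun s => a j k s x :=
  (h.cont j k).comp (by fun_prop : Continuous fun s : ℝ => (s, x))

lemma TC.av_cont (h : TC n T lam C M α μ a) (hp : Continuous p) (j k : Fin n) :
    Continuous (fun z : ℝ × (Fin n → ℝ) => av a p z.1 j k z.2) := by
  unfold av
  refine intervalIntegral.continuous_parametric_intervalIntegral_of_continuous' ?_ 0 1
  exact (h.cont j k).comp (by fun_prop :
    Continuous fun z : (ℝ × (Fin n → ℝ)) × ℝ => (z.1.1 + p z.1.1 * z.2, z.1.2))

lemma TC.ii (h : TC n T lam C M α μ a) (j k : Fin n) (x : Fin n → ℝ) (t : ℝ) :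
    IntervalIntegrable (fun σ => a j k (t + p t * σ) x) volume 0 1 := by
  have : Continuous (fun σ => a j k (t + p t * σ) x) :=
    (h.cont1 j k x).comp (by fun_prop : Continuous fun σ : ℝ => t + p t * σ)
  exact this.intervalIntegrable _ _

lemma TC.av_dist (h : TC n T lam C M α μ a) (j k : Fin n) (x y : Fin n → ℝ) (t s : ℝ) {B : ℝ}
    (hB : ∀ σ ∈ Icc (0:ℝ) 1, |a j k (t + p t * σ) x - a j k s y| ≤ B) :
    |av a p t j k x - a j k s y| ≤ B := by
  have e : av a p t j k x - a j k s y = ∫ σ in (0:ℝ)..1, (a j k (t + p t * σ) x - a j k s y) := by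
    rw [intervalIntegral.integral_sub (h.ii j k x t) (by simp)]
    simp [av]
  rw [e]
  have := intervalIntegral.norm_integral_le_of_norm_le_const (a := 0) (b := 1) (C := B)
    (f := fun σ => a j k (t + p t * σ) x - a j k s y) (fun σ hσ => by
      rw [uIoc_of_le zero_le_one] at hσ
      exact hB σ ⟨hσ.1.le, hσ.2⟩)
  simpa using this

lemma TC.av_coef (h : TC n T lam C M α μ a) (t : ℝ) : Coef n lam C M (av a p t) := by
  constructor
  · intro j k x y
    have e : av a p t j k x - av a p t j k y
        = ∫ σ in (0:ℝ)..1, (a j k (t + p t * σ) x - a j k (t + p t * σ) y) := by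
      rw [intervalIntegral.integral_sub (h.ii j k x t) (h.ii j k y t)]
      rfl
    rw [e]
    have := intervalIntegral.norm_integral_le_of_norm_le_const (a := 0) (b := 1)
      (C := C * dist x y) (f := fun σ => a j k (t + p t * σ) x - a j k (t + p t * σ) y)
      (fun σ _ => (h.coef (t + p t * σ)).lip j k x y)
    simpa using this
  · intro j k x
    have := intervalIntegral.norm_integral_le_of_norm_le_const (a := 0) (b := 1)
      (C := M) (f := fun σ => a j k (t + p t * σ) x)
      (fun σ _ => (h.coef (t + p t * σ)).bdd j k x)
    simpa [av] using this
  · intro j k x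
    unfold av
    refine intervalIntegral.integral_congr fun σ _ => ?_
    exact (h.coef (t + p t * σ)).symm j k x
  · intro x ξ
    have cc : ∀ j k, Continuous (fun σ => a j k (t + p t * σ) x * ξ j * ξ k) := fun j k =>
      (((h.cont1 j k x).comp (by fun_prop : Continuous fun σ : ℝ => t + p t * σ)).mul
        continuous_const).mul continuous_const
    have e : ∑ j, ∑ k, av a p t j k x * ξ j * ξ k
        = ∫ σ in (0:ℝ)..1, ∑ j, ∑ k, a j k (t + p t * σ) x * ξ j * ξ k := by
      rw [intervalIntegral.integral_finsetSum]
      · refine Finset.sum_congr rfl fun j _ => ?_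
        rw [intervalIntegral.integral_finsetSum]
        · refine Finset.sum_congr rfl fun k _ => ?_
          rw [intervalIntegral.integral_mul_const, intervalIntegral.integral_mul_const]
          rfl
        · intro k _
          exact ((h.ii j k x t).mul_const _).mul_const _
      · intro j _
        exact (continuous_finsetSum _ fun k _ => cc j k).intervalIntegrable _ _
    have e2 : lam * ∑ j, ξ j ^ 2 = ∫ σ in (0:ℝ)..1, lam * ∑ j, ξ j ^ 2 := by simp
    rw [e, e2]
    refine intervalIntegral.integral_mono_on zero_le_one (by simp) ?_ fun σ _ => ?_
    · exact (continuous_finsetSum _ fun j _ =>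
        continuous_finsetSum _ fun k _ => cc j k).intervalIntegrable _ _
    · exact (h.coef (t + p t * σ)).ell x ξ

lemma TC.av_deriv (h : TC n T lam C M α μ a) (hp0 : ∀ t, 0 < p t) {t : ℝ}
    (hp : HasDerivAt p (p' t) t) (j k : Fin n) (x : Fin n → ℝ) :
    HasDerivAt (fun t => av a p t j k x) (dav a p p' t j k x) t := by
  set A : ℝ → ℝ := fun τ => ∫ s in (0:ℝ)..τ, a j k s x with hA
  have hc := h.cont1 j k x
  have hAd : ∀ τ, HasDerivAt A (a j k τ x) τ := fun τ =>
    intervalIntegral.integral_hasDerivAt_right (hc.intervalIntegrable _ _)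
      (hc.stronglyMeasurableAtFilter _ _) hc.continuousAt
  have e : ∀ t, av a p t j k x = (A (t + p t) - A t) / p t := by
    intro t
    have := intervalIntegral.mul_integral_comp_add_mul (a := 0) (b := 1)
      (f := fun s => a j k s x) (p t) t
    rw [eq_div_iff (hp0 t).ne', mul_comm]
    unfold av
    rw [this, hA]
    simp only [mul_zero, add_zero, mul_one]
    rw [intervalIntegral.integral_interval_sub_left (hc.intervalIntegrable _ _)
      (hc.intervalIntegrable _ _)]
  have h1 : HasDerivAt (fun t => A (t + p t)) (a j k (t + p t) x * (1 + p' t)) t :=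
    HasDerivAt.comp t (h₂ := A) (h := fun t => t + p t) (hAd (t + p t))
      ((hasDerivAt_id' t).fun_add hp)
  have h2 := (h1.sub (hAd t)).div hp (hp0 t).ne'
  have h3 : HasDerivAt (fun t => av a p t j k x) _ t :=
    h2.congr_of_eventuallyEq (Filter.Eventually.of_forall fun t => e t)
  refine h3.congr_deriv ?_
  unfold dav
  rw [e]
  have := (hp0 t).ne'
  simp only [Pi.sub_apply]
  field_simp
  ring

lemma TC.dav_cont (h : TC n T lam C M α μ a) (hp0 : ∀ t, 0 < p t) (hp : Continuous p) {s : Set ℝ}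
    (hp' : ContinuousOn p' s) (j k : Fin n) :
    ContinuousOn (fun z : ℝ × (Fin n → ℝ) => dav a p p' z.1 j k z.2) (s ×ˢ univ) := by
  unfold dav
  have c1 : Continuous (fun z : ℝ × (Fin n → ℝ) => a j k (z.1 + p z.1) z.2) :=
    (h.cont j k).comp (by fun_prop : Continuous fun z : ℝ × (Fin n → ℝ) => (z.1 + p z.1, z.2))
  have c2 : Continuous (fun z : ℝ × (Fin n → ℝ) => a j k z.1 z.2) := h.cont j k
  have c3 : Continuous (fun z : ℝ × (Fin n → ℝ) => p z.1) := by fun_prop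
  have c4 : ContinuousOn (fun z : ℝ × (Fin n → ℝ) => p' z.1) (s ×ˢ univ) :=
    hp'.comp continuous_fst.continuousOn fun z hz => hz.1
  exact ((c1.sub c2).div c3 fun z => (hp0 z.1).ne').continuousOn.add
    ((c4.div c3.continuousOn fun z _ => (hp0 z.1).ne').mul
      (c1.sub (h.av_cont hp j k)).continuousOn)

/-- the oscillation bound -/
noncomputable def om (C α : ℝ) (μ : ℝ → ℝ) (p : ℝ → ℝ) (t : ℝ) : ℝ :=
  C * min (p t ^ α) (t ^ (α - 1) * μ (p t))

lemma TC.osc (h : TC n T lam C M α μ a) (hμ : Mod μ) (hC : 0 ≤ C) (hα : 0 < α)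
    (hp : ∀ t, p t ∈ Ioc (0:ℝ) 1) {t : ℝ} (ht : t ∈ Ioc 0 T) (htp : t + p t ≤ T) (j k : Fin n)
    (x : Fin n → ℝ) {σ : ℝ} (hσ : σ ∈ Icc (0:ℝ) 1) :
    |a j k (t + p t * σ) x - a j k t x| ≤ om C α μ p t := by
  have hpt := hp t
  have h0 : 0 ≤ p t * σ := mul_nonneg hpt.1.le hσ.1
  have h1 : p t * σ ≤ p t := mul_le_of_le_one_right hpt.1.le hσ.2
  have e : t + p t * σ - t = p t * σ := by ring
  unfold om
  rw [mul_min_of_nonneg _ _ hC]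
  refine le_min ?_ ?_
  · refine (h.hold j k _ _ x).trans ?_
    rw [e, abs_of_nonneg h0]
    gcongr
  · refine (h.osg j k t ht _ ⟨by linarith, by linarith⟩ t ⟨le_rfl, ht.2⟩ x).trans ?_
    rw [e, abs_of_nonneg h0, mul_assoc]
    have : μ (p t * σ) ≤ μ (p t) :=
      hμ.mono.monotoneOn ⟨h0, h1.trans hpt.2⟩ ⟨hpt.1.le, hpt.2⟩ h1
    have := Real.rpow_nonneg ht.1.le (α - 1)
    gcongr

lemma TC.av_osc (h : TC n T lam C M α μ a) (hμ : Mod μ) (hC : 0 ≤ C) (hα : 0 < α)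
    (hp : ∀ t, p t ∈ Ioc (0:ℝ) 1) {t : ℝ} (ht : t ∈ Ioc 0 T) (htp : t + p t ≤ T) (j k : Fin n)
    (x : Fin n → ℝ) : |av a p t j k x - a j k t x| ≤ om C α μ p t :=
  h.av_dist j k x x t t fun _ hσ => h.osc hμ hC hα hp ht htp j k x hσ

lemma TC.dav_osc (h : TC n T lam C M α μ a) (hμ : Mod μ) (hC : 0 ≤ C) (hα : 0 < α)
    (hp : ∀ t, p t ∈ Ioc (0:ℝ) 1) {t : ℝ} (ht : t ∈ Ioc 0 T) (htp : t + p t ≤ T)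
    {G : ℝ} (hG : 0 ≤ G) (hpG : p' t = G * p t ^ 2) (j k : Fin n)
    (x : Fin n → ℝ) : |dav a p p' t j k x| ≤ om C α μ p t / p t + C * (G * p t * p t ^ α) := by
  have hpt := hp t
  unfold dav
  refine (abs_add_le _ _).trans (add_le_add ?_ ?_)
  · rw [abs_div, abs_of_pos hpt.1]
    have := h.osc hμ hC hα hp ht htp j k x (σ := 1) (by simp)
    rw [mul_one] at this
    gcongr
    exact hpt.1.le
  · have e : p' t / p t = G * p t := by rw [hpG]; field_simp [hpt.1.ne']
    rw [e, abs_mul, abs_of_nonneg (mul_nonneg hG hpt.1.le), abs_sub_comm]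
    have : |av a p t j k x - a j k (t + p t) x| ≤ C * p t ^ α := by
      refine h.av_dist j k x x t _ fun σ hσ => (h.hold j k _ _ x).trans ?_
      have e2 : t + p t * σ - (t + p t) = -(p t * (1 - σ)) := by ring
      have h0 : 0 ≤ p t * (1 - σ) := mul_nonneg hpt.1.le (by linarith [hσ.2])
      have h1 : p t * (1 - σ) ≤ p t := mul_le_of_le_one_right hpt.1.le (by linarith [hσ.1])
      rw [e2, abs_neg, abs_of_nonneg h0]
      gcongr
    calc G * p t * |av a p t j k x - a j k (t + p t) x| ≤ G * p t * (C * p t ^ α) := by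
          have := mul_nonneg hG hpt.1.le
          gcongr
      _ = _ := by ring

end

end Carl

namespace Carl

noncomputable def en {n : ℕ} (a : Fin n → Fin n → ℝ → (Fin n → ℝ) → ℝ) (p : ℝ → ℝ)
    (U : ℝ → (Fin n → ℝ) → ℝ) (t : ℝ) (x : Fin n → ℝ) : ℝ :=
  Bform (av a p t) (U t) (U t) x - (1 / p t) * U t x ^ 2

noncomputable def den {n : ℕ} (a : Fin n → Fin n → ℝ → (Fin n → ℝ) → ℝ) (p p' : ℝ → ℝ)
    (U : ℝ → (Fin n → ℝ) → ℝ) (t : ℝ) (x : Fin n → ℝ) : ℝ :=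
  Bform (dav a p p' t) (U t) (U t) x + 2 * Bform (av a p t) (U t) (dt U t) x
    + (p' t / p t ^ 2) * U t x ^ 2 - 2 * (1 / p t) * (U t x * dt U t x)

section
variable {n : ℕ} {T lam C M α : ℝ} {μ : ℝ → ℝ} {a : Fin n → Fin n → ℝ → (Fin n → ℝ) → ℝ}
  {p p' : ℝ → ℝ} {U : ℝ → (Fin n → ℝ) → ℝ}

lemma Bform_eq (hU : SU U) {V : ℝ → (Fin n → ℝ) → ℝ} (hV : SU V)
    (b : Fin n → Fin n → (Fin n → ℝ) → ℝ) (t : ℝ) (x : Fin n → ℝ) :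
    Bform b (U t) (V t) x = ∑ j, ∑ k, b j k x * dx k U t x * dx j V t x := by
  unfold Bform
  simp only [hU.pd_eq, hV.pd_eq]

lemma Bform_deriv (h : TC n T lam C M α μ a) (hp0 : ∀ t, 0 < p t) {t : ℝ}
    (hp : HasDerivAt p (p' t) t) (hU : SU U) (x : Fin n → ℝ) :
    HasDerivAt (fun t => Bform (av a p t) (U t) (U t) x)
      (Bform (dav a p p' t) (U t) (U t) x + 2 * Bform (av a p t) (U t) (dt U t) x) t := by
  have e0 : (fun t => Bform (av a p t) (U t) (U t) x)
    = fun t => ∑ j, ∑ k, av a p t j k x * dx k U t x * dx j U t x :=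
    funext fun t => Bform_eq hU hU _ t x
  rw [e0]
  have h1 := HasDerivAt.fun_sum (u := Finset.univ) (fun j (_ : j ∈ Finset.univ) =>
    HasDerivAt.fun_sum (u := Finset.univ) (fun k (_ : k ∈ Finset.univ) =>
    ((h.av_deriv hp0 hp j k x).fun_mul (hU.dx_hasDerivAt k t x)).fun_mul (hU.dx_hasDerivAt j t x)))
  refine h1.congr_deriv ?_
  have hs := Bform_symm (h.av_coef (p := p) t) (dt U t) (U t) x
  rw [two_mul]
  nth_rewrite 1 [← hs]
  rw [Bform_eq hU hU, Bform_eq hU hU.dt, Bform_eq hU.dt hU]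
  simp only [← Finset.sum_add_distrib]
  refine Finset.sum_congr rfl fun j _ => Finset.sum_congr rfl fun k _ => ?_
  ring

lemma en_deriv (h : TC n T lam C M α μ a) (hp0 : ∀ t, 0 < p t) {t : ℝ}
    (hp : HasDerivAt p (p' t) t) (hU : SU U) (x : Fin n → ℝ) :
    HasDerivAt (fun t => en a p U t x) (den a p p' U t x) t := by
  unfold en
  have h1 := Bform_deriv h hp0 hp hU x
  have h2 := ((hasDerivAt_const t (1:ℝ)).fun_div hp (hp0 t).ne').fun_mul
    ((hU.hasDerivAt t x).fun_pow 2)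
  refine (h1.fun_sub h2).congr_deriv ?_
  unfold den
  have := (hp0 t).ne'
  simp
  field_simp
  ring

lemma Bform_cont {s : Set (ℝ × (Fin n → ℝ))} {b : ℝ → Fin n → Fin n → (Fin n → ℝ) → ℝ}
    (hb : ∀ j k, ContinuousOn (fun z : ℝ × (Fin n → ℝ) => b z.1 j k z.2) s)
    (hU : SU U) {V : ℝ → (Fin n → ℝ) → ℝ} (hV : SU V) :
    ContinuousOn (fun z : ℝ × (Fin n → ℝ) => Bform (b z.1) (U z.1) (V z.1) z.2) s := by
  simp only [Bform_eq hU hV]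
  refine continuousOn_finsetSum _ fun j _ => continuousOn_finsetSum _ fun k _ => ?_
  exact ((hb j k).mul (hU.dx k).cont.continuousOn).mul (hV.dx j).cont.continuousOn

lemma SU.cont' (hU : SU U) : Continuous fun z : ℝ × (Fin n → ℝ) => U z.1 z.2 := hU.cont

lemma en_cont (h : TC n T lam C M α μ a) (hp0 : ∀ t, 0 < p t) (hp : Continuous p) (hU : SU U) :
    Continuous (Function.uncurry (en a p U)) := by
  have h1 := Bform_cont (s := univ) (fun j k => (h.av_cont hp j k).continuousOn) hU hU
  rw [continuousOn_univ] at h1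
  have h2 : Continuous (fun z : ℝ × (Fin n → ℝ) => 1 / p z.1) :=
    continuous_const.div (by fun_prop) fun z => (hp0 z.1).ne'
  exact h1.sub (h2.mul (hU.cont'.pow 2))

lemma den_cont (h : TC n T lam C M α μ a) (hp0 : ∀ t, 0 < p t) (hp : Continuous p) {s : Set ℝ}
    (hp' : ContinuousOn p' s) (hU : SU U) :
    ContinuousOn (Function.uncurry (den a p p' U)) (s ×ˢ univ) := by
  have h0 := Bform_cont (s := s ×ˢ univ) (h.dav_cont hp0 hp hp') hU hU
  have h1 := Bform_cont (s := s ×ˢ univ) (fun j k => (h.av_cont hp j k).continuousOn) hU hU.dt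
  have c3 : Continuous (fun z : ℝ × (Fin n → ℝ) => p z.1) := by fun_prop
  have h2 : Continuous (fun z : ℝ × (Fin n → ℝ) => 1 / p z.1) :=
    continuous_const.div c3 fun z => (hp0 z.1).ne'
  have c4 : ContinuousOn (fun z : ℝ × (Fin n → ℝ) => p' z.1) (s ×ˢ univ) :=
    hp'.comp continuous_fst.continuousOn fun z hz => hz.1
  have c5 : ContinuousOn (fun z : ℝ × (Fin n → ℝ) => p' z.1 / p z.1 ^ 2) (s ×ˢ univ) :=
    c4.div (c3.pow 2).continuousOn fun z _ => (pow_pos (hp0 z.1) 2).ne'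
  exact ((h0.add (continuousOn_const.mul h1)).add (c5.mul (hU.cont'.pow 2).continuousOn)).sub
    ((continuous_const.mul h2).mul (hU.cont'.mul hU.dt.cont')).continuousOn

lemma Bform_SK (hU : SU U) (b : Fin n → Fin n → (Fin n → ℝ) → ℝ) (V : (Fin n → ℝ) → ℝ) (t : ℝ)
    {x : Fin n → ℝ} (hx : x ∉ SK U) : Bform b (U t) V x = 0 := by
  unfold Bform
  refine Finset.sum_eq_zero fun j _ => Finset.sum_eq_zero fun k _ => ?_
  rw [hU.pd_eq]
  unfold dx
  rw [SK_dd hx]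
  ring

lemma en_SK (hU : SU U) (t : ℝ) {x : Fin n → ℝ} (hx : x ∉ SK U) : en a p U t x = 0 := by
  unfold en
  rw [Bform_SK hU _ _ t hx, SK_zero hx]
  ring

noncomputable def Ef (a : Fin n → Fin n → ℝ → (Fin n → ℝ) → ℝ) (p : ℝ → ℝ)
    (U : ℝ → (Fin n → ℝ) → ℝ) (t : ℝ) : ℝ :=
  (∫ x, Bform (av a p t) (U t) (U t) x) - (1 / p t) * ∫ x, U t x ^ 2

lemma Ef_eq (h : TC n T lam C M α μ a) (hU : SU U) :
    Ef a p U = fun t => ∫ x, en a p U t x := by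
  funext t
  unfold Ef en
  rw [integral_sub (Bform_good (h.av_coef t).bd (hU.sm t) (hU.sm t)).integrable
    ((hU.sm t).good.sq.cmul _).integrable, integral_const_mul]

lemma Ef_cont (h : TC n T lam C M α μ a) (hp0 : ∀ t, 0 < p t) (hp : Continuous p) (hU : SU U) :
    Continuous (Ef a p U) := by
  rw [Ef_eq h hU]
  exact cont_int hU.SK_compact (en_cont h hp0 hp hU) fun t x hx => en_SK hU t hx

lemma dav_bd (h : TC n T lam C M α μ a) (hp0 : ∀ t, 0 < p t) (hp : Continuous p) (t : ℝ)
    (j k : Fin n) : Bd (dav a p p' t j k) := by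
  have h1 : Bd (a j k t) := (h.coef t).bd j k
  have h2 : Bd (a j k (t + p t)) := (h.coef (t + p t)).bd j k
  have h3 : Bd (av a p t j k) := (h.av_coef t).bd j k
  have h4 := ((Bd.const (1 / p t)).mul (h2.sub h1)).add
    ((Bd.const (p' t / p t)).mul (h2.sub h3))
  have e : dav a p p' t j k = fun x => 1 / p t * (a j k (t + p t) x - a j k t x)
    + p' t / p t * (a j k (t + p t) x - av a p t j k x) := by
    funext x
    unfold dav
    ring
  rw [e]
  exact h4

lemma Ef_deriv (h : TC n T lam C M α μ a) (hp0 : ∀ t, 0 < p t) (hp : Continuous p) {s : Set ℝ}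
    (hs : IsOpen s) (hpd : ∀ t ∈ s, HasDerivAt p (p' t) t)
    (hp' : ContinuousOn p' s) (hU : SU U) {t : ℝ} (ht : t ∈ s) :
    HasDerivAt (Ef a p U) ((∫ x, Bform (dav a p p' t) (U t) (U t) x)
      + 2 * (∫ x, Bform (av a p t) (U t) (dt U t) x) + (p' t / p t ^ 2) * (∫ x, U t x ^ 2)
      - 2 * (1 / p t) * ∫ x, U t x * dt U t x) t := by
  rw [Ef_eq h hU]
  have hc : ∀ t, Continuous (en a p U t) := fun t => by
    have h1 := (en_cont h hp0 hp hU).comp (by fun_prop : Continuous fun x : Fin n → ℝ => (t, x))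
    exact h1
  have := hasDerivAt_int (f := en a p U) (f' := den a p p' U) hs ht hU.SK_compact
    (fun t _ => hc t)
    (fun t x hx => en_SK hU t hx)
    (fun t ht x => en_deriv h hp0 (hpd t ht) hU x) (den_cont h hp0 hp hp' hU)
  refine this.congr_deriv ?_
  unfold den
  have g1 := Bform_good (dav_bd (p' := p') h hp0 hp t) (hU.sm t) (hU.sm t)
  have g2 := Bform_good (h.av_coef (p := p) t).bd (hU.sm t) (hU.dt.sm t)
  have g3 := (hU.sm t).good.sq
  have g4 := (hU.sm t).good.mul (hU.dt.sm t).good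
  rw [integral_sub ((g1.add (g2.cmul _)).add (g3.cmul _)).integrable (g4.cmul _).integrable,
    integral_add (g1.add (g2.cmul _)).integrable (g3.cmul _).integrable,
    integral_add g1.integrable (g2.cmul _).integrable]
  simp only [integral_const_mul]

end

end Carl

namespace Carl

/-- squared norm of the equation residual -/
noncomputable def ff {n : ℕ} (a : Fin n → Fin n → ℝ → (Fin n → ℝ) → ℝ)
    (U : ℝ → (Fin n → ℝ) → ℝ) (t : ℝ) : ℝ :=
  ∫ x, (dt U t x - Lop (fun j k => a j k t) (U t) x) ^ 2

section
variable {n : ℕ} {T lam C M α : ℝ} {μ : ℝ → ℝ} {a : Fin n → Fin n → ℝ → (Fin n → ℝ) → ℝ}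
  {U : ℝ → (Fin n → ℝ) → ℝ}

lemma Lop_eq (hU : SU U) (b : Fin n → Fin n → (Fin n → ℝ) → ℝ) (t : ℝ) (x : Fin n → ℝ) :
    Lop b (U t) x = - ∑ j, ∑ k, (pd j (b j k) x * dx k U t x + b j k x * dx j (dx k U) t x) := by
  unfold Lop
  simp only [hU.pd_eq, (hU.dx _).pd_eq]

lemma res_meas (h : TC n T lam C M α μ a) (hU : SU U) :
    Measurable (fun z : ℝ × (Fin n → ℝ) =>
      dt U z.1 z.2 - Lop (fun j k => a j k z.1) (U z.1) z.2) := by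
  simp only [Lop_eq hU]
  refine hU.dt.cont'.measurable.sub (Measurable.neg ?_)
  refine Finset.measurable_fun_sum _ fun j _ => Finset.measurable_fun_sum _ fun k _ => ?_
  refine Measurable.add (Measurable.mul ?_ (hU.dx k).cont'.measurable)
    (Measurable.mul (h.cont j k).measurable ((hU.dx k).dx j).cont'.measurable)
  exact measurable_fderiv_apply_const_with_param ℝ (h.cont j k) (Pi.single j 1)

lemma ff_meas (h : TC n T lam C M α μ a) (hU : SU U) : StronglyMeasurable (ff a U) := by
  unfold ff
  exact StronglyMeasurable.integral_prod_right
    (f := fun t x => (dt U t x - Lop (fun j k => a j k t) (U t) x) ^ 2)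
    ((res_meas h hU).pow_const 2).stronglyMeasurable

lemma res_bdd (h : TC n T lam C M α μ a) (hC : 0 ≤ C) (hU : SU U) :
    ∃ B, ∀ t x, |dt U t x - Lop (fun j k => a j k t) (U t) x| ≤ B := by
  obtain ⟨B0, hB0⟩ := hU.dt.bdd
  choose B1 hB1 using fun k => (hU.dx k).bdd
  choose B2 hB2 using fun j k => ((hU.dx k).dx j).bdd
  refine ⟨B0 + ∑ j, ∑ k, (C * B1 k + M * B2 j k), fun t x => ?_⟩
  rw [Lop_eq hU, sub_neg_eq_add]
  refine (abs_add_le _ _).trans (add_le_add (hB0 t x) ?_)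
  refine (Finset.abs_sum_le_sum_abs _ _).trans (Finset.sum_le_sum fun j _ => ?_)
  refine (Finset.abs_sum_le_sum_abs _ _).trans (Finset.sum_le_sum fun k _ => ?_)
  refine (abs_add_le _ _).trans (add_le_add ?_ ?_)
  · rw [abs_mul]
    exact mul_le_mul (((h.coef t).lip j k).pd_bdd hC j x) (hB1 k t x) (abs_nonneg _) hC
  · rw [abs_mul]
    exact mul_le_mul ((h.coef t).bdd j k x) (hB2 j k t x) (abs_nonneg _)
      ((abs_nonneg _).trans ((h.coef t).bdd j k x))

lemma res_SK (hU : SU U) {x : Fin n → ℝ} (hx : x ∉ SK U) (t : ℝ) :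
    dt U t x - Lop (fun j k => a j k t) (U t) x = 0 := by
  rw [Lop_eq hU]
  have h1 : dt U t x = 0 := SK_dd hx _ t
  have h2 : ∀ k, dx k U t x = 0 := fun k => SK_dd hx _ t
  have h3 : ∀ j k, dx j (dx k U) t x = 0 := fun j k =>
    SK_dd (fun hm => hx (SK_dd_sub _ hm)) _ t
  simp [h1, h2, h3]

lemma ff_nonneg (t : ℝ) : 0 ≤ ff a U t := integral_nonneg fun x => by positivity

lemma ff_bdd (h : TC n T lam C M α μ a) (hC : 0 ≤ C) (hU : SU U) : ∃ B, ∀ t, ff a U t ≤ B := by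
  obtain ⟨B, hB⟩ := res_bdd h hC hU
  refine ⟨B ^ 2 * (volume (SK U)).toReal, fun t => ?_⟩
  have e : ff a U t = ∫ x in SK U, (dt U t x - Lop (fun j k => a j k t) (U t) x) ^ 2 := by
    unfold ff
    rw [setIntegral_eq_integral_of_forall_compl_eq_zero]
    intro x hx
    rw [res_SK hU hx]
    simp
  rw [e]
  have := norm_setIntegral_le_of_norm_le_const (μ := volume) (s := SK U) (C := B ^ 2)
    (f := fun x => (dt U t x - Lop (fun j k => a j k t) (U t) x) ^ 2)
    hU.SK_compact.measure_lt_top (fun x _ => by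
      rw [norm_pow]
      exact pow_le_pow_left₀ (norm_nonneg _) (hB t x) 2)
  exact (le_abs_self _).trans this

lemma ff_int (h : TC n T lam C M α μ a) (hC : 0 ≤ C) (hU : SU U) {w : ℝ → ℝ} (hw : Continuous w)
    (s t : ℝ) : IntervalIntegrable (fun t => w t * ff a U t) volume s t := by
  obtain ⟨B, hB⟩ := ff_bdd h hC hU
  refine IntervalIntegrable.continuousOn_mul ?_ hw.continuousOn
  refine (intervalIntegrable_const (c := B)).mono_fun (ff_meas h hU).aestronglyMeasurable ?_
  refine Filter.Eventually.of_forall fun t => ?_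
  show ‖ff a U t‖ ≤ ‖B‖
  rw [Real.norm_of_nonneg (ff_nonneg t)]
  exact (hB t).trans (le_abs_self _)

lemma N0_cont (hU : SU U) : Continuous fun t => ∫ x, U t x ^ 2 :=
  cont_int hU.SK_compact (f := fun t x => U t x ^ 2) (hU.cont'.pow 2)
    fun t x hx => by rw [SK_zero hx]; simp

lemma N1_cont (hU : SU U) : Continuous fun t => ∫ x, S1 (U t) x := by
  refine cont_int hU.SK_compact (f := fun t x => S1 (U t) x) ?_ ?_
  · unfold S1
    simp only [hU.pd_eq]
    exact continuous_finsetSum _ fun k _ => (hU.dx k).cont'.pow 2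
  · intro t x hx
    unfold S1
    simp only [hU.pd_eq]
    refine Finset.sum_eq_zero fun k _ => ?_
    have h2 : dx k U t x = 0 := SK_dd hx _ t
    rw [h2]; simp

lemma Ef_zero {p : ℝ → ℝ} {t : ℝ} (h : ∀ x, U t x = 0) : Ef a p U t = 0 := by
  have e : U t = fun _ => 0 := funext h
  unfold Ef Bform pd
  rw [e]
  simp

/-- the real Carleman estimate -/
lemma real_main (h : TC n T lam C M α μ a) (hμ : Mod μ) (hT : 0 < T) (hlam : 0 < lam) (hC : 0 ≤ C)
    (hα : 0 < α) (hα1 : α < 1) {γ : ℝ} (hγ : 1 ≤ γ)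
    (hD : Dk n lam C (T ^ (α - 1)) * (1 / √γ) ≤ 1)
    (hp1 : ∀ t ∈ Icc 0 (T/2), pf μ T α γ t ≤ 1 / √γ)
    (hp2 : ∀ t ∈ Icc 0 (T/2), pf μ T α γ t ^ α ≤ 1 / √γ)
    (hp3 : ∀ t ∈ Icc 0 (T/2), pf μ T α γ t ≤ T / 2)
    (hU : SU U) (hs : tsupport (Function.uncurry U) ⊆ Icc 0 (T/2) ×ˢ univ) :
    ∫ t in (0:ℝ)..(T/2), Wf μ T α γ t * (√γ * (∫ x, S1 (U t) x) + γ * ∫ x, U t x ^ 2)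
      ≤ 5 * Real.exp (n * C / lam / α) * ∫ t in (0:ℝ)..(T/2), Wf μ T α γ t * ff a U t := by
  have hγ0 : 0 < γ := by linarith
  set p := pf μ T α γ with hpdef
  set p' : ℝ → ℝ := fun t => γ * t ^ (α - 1) * μ (p t) with hp'def
  set κ := n * C / lam with hκ
  have hκ0 : 0 ≤ κ := by positivity
  have hpm : ∀ t, p t ∈ Ioc (0:ℝ) 1 := hμ.pf_mem hT hα hγ0
  have hp0 : ∀ t, 0 < p t := fun t => (hpm t).1
  have hpc : Continuous p := hμ.pf_cont hT hα hγ0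
  have hpd : ∀ t ∈ Ioo 0 T, HasDerivAt p (p' t) t := fun t ht => hμ.pf_deriv hT hα hγ0 ht
  have hpc' : ContinuousOn p' (Ioo 0 T) := by
    refine ContinuousOn.mul (continuousOn_const.mul ?_) ?_
    · exact ContinuousOn.rpow_const continuousOn_id fun t ht => Or.inl ht.1.ne'
    · exact hμ.cont.comp hpc.continuousOn fun t _ => ⟨(hp0 t).le, (hpm t).2⟩
  set w : ℝ → ℝ := fun t => Real.exp (κ * (p t ^ α / α)) with hw
  have hwc : Continuous w := by
    have : Continuous fun t => p t ^ α := hpc.rpow_const fun _ => Or.inr hα.le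
    fun_prop
  have hwd : ∀ t ∈ Ioo 0 T, HasDerivAt w (κ * (p t ^ (α - 1) * p' t) * w t) t := by
    intro t ht
    have := ((((hpd t ht).rpow_const (p := α) (Or.inl (hp0 t).ne')).div_const α).const_mul κ).exp
    refine this.congr_deriv ?_
    rw [hw]
    field_simp
  have hw1 : ∀ t, 1 ≤ w t := fun t => by
    rw [hw]
    refine Real.one_le_exp ?_
    have := Real.rpow_nonneg (hp0 t).le α
    positivity
  have hw2 : ∀ t, w t ≤ Real.exp (κ / α) := fun t => by
    rw [hw]
    refine Real.exp_le_exp.2 ?_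
    rw [← mul_div_assoc]
    have := Real.rpow_le_one (hp0 t).le (hpm t).2 hα.le
    gcongr
    exact mul_le_of_le_one_right hκ0 this
  have hWd : ∀ t, HasDerivAt (Wf μ T α γ) (-(2 * (1 / p t)) * Wf μ T α γ t) t :=
    hμ.Wf_deriv hT hα hγ0
  have hWc : Continuous (Wf μ T α γ) := continuous_iff_continuousAt.2 fun t => (hWd t).continuousAt
  set W := Wf μ T α γ with hWdef
  have hW0 : ∀ t, 0 < W t := fun t => Wf_pos t
  have hT2 : (0:ℝ) ≤ T / 2 := by linarith
  set N : ℝ → ℝ := fun t => √γ * (∫ x, S1 (U t) x) + γ * ∫ x, U t x ^ 2 with hN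
  have hNc : Continuous N := (continuous_const.mul (N1_cont hU)).add
    (continuous_const.mul (N0_cont hU))
  have hN0 : ∀ t, 0 ≤ N t := fun t => by
    have i1 : 0 ≤ ∫ x, S1 (U t) x := integral_nonneg fun x => by unfold S1; positivity
    have i2 : 0 ≤ ∫ x, U t x ^ 2 := integral_nonneg fun x => by positivity
    rw [hN]; positivity
  have hsg : √γ ^ 2 = γ := Real.sq_sqrt hγ0.le
  have hsg0 : 0 < √γ := Real.sqrt_pos.2 hγ0
  have hsg1 : 1 ≤ √γ := Real.one_le_sqrt.2 hγ
  -- the pointwise inequality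
  have key : ∀ t ∈ Ioo 0 (T/2), N t - 5 * ff a U t ≤
      κ * (p t ^ (α - 1) * p' t) * Ef a p U t - 2 * (1 / p t) * Ef a p U t
      + ((∫ x, Bform (dav a p p' t) (U t) (U t) x)
      + 2 * (∫ x, Bform (av a p t) (U t) (dt U t) x) + (p' t / p t ^ 2) * (∫ x, U t x ^ 2)
      - 2 * (1 / p t) * ∫ x, U t x * dt U t x) := by
    intro t ht
    have htI : t ∈ Icc 0 (T/2) := ⟨ht.1.le, ht.2.le⟩
    have htT : t ∈ Ioc 0 T := ⟨ht.1, by linarith [ht.2]⟩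
    have htp : t + p t ≤ T := by linarith [ht.2, hp3 t htI]
    have hpt := hp0 t
    have hθ : T ^ (α - 1) ≤ t ^ (α - 1) :=
      Real.rpow_le_rpow_of_nonpos ht.1 htT.2 (by linarith)
    have hcT : 0 < T ^ (α - 1) := Real.rpow_pos_of_pos hT _
    have hθ0 : 0 < t ^ (α - 1) := hcT.trans_le hθ
    have hμp : p t ≤ μ (p t) := hμ.ge ⟨hpt.le, (hpm t).2⟩
    have hμ0 : 0 < μ (p t) := hpt.trans_le hμp
    have hq0 : 0 < p t ^ α := Real.rpow_pos_of_pos hpt _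
    have hp'0 : 0 < p' t := by rw [hp'def]; positivity
    have hGp : p' t = p' t / p t ^ 2 * p t ^ 2 := by field_simp
    have hG0 : 0 ≤ p' t / p t ^ 2 := by positivity
    have hom0 : 0 ≤ om C α μ p t := by
      unfold om
      exact mul_nonneg hC (le_min hq0.le (by positivity))
    have hom1 : om C α μ p t ≤ C * p t ^ α := by
      unfold om
      exact mul_le_mul_of_nonneg_left (min_le_left _ _) hC
    have hom2 : om C α μ p t ≤ C * (t ^ (α - 1) * μ (p t)) := by
      unfold om
      exact mul_le_mul_of_nonneg_left (min_le_right _ _) hC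
    have hom3 : √γ ^ 2 * om C α μ p t ≤ C * p' t := by
      rw [hsg]
      calc γ * om C α μ p t ≤ γ * (C * (t ^ (α - 1) * μ (p t))) := by gcongr
        _ = _ := by rw [hp'def]; ring
    have hom4 : √γ ^ 2 * om C α μ p t ^ 2 ≤ C ^ 2 * p t ^ α * p' t := by
      calc √γ ^ 2 * om C α μ p t ^ 2 = om C α μ p t * (√γ ^ 2 * om C α μ p t) := by ring
        _ ≤ (C * p t ^ α) * (C * p' t) := by gcongr
        _ = _ := by ring
    have hG : √γ ^ 2 * T ^ (α - 1) ≤ p' t / p t ^ 2 * p t := by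
      rw [hsg]
      have : p' t / p t ^ 2 * p t = γ * t ^ (α - 1) * (μ (p t) / p t) := by
        rw [hp'def]; field_simp
      rw [this]
      have h1 : 1 ≤ μ (p t) / p t := by rw [le_div_iff₀ hpt]; linarith
      calc γ * T ^ (α - 1) ≤ γ * t ^ (α - 1) * 1 := by rw [mul_one]; gcongr
        _ ≤ _ := by gcongr
    have := fixed_time hlam hC (h.coef t) (h.av_coef (p := p) t) (dav_bd (p' := p') h hp0 hpc t)
      (hU.sm t) (hU.dt.sm t) (cT := T ^ (α - 1)) (p := p t) (q := p t ^ α) (g := √γ)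
      (G := p' t / p t ^ 2) (ω := om C α μ p t) (h := 1 / √γ) hcT hpt hq0 hsg1 hom0
      (by positivity) (by rw [div_le_one hsg0]; exact hsg1) (hp1 t htI) (hp2 t htI)
      (by rw [one_div, inv_mul_cancel₀ hsg0.ne']) hD hG hom1 (by rw [← hGp]; exact hom3)
      (by rw [← hGp]; exact hom4)
      (fun j k x => h.av_osc hμ hC hα hpm htT htp j k x)
      (fun j k x => h.dav_osc hμ hC hα hpm htT htp hG0 hGp j k x)
    rw [hsg] at this
    have eq : p t ^ (α - 1) * p' t = p' t / p t ^ 2 * p t * p t ^ α := by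
      rw [Real.rpow_sub_one hpt.ne']; field_simp
    rw [eq]
    exact this
  -- integrate in time
  have hFc : Continuous fun t => w t * W t * Ef a p U t :=
    (hwc.mul hWc).mul (Ef_cont h hp0 hpc hU)
  have hφ1 : IntervalIntegrable (fun t => w t * W t * N t) volume 0 (T/2) :=
    ((hwc.mul hWc).mul hNc).intervalIntegrable _ _
  have hφ2 : IntervalIntegrable (fun t => w t * W t * ff a U t) volume 0 (T/2) :=
    ff_int h hC hU (hwc.mul hWc) _ _
  have hφ3 := hφ1.sub (hφ2.const_mul 5)
  have main := intervalIntegral.integral_le_sub_of_hasDeriv_right_of_le hT2 hFc.continuousOn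
    (g' := fun t => w t * W t * (κ * (p t ^ (α - 1) * p' t) * Ef a p U t
      - 2 * (1 / p t) * Ef a p U t
      + ((∫ x, Bform (dav a p p' t) (U t) (U t) x)
      + 2 * (∫ x, Bform (av a p t) (U t) (dt U t) x) + (p' t / p t ^ 2) * (∫ x, U t x ^ 2)
      - 2 * (1 / p t) * ∫ x, U t x * dt U t x)))
    (φ := fun t => w t * W t * N t - 5 * (w t * W t * ff a U t))
    (fun t ht => by
      have htT : t ∈ Ioo 0 T := ⟨ht.1, by linarith [ht.2]⟩
      have h1 := ((hwd t htT).fun_mul (hWd t)).fun_mul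
        (Ef_deriv h hp0 hpc isOpen_Ioo hpd hpc' hU htT)
      refine (h1.congr_deriv ?_).hasDerivWithinAt
      ring)
    ((intervalIntegrable_iff_integrableOn_Icc_of_le hT2).1 hφ3)
    (fun t ht => by
      have h1 := mul_le_mul_of_nonneg_left (key t ht)
        (mul_nonneg (zero_le_one.trans (hw1 t)) (hW0 t).le)
      refine le_trans (le_of_eq ?_) h1
      ring)
  rw [Ef_zero (hU.vanish hs (by simp)), Ef_zero (hU.vanish hs (by simp)),
    intervalIntegral.integral_sub hφ1 (hφ2.const_mul 5),
    intervalIntegral.integral_const_mul] at main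
  have s1 : ∫ t in (0:ℝ)..(T/2), W t * N t ≤ ∫ t in (0:ℝ)..(T/2), w t * W t * N t := by
    refine intervalIntegral.integral_mono_on hT2 ((hWc.mul hNc).intervalIntegrable _ _) hφ1
      fun t _ => ?_
    rw [mul_assoc]
    exact le_mul_of_one_le_left (mul_nonneg (hW0 t).le (hN0 t)) (hw1 t)
  have s2 : ∫ t in (0:ℝ)..(T/2), w t * W t * ff a U t
      ≤ ∫ t in (0:ℝ)..(T/2), Real.exp (κ / α) * (W t * ff a U t) := by
    refine intervalIntegral.integral_mono_on hT2 hφ2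
      ((ff_int h hC hU hWc _ _).const_mul _) fun t _ => ?_
    rw [mul_assoc]
    exact mul_le_mul_of_nonneg_right (hw2 t) (mul_nonneg (hW0 t).le (ff_nonneg t))
  rw [intervalIntegral.integral_const_mul] at s2
  linarith

end

end Carl

namespace Carl

section
variable {n : ℕ} {u : ℝ → (Fin n → ℝ) → ℂ}

lemma L_fd {E : Type*} [NormedAddCommGroup E] [NormedSpace ℝ E] (L : ℂ →L[ℝ] ℝ) {f : E → ℂ} {x : E}
    (hf : DifferentiableAt ℝ f x) (v : E) :
    L (fderiv ℝ f x v) = fderiv ℝ (fun y => L (f y)) x v := by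
  have h : HasFDerivAt (fun y => L (f y)) (L.comp (fderiv ℝ f x)) x :=
    L.hasFDerivAt.comp x hf.hasFDerivAt
  rw [h.fderiv]
  rfl

lemma L_SU (L : ℂ →L[ℝ] ℝ) (hu : ContDiff ℝ (⊤ : ℕ∞) (fun p : ℝ × (Fin n → ℝ) => u p.1 p.2))
    (hc : HasCompactSupport (fun p : ℝ × (Fin n → ℝ) => u p.1 p.2)) :
    SU (fun t x => L (u t x)) := by
  constructor
  · exact L.contDiff.comp hu
  · exact hc.comp_left (g := L) (map_zero L)

lemma L_ts (L : ℂ →L[ℝ] ℝ) {s : Set (ℝ × (Fin n → ℝ))}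
    (h : tsupport (fun p : ℝ × (Fin n → ℝ) => u p.1 p.2) ⊆ s) :
    tsupport (Function.uncurry fun t x => L (u t x)) ⊆ s := by
  refine subset_trans (closure_mono ?_) h
  exact Function.support_comp_subset (map_zero L) _

lemma u_sm (hu : ContDiff ℝ (⊤ : ℕ∞) (fun p : ℝ × (Fin n → ℝ) => u p.1 p.2)) (t : ℝ) :
    ContDiff ℝ (⊤ : ℕ∞) (u t) := hu.comp (contDiff_prodMk_right t)

lemma L_dx (L : ℂ →L[ℝ] ℝ) (hu : ContDiff ℝ (⊤ : ℕ∞) (fun p : ℝ × (Fin n → ℝ) => u p.1 p.2))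
    (hc : HasCompactSupport (fun p : ℝ × (Fin n → ℝ) => u p.1 p.2)) (t : ℝ) (x : Fin n → ℝ)
    (k : Fin n) : L (fderiv ℝ (u t) x (Pi.single k 1)) = pd k (fun x => L (u t x)) x :=
  L_fd L ((u_sm hu t).differentiable (by simp) x) _

lemma L_dt (L : ℂ →L[ℝ] ℝ) (hu : ContDiff ℝ (⊤ : ℕ∞) (fun p : ℝ × (Fin n → ℝ) => u p.1 p.2))
    (hc : HasCompactSupport (fun p : ℝ × (Fin n → ℝ) => u p.1 p.2)) (t : ℝ) (x : Fin n → ℝ) :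
    L (deriv (fun s => u s x) t) = dt (fun t x => L (u t x)) t x := by
  have h1 : ContDiff ℝ (⊤ : ℕ∞) (fun s => u s x) := hu.comp (contDiff_prodMk_left x)
  have h2 : DifferentiableAt ℝ (fun s => u s x) t := h1.differentiable (by simp) t
  have h3 : HasDerivAt (fun s => L (u s x)) (L (deriv (fun s => u s x) t)) t :=
    L.hasFDerivAt.comp_hasDerivAt t h2.hasDerivAt
  exact h3.unique ((L_SU L hu hc).hasDerivAt t x)

lemma L_div (L : ℂ →L[ℝ] ℝ) (hu : ContDiff ℝ (⊤ : ℕ∞) (fun p : ℝ × (Fin n → ℝ) => u p.1 p.2))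
    (hc : HasCompactSupport (fun p : ℝ × (Fin n → ℝ) => u p.1 p.2)) (t : ℝ) (x : Fin n → ℝ)
    (j k : Fin n) {b : (Fin n → ℝ) → ℝ} (hb : DifferentiableAt ℝ b x) :
    L (fderiv ℝ (fun y => (b y : ℂ) * fderiv ℝ (u t) y (Pi.single k 1)) x (Pi.single j 1))
      = pd j b x * pd k (fun x => L (u t x)) x + b x * pd j (pd k (fun x => L (u t x))) x := by
  have hd : ContDiff ℝ (⊤ : ℕ∞) fun y => fderiv ℝ (u t) y (Pi.single k 1) :=
    ((u_sm hu t).fderiv_right (m := (⊤ : ℕ∞)) (by simp)).clm_apply contDiff_const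
  have hb' : DifferentiableAt ℝ (fun y => (b y : ℂ)) x :=
    Complex.ofRealCLM.differentiableAt.comp x hb
  rw [L_fd L (hb'.fun_mul (hd.differentiable (by simp) x))]
  have e : (fun y => L ((b y : ℂ) * fderiv ℝ (u t) y (Pi.single k 1)))
      = fun y => b y * pd k (fun x => L (u t x)) y := by
    ext y
    rw [← L_dx L hu hc, ← Complex.real_smul, map_smul, smul_eq_mul]
  rw [e]
  exact pd_mul j x hb ((((L_SU L hu hc).sm t).pd k).diff x)

lemma L_res (L : ℂ →L[ℝ] ℝ) (hu : ContDiff ℝ (⊤ : ℕ∞) (fun p : ℝ × (Fin n → ℝ) => u p.1 p.2))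
    (hc : HasCompactSupport (fun p : ℝ × (Fin n → ℝ) => u p.1 p.2)) (t : ℝ) (x : Fin n → ℝ)
    {b : Fin n → Fin n → (Fin n → ℝ) → ℝ} (hb : ∀ j k, DifferentiableAt ℝ (b j k) x) :
    L (deriv (fun s => u s x) t + ∑ j, ∑ k, fderiv ℝ
        (fun y => (b j k y : ℂ) * fderiv ℝ (u t) y (Pi.single k 1)) x (Pi.single j 1))
      = dt (fun t x => L (u t x)) t x - Lop b (fun x => L (u t x)) x := by
  unfold Lop
  rw [sub_neg_eq_add, map_add, L_dt L hu hc, map_sum]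
  congr 1
  refine Finset.sum_congr rfl fun j _ => ?_
  rw [map_sum]
  exact Finset.sum_congr rfl fun k _ => L_div L hu hc t x j k (hb j k)

lemma nsq (z : ℂ) : ‖z‖ ^ 2 = (Complex.reCLM z) ^ 2 + (Complex.imCLM z) ^ 2 := by
  rw [Complex.sq_norm, Complex.normSq_apply]
  simp [sq]

variable {T lam C M α : ℝ} {μ : ℝ → ℝ} {a : Fin n → Fin n → ℝ → (Fin n → ℝ) → ℝ}

lemma int_res (h : TC n T lam C M α μ a) (hC : 0 ≤ C)
    (hu : ContDiff ℝ (⊤ : ℕ∞) (fun p : ℝ × (Fin n → ℝ) => u p.1 p.2))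
    (hc : HasCompactSupport (fun p : ℝ × (Fin n → ℝ) => u p.1 p.2)) (t : ℝ) :
    ∫ x : Fin n → ℝ, ‖deriv (fun s => u s x) t + ∑ j, ∑ k, fderiv ℝ
        (fun y => (a j k t y : ℂ) * fderiv ℝ (u t) y (Pi.single k 1)) x (Pi.single j 1)‖ ^ 2
      = ff a (fun t x => Complex.reCLM (u t x)) t + ff a (fun t x => Complex.imCLM (u t x)) t := by
  have hg : ∀ L : ℂ →L[ℝ] ℝ, Integrable fun x =>
      (dt (fun t x => L (u t x)) t x - Lop (fun j k => a j k t) (fun x => L (u t x)) x) ^ 2 := by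
    intro L
    have hS := L_SU L hu hc
    exact (((hS.dt.sm t).good).sub (Lop_good hC (h.coef t) (hS.sm t))).sq.integrable
  unfold ff
  rw [← integral_add (hg _) (hg _)]
  apply integral_congr_ae
  have hd : ∀ᵐ x, ∀ j k, DifferentiableAt ℝ (a j k t) x := by
    rw [ae_all_iff]; intro j
    rw [ae_all_iff]; intro k
    exact ((h.coef t).lip j k).ae_diff
  filter_upwards [hd] with x hx
  rw [nsq, L_res Complex.reCLM hu hc t x hx, L_res Complex.imCLM hu hc t x hx]

lemma int_grad (hu : ContDiff ℝ (⊤ : ℕ∞) (fun p : ℝ × (Fin n → ℝ) => u p.1 p.2))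
    (hc : HasCompactSupport (fun p : ℝ × (Fin n → ℝ) => u p.1 p.2)) (t : ℝ) :
    ∫ x : Fin n → ℝ, ∑ k, ‖fderiv ℝ (u t) x (Pi.single k 1)‖ ^ 2
      = (∫ x, S1 (fun x => Complex.reCLM (u t x)) x)
        + ∫ x, S1 (fun x => Complex.imCLM (u t x)) x := by
  have hg : ∀ L : ℂ →L[ℝ] ℝ, Integrable fun x => S1 (fun x => L (u t x)) x := by
    intro L
    have hS := L_SU L hu hc
    unfold S1
    exact (Good.sum _ fun k _ => ((hS.sm t).pd k).good.sq).integrable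
  rw [← integral_add (hg _) (hg _)]
  congr 1
  ext x
  unfold S1
  rw [← Finset.sum_add_distrib]
  refine Finset.sum_congr rfl fun k _ => ?_
  rw [nsq, L_dx Complex.reCLM hu hc, L_dx Complex.imCLM hu hc]

lemma int_u (hu : ContDiff ℝ (⊤ : ℕ∞) (fun p : ℝ × (Fin n → ℝ) => u p.1 p.2))
    (hc : HasCompactSupport (fun p : ℝ × (Fin n → ℝ) => u p.1 p.2)) (t : ℝ) :
    ∫ x : Fin n → ℝ, ‖u t x‖ ^ 2
      = (∫ x, (Complex.reCLM (u t x)) ^ 2) + ∫ x, (Complex.imCLM (u t x)) ^ 2 := by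
  have hg : ∀ L : ℂ →L[ℝ] ℝ, Integrable fun x => (L (u t x)) ^ 2 := by
    intro L
    have hS := L_SU L hu hc
    exact (hS.sm t).good.sq.integrable
  rw [← integral_add (hg _) (hg _)]
  congr 1
  ext x
  rw [nsq]

lemma cl_sub (T t s : ℝ) : |cl T t - cl T s| ≤ |t - s| := by
  unfold cl
  rw [max_comm 0, max_comm 0]
  refine (abs_max_sub_max_le_abs _ _ _).trans ((abs_min_sub_min_le_max t T s T).trans ?_)
  simp

lemma cl_TC (hT : 0 < T) (hα : 0 < α) (hC : 0 ≤ C)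
    (habdd : ∀ j k t x, |a j k t x| ≤ M)
    (hsymm : ∀ j k t x, a j k t x = a k j t x)
    (hell : ∀ t ∈ Icc 0 T, ∀ x : Fin n → ℝ, ∀ ξ : Fin n → ℝ,
      lam * ∑ j, ξ j ^ 2 ≤ ∑ j, ∑ k, a j k t x * ξ j * ξ k)
    (hHoldt : ∀ j k, ∀ t ∈ Icc 0 T, ∀ s ∈ Icc 0 T, ∀ x,
      |a j k t x - a j k s x| ≤ C * |t - s| ^ α)
    (hLipx : ∀ j k, ∀ t ∈ Icc 0 T, ∀ x y : Fin n → ℝ,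
      |a j k t x - a j k t y| ≤ C * dist x y)
    (hOsgt : ∀ j k, ∀ t ∈ Ioc 0 T, ∀ s₁ ∈ Icc t T, ∀ s₂ ∈ Icc t T, ∀ x,
      |a j k s₁ x - a j k s₂ x| ≤ C * t ^ (α - 1) * μ |s₁ - s₂|) :
    TC n T lam C M α μ (fun j k t x => a j k (cl T t) x) := by
  have hold : ∀ j k t s x, |a j k (cl T t) x - a j k (cl T s) x| ≤ C * |t - s| ^ α := by
    intro j k t s x
    refine (hHoldt j k _ (cl_mem hT t) _ (cl_mem hT s) x).trans ?_
    exact mul_le_mul_of_nonneg_left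
      (Real.rpow_le_rpow (abs_nonneg _) (cl_sub T t s) hα.le) hC
  refine ⟨?_, ?_, hold, ?_⟩
  · intro j k
    rw [continuous_iff_continuousAt]
    rintro ⟨t, x⟩
    have hb : Continuous fun z : ℝ × (Fin n → ℝ) => C * |z.1 - t| ^ α + C * dist z.2 x := by
      have : Continuous fun z : ℝ × (Fin n → ℝ) => |z.1 - t| ^ α :=
        Continuous.rpow_const (by fun_prop) fun _ => Or.inr hα.le
      fun_prop
    have hb0 := hb.tendsto (t, x)
    simp only [sub_self, abs_zero, Real.zero_rpow hα.ne', mul_zero, dist_self, add_zero] at hb0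
    refine tendsto_iff_dist_tendsto_zero.2 (squeeze_zero (fun _ => dist_nonneg) ?_ hb0)
    rintro ⟨s, y⟩
    simp only [Function.uncurry, Real.dist_eq]
    calc |a j k (cl T s) y - a j k (cl T t) x|
        = |(a j k (cl T s) y - a j k (cl T t) y) + (a j k (cl T t) y - a j k (cl T t) x)| := by
          congr 1; ring
      _ ≤ _ := (abs_add_le _ _).trans
          (add_le_add (hold j k s t y) (hLipx j k _ (cl_mem hT t) y x))
  · intro t
    exact ⟨fun j k => hLipx j k _ (cl_mem hT t), fun j k => habdd j k _,
      fun j k => hsymm j k _, hell _ (cl_mem hT t)⟩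
  · intro j k t ht s₁ h1 s₂ h2 x
    rw [cl_eq ⟨ht.1.le.trans h1.1, h1.2⟩, cl_eq ⟨ht.1.le.trans h2.1, h2.2⟩]
    exact hOsgt j k t ht s₁ h1 s₂ h2 x

lemma exp_neg_le {x : ℝ} (hx : 0 < x) : Real.exp (-x) ≤ 1 / x := by
  rw [Real.exp_neg, ← one_div]
  exact one_div_le_one_div_of_le hx (by linarith [Real.add_one_le_exp x])

lemma exp_neg_sqrt {c γ : ℝ} (hc : 0 < c) (hγ : 0 < γ) (h : (1 / c) ^ 2 ≤ γ) :
    Real.exp (-(γ * c)) ≤ 1 / √γ := by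
  refine (exp_neg_le (mul_pos hγ hc)).trans (one_div_le_one_div_of_le (Real.sqrt_pos.2 hγ) ?_)
  have h1 : 1 / c ≤ √γ := Real.le_sqrt_of_sq_le h
  have h2 : 1 ≤ √γ * c := by rwa [div_le_iff₀ hc] at h1
  have h3 : √γ * √γ = γ := Real.mul_self_sqrt hγ.le
  calc √γ = √γ * 1 := by ring
    _ ≤ √γ * (√γ * c) := mul_le_mul_of_nonneg_left h2 (Real.sqrt_nonneg _)
    _ = γ * c := by rw [← mul_assoc, h3]

end

theorem final
    (n : ℕ) (T : ℝ) (hT : 0 < T)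
    (μ : ℝ → ℝ) (hμ : Mod μ)
    (a : Fin n → Fin n → ℝ → (Fin n → ℝ) → ℝ)
    (habdd : ∃ M, ∀ j k t x, |a j k t x| ≤ M)
    (hsymm : ∀ j k t x, a j k t x = a k j t x)
    (lam0 : ℝ) (hlam0 : lam0 ∈ Ioo (0:ℝ) 1)
    (hell : ∀ t ∈ Icc 0 T, ∀ x : Fin n → ℝ, ∀ ξ : Fin n → ℝ,
      lam0 * ∑ j, ξ j ^ 2 ≤ ∑ j, ∑ k, a j k t x * ξ j * ξ k)
    (α C : ℝ) (hα : α ∈ Ioo (0:ℝ) 1) (hC : 0 < C)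
    (hHoldt : ∀ j k, ∀ t ∈ Icc 0 T, ∀ s ∈ Icc 0 T, ∀ x,
      |a j k t x - a j k s x| ≤ C * |t - s| ^ α)
    (hLipx : ∀ j k, ∀ t ∈ Icc 0 T, ∀ x y : Fin n → ℝ,
      |a j k t x - a j k t y| ≤ C * dist x y)
    (hOsgt : ∀ j k, ∀ t ∈ Ioc 0 T, ∀ s₁ ∈ Icc t T, ∀ s₂ ∈ Icc t T, ∀ x,
      |a j k s₁ x - a j k s₂ x| ≤ C * t ^ (α - 1) * μ |s₁ - s₂|) :
    ∃ γ₀ > (0:ℝ), ∃ C' > (0:ℝ), ∀ γ : ℝ, γ₀ < γ →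
      ∀ u : ℝ → (Fin n → ℝ) → ℂ,
        ContDiff ℝ (⊤ : ℕ∞) (fun p : ℝ × (Fin n → ℝ) => u p.1 p.2) →
        HasCompactSupport (fun p : ℝ × (Fin n → ℝ) => u p.1 p.2) →
        tsupport (fun p : ℝ × (Fin n → ℝ) => u p.1 p.2) ⊆
          Icc 0 (T/2) ×ˢ (univ : Set (Fin n → ℝ)) →
        C' * γ ^ ((1:ℝ)/2) *
          ∫ t in (0:ℝ)..(T/2), Real.exp ((2/γ) * PhiF μ T α γ (γ * (T - t))) *
            ((∫ x : Fin n → ℝ, ∑ k, ‖fderiv ℝ (u t) x (Pi.single k 1)‖ ^ 2) +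
              γ ^ ((1:ℝ)/2) * ∫ x : Fin n → ℝ, ‖u t x‖ ^ 2) ≤
        ∫ t in (0:ℝ)..(T/2), Real.exp ((2/γ) * PhiF μ T α γ (γ * (T - t))) *
          ∫ x : Fin n → ℝ,
            ‖deriv (fun s => u s x) t
              + ∑ j, ∑ k, fderiv ℝ
                  (fun y => (a j k t y : ℂ) * fderiv ℝ (u t) y (Pi.single k 1)) x
                  (Pi.single j 1)‖ ^ 2 := by
  obtain ⟨M, hM⟩ := habdd
  have hα0 : 0 < α := hα.1
  have h := cl_TC (μ := μ) hT hα0 hC.le hM hsymm hell hHoldt hLipx hOsgt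
  set c0 := (T ^ α - (T / 2) ^ α) / α with hc0
  have hc0p : 0 < c0 := by
    refine div_pos (sub_pos.2 ?_) hα0
    exact Real.rpow_lt_rpow (by positivity) (by linarith) hα0
  set D := Dk n lam0 C (T ^ (α - 1)) with hD
  set K := 5 * Real.exp (n * C / lam0 / α) with hK
  have hKp : 0 < K := by positivity
  have q1 : 0 ≤ D ^ 2 := by positivity
  have q2 : 0 ≤ (1 / (c0 * α)) ^ 2 := by positivity
  have q3 : 0 ≤ (1 / c0) ^ 2 := by positivity
  have q4 : 0 ≤ 2 / (c0 * T) := by positivity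
  refine ⟨1 + D ^ 2 + (1 / (c0 * α)) ^ 2 + (1 / c0) ^ 2 + 2 / (c0 * T), by positivity,
    1 / K, by positivity, ?_⟩
  intro γ hγ u hu hc hs
  have hγ1 : 1 ≤ γ := by linarith
  have hγ0 : 0 < γ := by linarith
  have hsq : 0 < √γ := Real.sqrt_pos.2 hγ0
  have hDD : D * (1 / √γ) ≤ 1 := by
    rw [mul_one_div, div_le_one hsq]
    exact Real.le_sqrt_of_sq_le (by linarith)
  have hpe : ∀ t ∈ Icc 0 (T/2), pf μ T α γ t ≤ Real.exp (-(γ * c0)) := fun t ht =>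
    hμ.pf_exp hT hα0 hγ0 ht
  have hp1 : ∀ t ∈ Icc 0 (T/2), pf μ T α γ t ≤ 1 / √γ := fun t ht =>
    (hpe t ht).trans (exp_neg_sqrt hc0p hγ0 (by linarith))
  have hp2 : ∀ t ∈ Icc 0 (T/2), pf μ T α γ t ^ α ≤ 1 / √γ := by
    intro t ht
    refine (Real.rpow_le_rpow (hμ.pf_mem hT hα0 hγ0 t).1.le (hpe t ht) hα0.le).trans ?_
    rw [← Real.exp_mul]
    have e : -(γ * c0) * α = -(γ * (c0 * α)) := by ring
    rw [e]
    exact exp_neg_sqrt (by positivity) hγ0 (by linarith)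
  have hp3 : ∀ t ∈ Icc 0 (T/2), pf μ T α γ t ≤ T / 2 := by
    intro t ht
    refine (hpe t ht).trans ((exp_neg_le (by positivity)).trans ?_)
    have h1 : 2 / (c0 * T) ≤ γ := by linarith
    rw [div_le_iff₀ (by positivity)] at h1 ⊢
    linarith
  set U1 : ℝ → (Fin n → ℝ) → ℝ := fun t x => Complex.reCLM (u t x) with hU1
  set U2 : ℝ → (Fin n → ℝ) → ℝ := fun t x => Complex.imCLM (u t x) with hU2
  have S1' : SU U1 := L_SU _ hu hc
  have S2' : SU U2 := L_SU _ hu hc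
  have m1 := real_main h hμ hT hlam0.1 hC.le hα0 hα.2 hγ1 hDD hp1 hp2 hp3 S1' (L_ts _ hs)
  have m2 := real_main h hμ hT hlam0.1 hC.le hα0 hα.2 hγ1 hDD hp1 hp2 hp3 S2' (L_ts _ hs)
  have hWc : Continuous (Wf μ T α γ) :=
    continuous_iff_continuousAt.2 fun t => (hμ.Wf_deriv hT hα0 hγ0 t).continuousAt
  have hmem : ∀ t ∈ uIcc (0:ℝ) (T/2), t ∈ Icc 0 T := by
    intro t ht
    rw [uIcc_of_le (by positivity)] at ht
    exact ⟨ht.1, ht.2.trans (by linarith)⟩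
  have hr : γ ^ ((1:ℝ)/2) = √γ := (Real.sqrt_eq_rpow γ).symm
  have hss : √γ * √γ = γ := Real.mul_self_sqrt hγ0.le
  have eR : (∫ t in (0:ℝ)..(T/2), Real.exp ((2/γ) * PhiF μ T α γ (γ * (T - t))) *
          ∫ x : Fin n → ℝ,
            ‖deriv (fun s => u s x) t
              + ∑ j, ∑ k, fderiv ℝ
                  (fun y => (a j k t y : ℂ) * fderiv ℝ (u t) y (Pi.single k 1)) x
                  (Pi.single j 1)‖ ^ 2)
      = (∫ t in (0:ℝ)..(T/2), Wf μ T α γ t * ff (fun j k t x => a j k (cl T t) x) U1 t)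
       + ∫ t in (0:ℝ)..(T/2), Wf μ T α γ t * ff (fun j k t x => a j k (cl T t) x) U2 t := by
    rw [← intervalIntegral.integral_add (ff_int h hC.le S1' hWc _ _) (ff_int h hC.le S2' hWc _ _)]
    refine intervalIntegral.integral_congr fun t ht => ?_
    have e := int_res h hC.le hu hc t
    simp only [cl_eq (hmem t ht)] at e
    rw [Wf_eq hα0 hγ0 (hmem t ht), e, mul_add]
  have eL : √γ * (∫ t in (0:ℝ)..(T/2), Real.exp ((2/γ) * PhiF μ T α γ (γ * (T - t))) *
            ((∫ x : Fin n → ℝ, ∑ k, ‖fderiv ℝ (u t) x (Pi.single k 1)‖ ^ 2) +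
              √γ * ∫ x : Fin n → ℝ, ‖u t x‖ ^ 2))
      = (∫ t in (0:ℝ)..(T/2), Wf μ T α γ t *
          (√γ * (∫ x, S1 (U1 t) x) + γ * ∫ x, U1 t x ^ 2))
       + ∫ t in (0:ℝ)..(T/2), Wf μ T α γ t *
          (√γ * (∫ x, S1 (U2 t) x) + γ * ∫ x, U2 t x ^ 2) := by
    have hi : ∀ {U : ℝ → (Fin n → ℝ) → ℝ}, SU U → IntervalIntegrable (fun t => Wf μ T α γ t *
          (√γ * (∫ x, S1 (U t) x) + γ * ∫ x, U t x ^ 2)) volume 0 (T/2) := by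
      intro U hU
      exact (hWc.mul ((continuous_const.mul (N1_cont hU)).add
        (continuous_const.mul (N0_cont hU)))).intervalIntegrable _ _
    rw [← intervalIntegral.integral_add (hi S1') (hi S2'), ← intervalIntegral.integral_const_mul]
    refine intervalIntegral.integral_congr fun t ht => ?_
    rw [Wf_eq hα0 hγ0 (hmem t ht), int_grad hu hc t, int_u hu hc t]
    generalize (∫ x, S1 (fun x => Complex.reCLM (u t x)) x) = A1
    generalize (∫ x, S1 (fun x => Complex.imCLM (u t x)) x) = A2
    change √γ * (Wf μ T α γ t * (A1 + A2 + √γ * ((∫ x, U1 t x ^ 2) + ∫ x, U2 t x ^ 2)))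
      = Wf μ T α γ t * (√γ * A1 + γ * ∫ x, U1 t x ^ 2)
        + Wf μ T α γ t * (√γ * A2 + γ * ∫ x, U2 t x ^ 2)
    linear_combination (Wf μ T α γ t * ((∫ x, U1 t x ^ 2) + ∫ x, U2 t x ^ 2)) * hss
  rw [hr, mul_assoc, eL, eR, one_div, inv_mul_le_iff₀ hKp]
  linarith
end Carl

/-- the Carleman estimate. Under the hypotheses of the main theorem on
the coefficients `a_{jk}` (symmetric, elliptic, bounded measurable, `α`-Hölder in
time, Lipschitz in space, Osgood-continuous in time on `[t,T]` with constant
`C t^{α−1}`), there exist `γ₀ > 0` and `C' > 0` such that for all `γ > γ₀` and all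
smooth compactly supported `u` with support in `[0,T/2] × ℝⁿ`:
`∫₀^{T/2} e^{(2/γ)Φ_γ(γ(T−t))} ‖∂_t u + Σ ∂_{x_j}(a_{jk} ∂_{x_k} u)‖²_{L²} dt
 ≥ C' γ^{1/2} ∫₀^{T/2} e^{(2/γ)Φ_γ(γ(T−t))} (‖∇_x u‖²_{L²} + γ^{1/2} ‖u‖²_{L²}) dt`. -/
theorem stmt_1
    (n : ℕ) (T : ℝ) (hT : 0 < T)
    (μ : ℝ → ℝ)
    (hμcont : ContinuousOn μ (Icc 0 1))
    (hμconc : ConcaveOn ℝ (Icc 0 1) μ)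
    (hμmono : StrictMonoOn μ (Icc 0 1))
    (hμmaps : MapsTo μ (Icc 0 1) (Icc 0 1))
    (hμ0 : μ 0 = 0) (hμ1 : μ 1 = 1)
    (hOsgood : (∫⁻ s in Ioc (0:ℝ) 1, ENNReal.ofReal (1 / μ s)) = ⊤)
    (a : Fin n → Fin n → ℝ → (Fin n → ℝ) → ℝ)
    (hameas : ∀ j k, Measurable (Function.uncurry (a j k)))
    (habdd : ∃ M, ∀ j k t x, |a j k t x| ≤ M)
    (hsymm : ∀ j k t x, a j k t x = a k j t x)
    (lam0 : ℝ) (hlam0 : lam0 ∈ Ioo (0:ℝ) 1)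
    (hell : ∀ t ∈ Icc 0 T, ∀ x : Fin n → ℝ, ∀ ξ : Fin n → ℝ,
      lam0 * ∑ j, ξ j ^ 2 ≤ ∑ j, ∑ k, a j k t x * ξ j * ξ k)
    (α C : ℝ) (hα : α ∈ Ioo (0:ℝ) 1) (hC : 0 < C)
    (hHoldt : ∀ j k, ∀ t ∈ Icc 0 T, ∀ s ∈ Icc 0 T, ∀ x,
      |a j k t x - a j k s x| ≤ C * |t - s| ^ α)
    (hLipx : ∀ j k, ∀ t ∈ Icc 0 T, ∀ x y : Fin n → ℝ,
      |a j k t x - a j k t y| ≤ C * dist x y)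
    (hOsgt : ∀ j k, ∀ t ∈ Ioc 0 T, ∀ s₁ ∈ Icc t T, ∀ s₂ ∈ Icc t T, ∀ x,
      |a j k s₁ x - a j k s₂ x| ≤ C * t ^ (α - 1) * μ |s₁ - s₂|) :
    ∃ γ₀ > (0:ℝ), ∃ C' > (0:ℝ), ∀ γ : ℝ, γ₀ < γ →
      ∀ u : ℝ → (Fin n → ℝ) → ℂ,
        ContDiff ℝ (⊤ : ℕ∞) (fun p : ℝ × (Fin n → ℝ) => u p.1 p.2) →
        HasCompactSupport (fun p : ℝ × (Fin n → ℝ) => u p.1 p.2) →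
        tsupport (fun p : ℝ × (Fin n → ℝ) => u p.1 p.2) ⊆
          Icc 0 (T/2) ×ˢ (univ : Set (Fin n → ℝ)) →
        C' * γ ^ ((1:ℝ)/2) *
          ∫ t in (0:ℝ)..(T/2), Real.exp ((2/γ) * PhiF μ T α γ (γ * (T - t))) *
            ((∫ x : Fin n → ℝ, ∑ k, ‖fderiv ℝ (u t) x (Pi.single k 1)‖ ^ 2) +
              γ ^ ((1:ℝ)/2) * ∫ x : Fin n → ℝ, ‖u t x‖ ^ 2) ≤
        ∫ t in (0:ℝ)..(T/2), Real.exp ((2/γ) * PhiF μ T α γ (γ * (T - t))) *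
          ∫ x : Fin n → ℝ,
            ‖deriv (fun s => u s x) t
              + ∑ j, ∑ k, fderiv ℝ
                  (fun y => (a j k t y : ℂ) * fderiv ℝ (u t) y (Pi.single k 1)) x
                  (Pi.single j 1)‖ ^ 2 := by
  exact Carl.final n T hT μ ⟨hμcont, hμconc, hμmono, hμmaps, hμ0, hμ1, hOsgood⟩ a habdd hsymm lam0
    hlam0 hell α C hα hC hHoldt hLipx hOsgt
end

section
/- Let μ be a modulus of continuity satisfying the Osgood condition, T > 0, α ∈ (0,1), γ > 0, and define ψ_γ(τ) = φ⁻¹(γ ∫₀^{τ/γ} (T−s)^{α−1} ds) for τ ∈ [0, γT) and Φ_γ(τ) = ∫₀^τ ψ_γ(σ) dσ. Then ψ_γ is differentiable on (0, γT) and satisfies the differential equation ψ_γ'(τ) = (T − τ/γ)^{α−1} · ψ_γ(τ)² · μ(1/ψ_γ(τ)); consequently Φ_γ is twice differentiable with Φ_γ'(τ) = ψ_γ(τ) and Φ_γ''(τ) = (T − τ/γ)^{α−1} · (Φ_γ'(τ))² · μ(1/Φ_γ'(τ)). -/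
open Set

lemma aux_main (μ : ℝ → ℝ)
    (hcont : ContinuousOn μ (Icc 0 1))
    (hmono : StrictMonoOn μ (Icc 0 1))
    (h0 : μ 0 = 0)
    (hOsgood : (∫⁻ s in Ioc (0:ℝ) 1, ENNReal.ofReal (1 / μ s)) = ⊤) :
    StrictMonoOn (phiF μ) (Ici 1) ∧ SurjOn (phiF μ) (Ici 1) (Ici 0) ∧ phiF μ 1 = 0 ∧
    ∀ t, 1 < t → HasDerivAt (phiF μ) (1 / (t ^ 2 * μ (1 / t))) t := by
  have hpos : ∀ x ∈ Ioc (0:ℝ) 1, 0 < μ x := by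
    intro x hx
    have := hmono (left_mem_Icc.2 zero_le_one) ⟨hx.1.le, hx.2⟩ hx.1
    rwa [h0] at this
  have hc : ContinuousOn (fun s => 1 / μ s) (Ioc 0 1) := by
    apply ContinuousOn.div continuousOn_const (hcont.mono Ioc_subset_Icc_self)
    intro x hx
    exact (hpos x hx).ne'
  have hint : ∀ a b : ℝ, 0 < a → a ≤ 1 → 0 < b → b ≤ 1 →
      IntervalIntegrable (fun s => 1 / μ s) MeasureTheory.volume a b := by
    intro a b ha ha1 hb hb1
    apply ContinuousOn.intervalIntegrable
    apply hc.mono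
    intro x hx
    rw [mem_uIcc] at hx
    constructor <;> rcases hx with hx | hx <;> linarith [hx.1, hx.2]
  have hinv : ∀ t : ℝ, 1 ≤ t → 0 < 1 / t ∧ 1 / t ≤ 1 := by
    intro t ht
    have : 0 < t := by linarith
    exact ⟨by positivity, by rw [div_le_one this]; exact ht⟩
  have hphi1 : phiF μ 1 = 0 := by simp [phiF]
  have hder : ∀ t, 1 < t → HasDerivAt (phiF μ) (1 / (t ^ 2 * μ (1 / t))) t := by
    intro t ht
    have ht0 : 0 < t := by linarith
    have h1t : 1 / t < 1 := by rw [div_lt_one ht0]; exact ht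
    have hp := (hinv t ht.le).1
    have hco : ContinuousOn (fun s => 1 / μ s) (Ioo 0 1) := hc.mono Ioo_subset_Ioc_self
    have hF : HasDerivAt (fun x => ∫ s in x..1, 1 / μ s) (-(1 / μ (1/t))) (1/t) :=
      intervalIntegral.integral_hasDerivAt_left (hint _ _ hp h1t.le one_pos le_rfl)
        (hco.stronglyMeasurableAtFilter isOpen_Ioo _ ⟨hp, h1t⟩)
        (hco.continuousAt (Ioo_mem_nhds hp h1t))
    have hi : HasDerivAt (fun t : ℝ => 1 / t) (-(t^2)⁻¹) t := by
      simpa using hasDerivAt_inv ht0.ne'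
    have := hF.comp t hi
    refine this.congr_deriv ?_
    have := (hpos _ ⟨hp, h1t.le⟩).ne'
    field_simp
  have hcontphi : ContinuousOn (phiF μ) (Ici 1) := by
    intro t ht
    rcases eq_or_lt_of_le (show (1:ℝ) ≤ t from ht) with h | h
    · subst h
      have h2 : ContinuousOn (fun x => ∫ s in x..1, 1 / μ s) (uIcc (1/2:ℝ) 1) :=
        intervalIntegral.continuousOn_primitive_interval_left
          (((intervalIntegrable_iff' (by simp)).1 (hint (1/2) 1 (by norm_num) (by norm_num) one_pos le_rfl)))
      rw [uIcc_of_le (by norm_num)] at h2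
      have h3 : ContinuousOn (phiF μ) (Icc 1 2) := by
        refine h2.comp (f := fun t : ℝ => 1 / t) ?_ ?_
        · exact continuousOn_const.div continuousOn_id (fun x hx => by
            have := hx.1
            linarith)
        · intro x hx
          have hx0 : 0 < x := by linarith [hx.1]
          exact ⟨one_div_le_one_div_of_le hx0 hx.2, (hinv x hx.1).2⟩
      have h4 := h3 1 ⟨le_rfl, by norm_num⟩
      refine h4.mono_of_mem_nhdsWithin ?_
      exact Icc_mem_nhdsGE (by norm_num)
    · exact (hder t h).continuousAt.continuousWithinAt
  have hsm : StrictMonoOn (phiF μ) (Ici 1) := by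
    apply strictMonoOn_of_deriv_pos (convex_Ici 1) hcontphi
    intro t ht
    rw [interior_Ici] at ht
    have ht : 1 < t := ht
    rw [(hder t ht).deriv]
    have := hpos _ (hinv t ht.le)
    have : 0 < t := by linarith
    positivity
  refine ⟨hsm, ?_, hphi1, hder⟩
  intro y hy
  obtain ⟨t, ht, hty⟩ : ∃ t, 1 ≤ t ∧ y ≤ phiF μ t := by
    by_contra hcon
    push Not at hcon
    have hI : MeasureTheory.IntegrableOn (fun s => 1 / μ s) (Ioc 0 1) := by
      refine MeasureTheory.integrableOn_Ioc_of_intervalIntegral_norm_bounded_left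
        (l := Filter.atTop) (a := fun n : ℕ => 1 / ((n:ℝ) + 1)) (I := y) ?_ ?_ ?_
      · intro n
        have := hinv ((n:ℝ)+1) (by linarith [n.cast_nonneg (α := ℝ)])
        exact (hint _ _ this.1 this.2 one_pos le_rfl).1
      · exact tendsto_one_div_add_atTop_nhds_zero_nat
      · refine Filter.Eventually.of_forall fun n => ?_
        have hn : (1:ℝ) ≤ (n:ℝ)+1 := by linarith [n.cast_nonneg (α := ℝ)]
        have h := hinv ((n:ℝ)+1) hn
        refine le_trans (le_of_eq ?_) (hcon _ hn).le
        rw [phiF, intervalIntegral.integral_of_le h.2]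
        refine MeasureTheory.setIntegral_congr_fun measurableSet_Ioc ?_
        intro x hx
        have := hpos x ⟨h.1.trans hx.1, hx.2⟩
        simp only [Real.norm_eq_abs]
        exact abs_of_pos (by positivity)
    have := hI.lintegral_lt_top
    rw [hOsgood] at this
    exact lt_irrefl _ this
  have hy' : y ∈ Icc (phiF μ 1) (phiF μ t) := ⟨by rw [hphi1]; exact hy, hty⟩
  obtain ⟨x, hx, hxy⟩ := intermediate_value_Icc ht (hcontphi.mono Icc_subset_Ici_self) hy'
  exact ⟨x, hx.1, hxy⟩

/-- the argument of `φ⁻¹`. -/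
noncomputable def gF (T α γ τ : ℝ) : ℝ := γ * ∫ s in (0:ℝ)..(τ/γ), (T - s) ^ (α - 1)

lemma aux_g (T α γ : ℝ) (hT : 0 < T) (hγ : 0 < γ) :
    (∀ τ ∈ Ioo (-(γ * T)) (γ * T), HasDerivAt (gF T α γ) ((T - τ/γ) ^ (α - 1)) τ) ∧
    StrictMonoOn (gF T α γ) (Ico 0 (γ * T)) ∧ gF T α γ 0 = 0 := by
  have hco : ContinuousOn (fun s : ℝ => (T - s) ^ (α - 1)) (Iio T) := by
    apply ContinuousOn.rpow_const (by fun_prop)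
    intro x hx
    left
    have : x < T := hx
    linarith
  have hder : ∀ τ ∈ Ioo (-(γ * T)) (γ * T),
      HasDerivAt (gF T α γ) ((T - τ/γ) ^ (α - 1)) τ := by
    intro τ hτ
    have hlt : τ / γ < T := by rw [div_lt_iff₀ hγ]; linarith [hτ.2]
    have hF : HasDerivAt (fun x => ∫ s in (0:ℝ)..x, (T - s) ^ (α - 1))
        ((T - τ/γ) ^ (α - 1)) (τ / γ) := by
      refine intervalIntegral.integral_hasDerivAt_right ?_
        (hco.stronglyMeasurableAtFilter isOpen_Iio _ hlt)
        (hco.continuousAt (Iio_mem_nhds hlt))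
      apply ContinuousOn.intervalIntegrable
      apply hco.mono
      intro x hx
      rw [mem_uIcc] at hx
      show x < T
      rcases hx with hx | hx <;> linarith [hx.1, hx.2]
    have hi : HasDerivAt (fun t : ℝ => t / γ) (1 / γ) τ := (hasDerivAt_id τ).div_const γ
    refine ((hF.comp τ hi).const_mul γ).congr_deriv ?_
    field_simp
  refine ⟨hder, ?_, by simp [gF]⟩
  have hsub : Ico 0 (γ * T) ⊆ Ioo (-(γ * T)) (γ * T) := by
    intro x hx
    have : 0 < γ * T := by positivity
    exact ⟨by linarith [hx.1], hx.2⟩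
  apply strictMonoOn_of_deriv_pos (convex_Ico _ _)
  · intro x hx
    exact (hder x (hsub hx)).continuousAt.continuousWithinAt
  · intro x hx
    have hx := hsub (interior_subset hx)
    rw [(hder x hx).deriv]
    apply Real.rpow_pos_of_pos
    have hlt : x / γ < T := by rw [div_lt_iff₀ hγ]; linarith [hx.2]
    linarith

/-- Let `μ` be a modulus of continuity satisfying the Osgood condition,
`T > 0`, `α ∈ (0,1)`, `γ > 0`. Then `ψ_γ` is differentiable on `(0, γT)` with
`ψ_γ'(τ) = (T − τ/γ)^{α−1} ψ_γ(τ)² μ(1/ψ_γ(τ))`; consequently `Φ_γ` is twice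
differentiable with `Φ_γ'(τ) = ψ_γ(τ)` and
`Φ_γ''(τ) = (T − τ/γ)^{α−1} (Φ_γ'(τ))² μ(1/Φ_γ'(τ))`. -/
theorem stmt_6 (μ : ℝ → ℝ)
    (hcont : ContinuousOn μ (Icc 0 1))
    (hconc : ConcaveOn ℝ (Icc 0 1) μ)
    (hmono : StrictMonoOn μ (Icc 0 1))
    (hmaps : MapsTo μ (Icc 0 1) (Icc 0 1))
    (h0 : μ 0 = 0) (h1 : μ 1 = 1)
    (hOsgood : (∫⁻ s in Ioc (0:ℝ) 1, ENNReal.ofReal (1 / μ s)) = ⊤)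
    (T α γ : ℝ) (hT : 0 < T) (hα : α ∈ Ioo (0:ℝ) 1) (hγ : 0 < γ) :
    ∀ τ ∈ Ioo 0 (γ * T),
      HasDerivAt (psiF μ T α γ)
        ((T - τ/γ) ^ (α - 1) * (psiF μ T α γ τ) ^ 2 * μ (1 / psiF μ T α γ τ)) τ ∧
      HasDerivAt (PhiF μ T α γ) (psiF μ T α γ τ) τ ∧
      HasDerivAt (deriv (PhiF μ T α γ))
        ((T - τ/γ) ^ (α - 1) * (deriv (PhiF μ T α γ) τ) ^ 2 *
          μ (1 / deriv (PhiF μ T α γ) τ)) τ := by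
  obtain ⟨hsm, hsurj, hphi1, hder⟩ := aux_main μ hcont hmono h0 hOsgood
  obtain ⟨hg, hgm, hg0⟩ := aux_g T α γ hT hγ
  set J := Function.invFunOn (phiF μ) (Ici 1) with hJ
  have hJmem : ∀ y, 0 ≤ y → 1 ≤ J y := fun y hy => Function.invFunOn_mem (hsurj hy)
  have hJeq : ∀ y, 0 ≤ y → phiF μ (J y) = y := fun y hy => Function.invFunOn_eq (hsurj hy)
  have hJsm : StrictMonoOn J (Ici 0) := by
    intro a ha b hb hab
    rw [← hsm.lt_iff_lt (hJmem a ha) (hJmem b hb), hJeq a ha, hJeq b hb]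
    exact hab
  have hJphi : ∀ x, 1 ≤ x → 0 ≤ phiF μ x ∧ J (phiF μ x) = x := by
    intro x hx
    have h : 0 ≤ phiF μ x := by
      rw [← hphi1]; exact hsm.monotoneOn (mem_Ici.2 le_rfl) hx hx
    exact ⟨h, hsm.injOn (hJmem _ h) hx (hJeq _ h)⟩
  have hJgt : ∀ y, 0 < y → 1 < J y := by
    intro y hy
    rw [← hsm.lt_iff_lt (mem_Ici.2 le_rfl) (hJmem y hy.le), hJeq y hy.le, hphi1]
    exact hy
  have hJder : ∀ y, 0 < y → HasDerivAt J ((J y) ^ 2 * μ (1 / J y)) y := by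
    intro y hy
    have h1J := hJgt y hy
    have hJc : ContinuousAt J y := by
      apply hJsm.continuousAt_of_image_mem_nhds (Ici_mem_nhds hy)
      refine Filter.mem_of_superset (Ici_mem_nhds h1J) ?_
      intro x hx
      exact ⟨phiF μ x, (hJphi x hx).1, (hJphi x hx).2⟩
    have hpos : 0 < μ (1 / J y) := by
      have hp : 0 < 1 / J y := by positivity
      have hl : 1 / J y ≤ 1 := by rw [div_le_one (by linarith)]; exact h1J.le
      have := hmono (left_mem_Icc.2 zero_le_one) ⟨hp.le, hl⟩ hp
      rwa [h0] at this
    have hne : (1 / ((J y) ^ 2 * μ (1 / J y))) ≠ 0 := by positivity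
    have := HasDerivAt.of_local_left_inverse hJc (hder _ h1J) hne
      (by filter_upwards [Ioi_mem_nhds hy] with z hz using hJeq z (le_of_lt hz))
    refine this.congr_deriv ?_
    simp
  have hpsi : psiF μ T α γ = fun τ => J (gF T α γ τ) := rfl
  have hTγ : 0 < γ * T := by positivity
  have hgpos : ∀ τ ∈ Ioo 0 (γ * T), 0 < gF T α γ τ := by
    intro τ hτ
    rw [← hg0]
    exact hgm ⟨le_rfl, hTγ⟩ ⟨hτ.1.le, hτ.2⟩ hτ.1
  have hA : ∀ τ ∈ Ioo 0 (γ * T), HasDerivAt (psiF μ T α γ)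
        ((T - τ/γ) ^ (α - 1) * (psiF μ T α γ τ) ^ 2 * μ (1 / psiF μ T α γ τ)) τ := by
    intro τ hτ
    have := (hJder _ (hgpos τ hτ)).comp τ (hg τ ⟨by linarith [hτ.1], hτ.2⟩)
    refine this.congr_deriv ?_
    simp only [hpsi]
    ring
  have hpsico : ContinuousOn (psiF μ T α γ) (Ioo 0 (γ * T)) :=
    fun τ hτ => (hA τ hτ).continuousAt.continuousWithinAt
  have hpsim : MonotoneOn (psiF μ T α γ) (Ico 0 (γ * T)) := by
    intro a ha b hb hab
    have hz : (0:ℝ) ∈ Ico 0 (γ * T) := ⟨le_rfl, hTγ⟩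
    refine hJsm.monotoneOn ?_ ?_ (hgm.monotoneOn ha hb hab)
    · exact hg0.symm.le.trans (hgm.monotoneOn hz ha ha.1)
    · exact hg0.symm.le.trans (hgm.monotoneOn hz hb hb.1)
  have hB : ∀ τ ∈ Ioo 0 (γ * T), HasDerivAt (PhiF μ T α γ) (psiF μ T α γ τ) τ := by
    intro τ hτ
    refine intervalIntegral.integral_hasDerivAt_right ?_
        (hpsico.stronglyMeasurableAtFilter isOpen_Ioo _ hτ)
        (hA τ hτ).continuousAt
    apply MonotoneOn.intervalIntegrable
    apply hpsim.mono
    rw [uIcc_of_le hτ.1.le]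
    intro x hx
    exact ⟨hx.1, hx.2.trans_lt hτ.2⟩
  intro τ hτ
  refine ⟨hA τ hτ, hB τ hτ, ?_⟩
  rw [(hB τ hτ).deriv]
  refine (hA τ hτ).congr_of_eventuallyEq ?_
  filter_upwards [Ioo_mem_nhds hτ.1 hτ.2] with x hx using (hB x hx).deriv
end

section
/- Let μ be a modulus of continuity satisfying the Osgood condition, T > 0, α ∈ (0,1), γ > 0, and define ψ_γ(τ) = φ⁻¹(γ ∫₀^{τ/γ} (T−s)^{α−1} ds) and Φ_γ(τ) = ∫₀^τ ψ_γ(σ) dσ for τ ∈ [0, γT). Then Φ_γ'(τ) = ψ_γ(τ) ≥ 1 for all τ ∈ [0, γT), and for every t ∈ (0, T/2] one has Φ_γ''(γ(T−t)) ≥ t^{α−1} ≥ (T/2)^{α−1}. -/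
open Set

/-- clamped reciprocal of the modulus -/
noncomputable def nuF (μ : ℝ → ℝ) (y : ℝ) : ℝ := 1 / μ (min y 1)

noncomputable def KF (μ : ℝ → ℝ) (x : ℝ) : ℝ := ∫ s in (1/x)..1, nuF μ s

lemma mu_ge {μ : ℝ → ℝ} (hconc : ConcaveOn ℝ (Icc 0 1) μ) (h0 : μ 0 = 0) (h1 : μ 1 = 1)
    {s : ℝ} (hs : s ∈ Icc (0:ℝ) 1) : s ≤ μ s := by
  have h := hconc.2 (show (0:ℝ) ∈ Icc (0:ℝ) 1 by simp) (show (1:ℝ) ∈ Icc (0:ℝ) 1 by simp)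
    (show 0 ≤ 1 - s by linarith [hs.2]) hs.1 (by ring)
  simpa [h0, h1] using h

lemma nu_pos {μ : ℝ → ℝ} (hge : ∀ s ∈ Icc (0:ℝ) 1, s ≤ μ s) {y : ℝ} (hy : 0 < y) :
    0 < nuF μ y := by
  have h : 0 < min y 1 := lt_min hy one_pos
  have := hge (min y 1) ⟨h.le, min_le_right _ _⟩
  unfold nuF
  have : 0 < μ (min y 1) := by linarith
  positivity

lemma nu_cont {μ : ℝ → ℝ} (hcont : ContinuousOn μ (Icc 0 1))
    (hge : ∀ s ∈ Icc (0:ℝ) 1, s ≤ μ s) : ContinuousOn (nuF μ) (Ioi 0) := by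
  unfold nuF
  apply ContinuousOn.div continuousOn_const
  · apply hcont.comp (by fun_prop)
    intro y hy
    exact ⟨le_min (le_of_lt hy) zero_le_one, min_le_right _ _⟩
  · intro y hy
    have h : 0 < min y 1 := lt_min hy one_pos
    have := hge (min y 1) ⟨h.le, min_le_right _ _⟩
    linarith

lemma nu_int {μ : ℝ → ℝ} (hc : ContinuousOn (nuF μ) (Ioi 0)) {a b : ℝ} (ha : 0 < a)
    (hb : 0 < b) : IntervalIntegrable (nuF μ) MeasureTheory.volume a b := by
  apply ContinuousOn.intervalIntegrable
  apply hc.mono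
  intro x hx
  exact lt_of_lt_of_le (lt_min ha hb) hx.1

lemma K_deriv {μ : ℝ → ℝ} (hc : ContinuousOn (nuF μ) (Ioi 0)) {x : ℝ} (hx : 0 < x) :
    HasDerivAt (KF μ) (nuF μ (1/x) / x^2) x := by
  have hx' : 0 < 1 / x := by positivity
  have h1 : HasDerivAt (fun u => ∫ s in u..1, nuF μ s) (-nuF μ (1/x)) (1/x) := by
    apply intervalIntegral.integral_hasDerivAt_left (nu_int hc hx' one_pos)
    · exact hc.stronglyMeasurableAtFilter isOpen_Ioi _ hx'
    · exact hc.continuousAt (Ioi_mem_nhds hx')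
  have h2 : HasDerivAt (fun x : ℝ => 1 / x) (-(x^2)⁻¹) x := by
    simpa using hasDerivAt_inv hx.ne'
  have h3 := h1.comp x h2
  refine HasDerivAt.congr_deriv h3 ?_
  rw [div_eq_mul_inv]
  ring

lemma K_mono {μ : ℝ → ℝ} (hc : ContinuousOn (nuF μ) (Ioi 0))
    (hp : ∀ y, 0 < y → 0 < nuF μ y) : StrictMonoOn (KF μ) (Ici 1) := by
  apply strictMonoOn_of_deriv_pos (convex_Ici 1)
  · intro x hx
    exact (K_deriv hc (lt_of_lt_of_le one_pos hx)).continuousAt.continuousWithinAt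
  · intro x hx
    rw [interior_Ici] at hx
    have hx0 : 0 < x := lt_trans one_pos hx
    rw [(K_deriv hc hx0).deriv]
    have := hp (1/x) (by positivity)
    positivity

lemma K_eq (μ : ℝ → ℝ) {x : ℝ} (hx : 1 ≤ x) : phiF μ x = KF μ x := by
  unfold phiF KF
  apply intervalIntegral.integral_congr
  intro s hs
  have : 1 / x ≤ 1 := by
    rw [div_le_one (by linarith)]; exact hx
  rw [uIcc_of_le this] at hs
  simp [nuF, min_eq_left hs.2]

lemma K_one (μ : ℝ → ℝ) : KF μ 1 = 0 := by simp [KF]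

lemma K_unbdd {μ : ℝ → ℝ} (hc : ContinuousOn (nuF μ) (Ioi 0))
    (hp : ∀ y, 0 < y → 0 < nuF μ y)
    (hOsgood : (∫⁻ s in Ioc (0:ℝ) 1, ENNReal.ofReal (1 / μ s)) = ⊤) (B : ℝ) :
    ∃ x, 1 ≤ x ∧ B ≤ KF μ x := by
  by_contra! hcon
  have hI : MeasureTheory.IntegrableOn (nuF μ) (Ioc 0 1) := by
    apply MeasureTheory.integrableOn_Ioc_of_intervalIntegral_norm_bounded_left
      (l := Filter.atTop) (a := fun n : ℕ => 1 / ((n:ℝ) + 1)) (I := B)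
    · intro n
      have h := nu_int hc (a := 1 / ((n:ℝ) + 1)) (b := 1) (by positivity) one_pos
      exact h.1
    · exact tendsto_one_div_add_atTop_nhds_zero_nat
    · filter_upwards with n
      have hle : 1 / ((n:ℝ) + 1) ≤ 1 := by
        rw [div_le_one (by positivity)]; linarith [(Nat.cast_nonneg n : (0:ℝ) ≤ n)]
      have h := hcon ((n:ℝ) + 1) (by linarith [(Nat.cast_nonneg n : (0:ℝ) ≤ n)])
      refine le_trans (le_of_eq ?_) h.le
      unfold KF
      rw [intervalIntegral.integral_of_le hle]
      apply MeasureTheory.setIntegral_congr_fun measurableSet_Ioc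
      intro s hs
      have hs0 : 0 < s := lt_of_le_of_lt (by positivity) hs.1
      exact Real.norm_of_nonneg (hp s hs0).le
  have hfin := hI.lintegral_lt_top
  have : (∫⁻ s in Ioc (0:ℝ) 1, ENNReal.ofReal (nuF μ s))
      = ∫⁻ s in Ioc (0:ℝ) 1, ENNReal.ofReal (1 / μ s) := by
    apply MeasureTheory.setLIntegral_congr_fun measurableSet_Ioc
    intro s hs
    simp [nuF, min_eq_left hs.2]
  rw [this, hOsgood] at hfin
  exact lt_irrefl _ hfin

/-- extension of `φ` to a bijection of the line -/
noncomputable def EF (μ : ℝ → ℝ) (x : ℝ) : ℝ := if 1 ≤ x then KF μ x else x - 1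

lemma E_mono {μ : ℝ → ℝ} (hm : StrictMonoOn (KF μ) (Ici 1)) : StrictMono (EF μ) := by
  intro x y hxy
  unfold EF
  split_ifs with h1 h2 h2
  · exact hm h1 h2 hxy
  · linarith
  · have := hm.monotoneOn (mem_Ici.2 le_rfl) h2 h2
    rw [K_one] at this
    linarith
  · linarith

lemma K_surj {μ : ℝ → ℝ} (hc : ContinuousOn (nuF μ) (Ioi 0))
    (hu : ∀ B, ∃ x, 1 ≤ x ∧ B ≤ KF μ x) {y : ℝ} (hy : 0 ≤ y) : ∃ x, 1 ≤ x ∧ KF μ x = y := by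
  obtain ⟨b, hb, hB⟩ := hu y
  have hcK : ContinuousOn (KF μ) (Icc 1 b) := fun x hx =>
    (K_deriv hc (lt_of_lt_of_le one_pos hx.1)).continuousAt.continuousWithinAt
  obtain ⟨x, hx, hxy⟩ := intermediate_value_Icc hb hcK ⟨by rw [K_one]; exact hy, hB⟩
  exact ⟨x, hx.1, hxy⟩

lemma E_surj {μ : ℝ → ℝ} (hs : ∀ y, 0 ≤ y → ∃ x, 1 ≤ x ∧ KF μ x = y) :
    Function.Surjective (EF μ) := by
  intro y
  rcases le_or_gt 0 y with hy | hy
  · obtain ⟨x, hx, hxy⟩ := hs y hy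
    exact ⟨x, by simp [EF, hx, hxy]⟩
  · refine ⟨y + 1, ?_⟩
    have : ¬ (1 ≤ y + 1) := by linarith
    simp [EF, this]

noncomputable def GF (T α γ τ : ℝ) : ℝ := γ * ((T ^ α - (T - τ/γ) ^ α) / α)

lemma G_eq {T α γ τ : ℝ} (hα : α ∈ Ioo (0:ℝ) 1) :
    γ * (∫ s in (0:ℝ)..(τ/γ), (T - s) ^ (α - 1)) = GF T α γ τ := by
  unfold GF
  rw [intervalIntegral.integral_comp_sub_left (fun u : ℝ => u ^ (α - 1)) T,
    integral_rpow (Or.inl (by linarith [hα.1]))]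
  simp

lemma G_nonneg {T α γ τ : ℝ} (hα : α ∈ Ioo (0:ℝ) 1) (hγ : 0 < γ)
    (hτ : τ ∈ Ico 0 (γ * T)) : 0 ≤ GF T α γ τ := by
  unfold GF
  have h1 : τ / γ < T := by rw [div_lt_iff₀ hγ]; linarith [hτ.2]
  have h2 : 0 ≤ τ / γ := div_nonneg hτ.1 hγ.le
  have h3 : (T - τ/γ) ^ α ≤ T ^ α :=
    Real.rpow_le_rpow (by linarith) (by linarith) hα.1.le
  have := hα.1
  have : 0 ≤ T ^ α - (T - τ/γ) ^ α := by linarith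
  positivity

lemma G_cont {T α γ : ℝ} (hα : α ∈ Ioo (0:ℝ) 1) : Continuous (GF T α γ) := by
  unfold GF
  have : Continuous fun τ : ℝ => (T - τ/γ) ^ α :=
    Continuous.rpow_const (by fun_prop) (fun _ => Or.inr hα.1.le)
  fun_prop

lemma G_deriv {T α γ τ : ℝ} (hα : α ∈ Ioo (0:ℝ) 1) (hγ : 0 < γ) (h : 0 < T - τ/γ) :
    HasDerivAt (GF T α γ) ((T - τ/γ) ^ (α - 1)) τ := by
  unfold GF
  have h1 : HasDerivAt (fun τ : ℝ => T - τ/γ) (-(1/γ)) τ :=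
    ((hasDerivAt_id τ).div_const γ).const_sub T
  have h2 := (((h1.rpow_const (p := α) (Or.inl h.ne')).const_sub (T ^ α)).div_const α).const_mul γ
  refine HasDerivAt.congr_deriv h2 ?_
  have := hα.1
  field_simp

/-- Let `μ` be a modulus of continuity satisfying the Osgood condition,
`T > 0`, `α ∈ (0,1)`, `γ > 0`. Then `Φ_γ'(τ) = ψ_γ(τ) ≥ 1` for all `τ ∈ [0, γT)`,
and for every `t ∈ (0, T/2]` one has `Φ_γ''(γ(T−t)) ≥ t^{α−1} ≥ (T/2)^{α−1}`
(where `Φ_γ'' = ψ_γ'`). -/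
theorem stmt_7 (μ : ℝ → ℝ)
    (hcont : ContinuousOn μ (Icc 0 1))
    (hconc : ConcaveOn ℝ (Icc 0 1) μ)
    (hmono : StrictMonoOn μ (Icc 0 1))
    (hmaps : MapsTo μ (Icc 0 1) (Icc 0 1))
    (h0 : μ 0 = 0) (h1 : μ 1 = 1)
    (hOsgood : (∫⁻ s in Ioc (0:ℝ) 1, ENNReal.ofReal (1 / μ s)) = ⊤)
    (T α γ : ℝ) (hT : 0 < T) (hα : α ∈ Ioo (0:ℝ) 1) (hγ : 0 < γ) :
    (∀ τ ∈ Ico 0 (γ * T),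
      1 ≤ psiF μ T α γ τ ∧
      HasDerivWithinAt (PhiF μ T α γ) (psiF μ T α γ τ) (Ico 0 (γ * T)) τ) ∧
    (∀ t ∈ Ioc (0:ℝ) (T/2),
      ∃ d : ℝ, HasDerivAt (psiF μ T α γ) d (γ * (T - t)) ∧
        t ^ (α - 1) ≤ d ∧ (T/2) ^ (α - 1) ≤ t ^ (α - 1)) := by
  have hge : ∀ s ∈ Icc (0:ℝ) 1, s ≤ μ s := fun s hs => mu_ge hconc h0 h1 hs
  have hc := nu_cont hcont hge
  have hp : ∀ y, 0 < y → 0 < nuF μ y := fun y hy => nu_pos hge hy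
  have hm := K_mono hc hp
  have hs : ∀ y, 0 ≤ y → ∃ x, 1 ≤ x ∧ KF μ x = y :=
    fun y hy => K_surj hc (K_unbdd hc hp hOsgood) hy
  have hE := E_mono hm
  let e : ℝ ≃o ℝ := hE.orderIsoOfSurjective _ (E_surj hs)
  have he : ∀ x, e x = EF μ x := fun x => rfl
  have hpsi : ∀ τ ∈ Ico 0 (γ * T), 1 ≤ psiF μ T α γ τ ∧
      psiF μ T α γ τ = e.symm (GF T α γ τ) := by
    intro τ hτ
    have hG := G_nonneg hα hγ hτ
    obtain ⟨x, hx, hxy⟩ := hs _ hG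
    have hex : ∃ a ∈ Ici (1:ℝ), phiF μ a = GF T α γ τ := ⟨x, hx, by rw [K_eq μ hx, hxy]⟩
    have hmem := Function.invFunOn_mem hex
    have heq := Function.invFunOn_eq hex
    unfold psiF
    rw [G_eq hα]
    refine ⟨hmem, ?_⟩
    rw [K_eq μ hmem] at heq
    rw [OrderIso.eq_symm_apply, he, EF, if_pos (mem_Ici.1 hmem), heq]
  have hFc : Continuous fun τ => e.symm (GF T α γ τ) := e.symm.continuous.comp (G_cont hα)
  refine ⟨fun τ hτ => ⟨(hpsi τ hτ).1, ?_⟩, ?_⟩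
  · have hd := (intervalIntegral.integral_hasDerivAt_right (hFc.intervalIntegrable 0 τ)
      (hFc.stronglyMeasurableAtFilter _ _) hFc.continuousAt).hasDerivWithinAt
        (s := Ico 0 (γ * T))
    rw [(hpsi τ hτ).2]
    have hcg : ∀ x ∈ Ico 0 (γ * T), PhiF μ T α γ x = ∫ σ in (0:ℝ)..x, e.symm (GF T α γ σ) := by
      intro x hx
      unfold PhiF
      apply intervalIntegral.integral_congr
      intro σ hσ
      rw [uIcc_of_le hx.1] at hσ
      exact (hpsi σ ⟨hσ.1, lt_of_le_of_lt hσ.2 hx.2⟩).2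
    exact hd.congr hcg (hcg τ hτ)
  · intro t ht
    have ht0 := ht.1
    have ht2 := ht.2
    set τ := γ * (T - t) with hτd
    have hdiv : T - τ / γ = t := by rw [hτd]; field_simp; ring
    have hτ : τ ∈ Ioo 0 (γ * T) :=
      ⟨mul_pos hγ (by linarith), mul_lt_mul_of_pos_left (by linarith) hγ⟩
    have hGpos : 0 < GF T α γ τ := by
      unfold GF
      rw [hdiv]
      have := Real.rpow_lt_rpow ht0.le (show t < T by linarith) hα.1
      have h3 : 0 < T ^ α - t ^ α := by linarith
      have := hα.1
      positivity
    set x := e.symm (GF T α γ τ) with hx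
    have hx1 : 1 < x := by
      rw [hx, OrderIso.lt_symm_apply, he, EF, if_pos le_rfl, K_one]
      exact hGpos
    have hx0 : 0 < x := by linarith
    have hKd := K_deriv hc hx0
    have hed : HasDerivAt e (nuF μ (1/x) / x^2) x := by
      apply hKd.congr_of_eventuallyEq
      filter_upwards [Ioi_mem_nhds hx1] with z hz
      rw [he, EF, if_pos (le_of_lt hz)]
    have hnu := hp (1/x) (by positivity)
    have hsd : HasDerivAt e.symm (nuF μ (1/x) / x^2)⁻¹ (GF T α γ τ) :=
      HasDerivAt.of_local_left_inverse e.symm.continuous.continuousAt hed (by positivity)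
        (Filter.Eventually.of_forall fun y => e.apply_symm_apply y)
    have hGd := G_deriv (T := T) (τ := τ) hα hγ (by rw [hdiv]; exact ht0)
    rw [hdiv] at hGd
    have hcomp := hsd.comp τ hGd
    refine ⟨_, hcomp.congr_of_eventuallyEq ?_, ?_, ?_⟩
    · filter_upwards [Ioo_mem_nhds hτ.1 hτ.2] with z hz
      exact (hpsi z ⟨hz.1.le, hz.2⟩).2
    · have htp : 0 < t ^ (α - 1) := Real.rpow_pos_of_pos ht0 _
      have hle : 1 / x ≤ 1 := by rw [div_le_one hx0]; exact hx1.le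
      have hmu := hge (1/x) ⟨by positivity, hle⟩
      have h1x : 0 < 1 / x := by positivity
      have hmp : 0 < μ (1/x) := by linarith
      have hval : (nuF μ (1/x) / x^2)⁻¹ = x^2 * μ (1/x) := by
        rw [nuF, min_eq_left hle]
        field_simp
      rw [hval]
      have : x ≤ x^2 * μ (1/x) := by
        calc x = x^2 * (1/x) := by field_simp
          _ ≤ _ := by gcongr
      exact le_mul_of_one_le_left htp.le (by linarith)
    · exact Real.rpow_le_rpow_of_nonpos ht0 ht2 (by linarith [hα.2])
end
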